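/- arXiv:0906.2848 — 2 statements merged into one kernel-verified Lean document; each statement's English description precedes it below -/
import Mathlib

section
/- As formal power series in ℤ⟦q⟧: ψ(q)·(φ(q)² − φ(q⁵)²) = 4q³·ψ(q⁵)·ψ(q²⁰)·φ(q²) + 4q·ψ(q⁴)·ψ(q⁵)·φ(q¹⁰) + 8q²·ψ(q²)·ψ(q⁵)·ψ(q¹⁰). -/
open PowerSeries

/-- `phi k` is the theta series `φ(q^k) = ∑_{m ∈ ℤ} q^(k·m²)`, i.e. the formal power
series whose coefficient of `qⁿ` is `#{m ∈ ℤ : n = k·m²}`. -/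
noncomputable def phi (k : ℕ) : PowerSeries ℤ :=
  PowerSeries.mk fun n => ({m : ℤ | (n : ℤ) = k * m ^ 2}.ncard : ℤ)

/-- `psi k` is the theta series `ψ(q^k) = ∑_{m ≥ 0} q^(k·m(m+1)/2)`, i.e. the formal
power series whose coefficient of `qⁿ` is `#{m ∈ ℤ, m ≥ 0 : n = k·m(m+1)/2}`. -/
noncomputable def psi (k : ℕ) : PowerSeries ℤ :=
  PowerSeries.mk fun n => ({m : ℤ | 0 ≤ m ∧ (n : ℤ) = k * (m * (m + 1) / 2)}.ncard : ℤ)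


namespace ThetaAux
open Filter PowerSeries.WithPiTopology Topology

/-- triangular numbers on all integers -/
def tri (n : ℤ) : ℕ := (n * (n + 1) / 2).toNat

lemma tri_spec (n : ℤ) : 2 * (tri n : ℤ) = n * (n + 1) := by
  have h : Even (n * (n + 1)) := Int.even_mul_succ_self n
  obtain ⟨c, hc⟩ := h
  have hn : 0 ≤ n * (n + 1) := by
    rcases le_or_gt 0 n with h | h <;> nlinarith
  unfold tri
  omega

/-- locally finite families -/
def LF {ι : Type*} (f : ι → ℤ⟦X⟧) : Prop := ∀ d : ℕ, {i | ¬ (X : ℤ⟦X⟧) ^ d ∣ f i}.Finite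

lemma LF.summable {ι : Type*} {f : ι → ℤ⟦X⟧} (h : LF f) : Summable f := by
  rw [summable_iff_summable_coeff]
  intro d
  apply summable_of_hasFiniteSupport
  apply (h (d + 1)).subset
  intro i hi hd
  apply hi
  exact (X_pow_dvd_iff.1 hd) d (by omega)

lemma LF.mul {ι κ : Type*} {f : ι → ℤ⟦X⟧} {g : κ → ℤ⟦X⟧} (hf : LF f) (hg : LF g) :
    LF (fun x : ι × κ => f x.1 * g x.2) := by
  intro d
  apply ((hf d).prod (hg d)).subset
  rintro ⟨i, j⟩ h
  exact ⟨fun h1 => h (h1.mul_right _), fun h1 => h (h1.mul_left _)⟩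

lemma LF.hasSum_mul {ι κ : Type*} {f : ι → ℤ⟦X⟧} {g : κ → ℤ⟦X⟧} (hf : LF f) (hg : LF g)
    {a b : ℤ⟦X⟧} (ha : HasSum f a) (hb : HasSum g b) :
    HasSum (fun x : ι × κ => f x.1 * g x.2) (a * b) :=
  ha.mul hb (hf.mul hg).summable

/-- summand of theta -/
noncomputable def tt (s : ℤˣ) (i j : ℕ) (n : ℤ) : ℤ⟦X⟧ :=
  ((s ^ n : ℤˣ) : ℤ) • X ^ (i * tri n + j * tri (n - 1))

noncomputable def th (s : ℤˣ) (i j : ℕ) : ℤ⟦X⟧ := ∑' n, tt s i j n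

lemma tt_LF (s : ℤˣ) (i j : ℕ) (hi : 1 ≤ i) : LF (tt s i j) := by
  intro d
  apply (Set.finite_Icc (-2 * (d : ℤ) - 2) (2 * d + 2)).subset
  intro n hn
  have h1 : tri n < d := by
    by_contra h
    apply hn
    unfold tt
    apply dvd_smul_of_dvd
    apply pow_dvd_pow
    nlinarith [Nat.zero_le (j * tri (n - 1))]
  have h2 := tri_spec n
  constructor <;> nlinarith

lemma th_hasSum (s : ℤˣ) (i j : ℕ) (hi : 1 ≤ i) : HasSum (tt s i j) (th s i j) :=
  (tt_LF s i j hi).summable.hasSum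

@[to_additive]
lemma hasProd_fin {ι κ M : Type*} [Fintype κ] [DecidableEq κ] [CommMonoid M] [TopologicalSpace M]
    [ContinuousMul M]
    (f : κ × ι → M) (v : κ → M) (h : ∀ r, HasProd (fun i => f (r, i)) (v r)) :
    HasProd f (∏ r, v r) := by
  have h1 : ∀ r ∈ (Finset.univ : Finset κ),
      HasProd (fun x : κ × ι => if x.1 = r then f x else 1) (v r) := by
    intro r _
    have hinj : Function.Injective (fun i : ι => (r, i)) := fun a b h => by simpa using h
    rw [← hinj.hasProd_iff]
    · simpa [Function.comp_def] using h r
    · rintro ⟨a, b⟩ hx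
      have : a ≠ r := fun h => hx ⟨b, by simp [h]⟩
      simp [this]
  have h2 := hasProd_prod h1
  simpa using h2

lemma hasSum_part {κ ι ι' : Type*} [Fintype κ] [DecidableEq κ] (F : ι' → ℤ⟦X⟧)
    (g : κ × ι → ι') (hg : Function.Bijective g)
    (v : κ → ℤ⟦X⟧) (h : ∀ r, HasSum (fun i => F (g (r, i))) (v r)) :
    HasSum F (∑ r, v r) := by
  have := hasSum_fin (fun x => F (g x)) v h
  exact (Equiv.ofBijective g hg).hasSum_iff.1 this

noncomputable def Q (s : ℤˣ) (i m : ℕ) : ℤ⟦X⟧ := ∏' n : ℕ, (1 + ((s : ℤˣ) : ℤ) • X ^ (i + m * n))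

lemma Q_mult (s : ℤˣ) (i m : ℕ) (hm : 1 ≤ m) :
    Multipliable (fun n : ℕ => (1 + ((s : ℤˣ) : ℤ) • X ^ (i + m * n) : ℤ⟦X⟧)) := by
  apply multipliable_one_add_of_tendsto_order_atTop_nhds_top
  refine ENat.tendsto_nhds_top_iff_natCast_lt.mpr fun n ↦ eventually_atTop.mpr ⟨n + 1, ?_⟩
  intro b hb
  have : ((n + 1 : ℕ) : ℕ∞) ≤ order (((s : ℤˣ) : ℤ) • X ^ (i + m * b) : ℤ⟦X⟧) := by
    apply nat_le_order
    intro k hk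
    have : k ≠ i + m * b := by nlinarith
    rw [map_zsmul, coeff_X_pow, if_neg this, smul_zero]
  refine lt_of_lt_of_le ?_ this
  exact_mod_cast Nat.lt_succ_self n

lemma Q_hasProd (s : ℤˣ) (i m : ℕ) (hm : 1 ≤ m) :
    HasProd (fun n : ℕ => (1 + ((s : ℤˣ) : ℤ) • X ^ (i + m * n) : ℤ⟦X⟧)) (Q s i m) :=
  (Q_mult s i m hm).hasProd

lemma Q_const (s : ℤˣ) (i m : ℕ) (hi : 1 ≤ i) (hm : 1 ≤ m) : constantCoeff (Q s i m) = 1 := by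
  have h := (Q_hasProd s i m hm).map (constantCoeff (R := ℤ)) (continuous_constantCoeff ℤ)
  have h2 : (⇑(constantCoeff (R := ℤ)) ∘ fun n : ℕ => (1 + ((s : ℤˣ) : ℤ) • X ^ (i + m * n) : ℤ⟦X⟧))
      = fun _ => 1 := by
    funext n
    have : i + m * n ≠ 0 := by omega
    simp [Function.comp]
    omega
  rw [h2] at h
  exact h.unique hasProd_one

lemma Q_ne (s : ℤˣ) (i m : ℕ) (hi : 1 ≤ i) (hm : 1 ≤ m) : Q s i m ≠ 0 := by
  intro h
  have := Q_const s i m hi hm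
  simp [h] at this

noncomputable def QF (s : ℤˣ) (n : ℕ) : ℤ⟦X⟧ := 1 + ((s : ℤˣ) : ℤ) • X ^ n

lemma Q_hasProd' (s : ℤˣ) (i m : ℕ) (hm : 1 ≤ m) :
    HasProd (fun n : ℕ => QF s (i + m * n)) (Q s i m) := Q_hasProd s i m hm

lemma hasProd_residue {M : Type*} [CommMonoid M] [TopologicalSpace M] [ContinuousMul M]
    (F : ℕ → M) (i m N : ℕ) (hN : 1 ≤ N) (v : Fin N → M)
    (h0 : ∀ r : Fin N, HasProd (fun n : ℕ => F (i + (r : ℕ) * m + (N * m) * n)) (v r)) :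
    HasProd (fun n => F (i + m * n)) (∏ r, v r) := by
  have : NeZero N := ⟨by omega⟩
  have h := hasProd_fin (fun x : Fin N × ℕ => F (i + (x.1 : ℕ) * m + (N * m) * x.2)) v h0
  have h2 := ((Nat.divModEquiv N).trans (Equiv.prodComm _ _)).hasProd_iff.2 h
  convert h2 using 1
  funext n
  simp only [Function.comp, Nat.divModEquiv, Equiv.trans_apply, Equiv.coe_fn_mk,
    Equiv.prodComm_apply, Prod.swap]
  congr 1
  simp only [Fin.val_ofNat]
  conv_lhs => rw [← Nat.mod_add_div n N]
  ring

lemma Q_split (s : ℤˣ) (i m N : ℕ) (hm : 1 ≤ m) (hN : 1 ≤ N) :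
    Q s i m = ∏ r : Fin N, Q s (i + (r : ℕ) * m) (N * m) := by
  refine (Q_hasProd' s i m hm).unique ?_
  apply hasProd_residue (QF s) i m N hN
  intro r
  exact Q_hasProd' s (i + (r : ℕ) * m) (N * m) (Nat.mul_pos hN hm)

lemma Q_mul (i m : ℕ) (hm : 1 ≤ m) : Q 1 i m * Q (-1) i m = Q (-1) (2 * i) (2 * m) := by
  refine ((Q_hasProd 1 i m hm).mul (Q_hasProd (-1) i m hm)).unique ?_
  convert Q_hasProd (-1) (2 * i) (2 * m) (by omega) using 1
  funext n
  simp
  ring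

section finite
variable {R : Type*} [CommRing R]

/-- Gaussian binomials -/
def gb (p : R) : ℕ → ℕ → R
  | _, 0 => 1
  | 0, _ + 1 => 0
  | m + 1, j + 1 => gb p m j + p ^ (j + 1) * gb p m (j + 1)

/-- finite Pochhammer product -/
def poc (p : R) (m : ℕ) : R := ∏ t ∈ Finset.range m, (1 - p ^ (t + 1))

lemma gb_zero (p : R) (m : ℕ) : gb p m 0 = 1 := by cases m <;> simp [gb]

lemma gb_succ (p : R) (m j : ℕ) :
    gb p (m + 1) (j + 1) = gb p m j + p ^ (j + 1) * gb p m (j + 1) := rfl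

lemma gb_gt (p : R) (m j : ℕ) (h : m < j) : gb p m j = 0 := by
  induction m generalizing j with
  | zero => cases j with
    | zero => omega
    | succ j => simp [gb]
  | succ m ih => cases j with
    | zero => omega
    | succ j => simp [gb, ih j (by omega), ih (j + 1) (by omega)]

lemma gb_self (p : R) (m : ℕ) : gb p m m = 1 := by
  induction m with
  | zero => simp [gb]
  | succ m ih => simp [gb, ih, gb_gt p m (m + 1) (by omega)]

lemma poc_succ (p : R) (m : ℕ) : poc p (m + 1) = poc p m * (1 - p ^ (m + 1)) := by
  simp [poc, Finset.prod_range_succ]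

lemma gb_poc (p : R) (n : ℕ) : ∀ j l, j + l = n → gb p (j + l) j * poc p j * poc p l = poc p (j + l) := by
  induction n with
  | zero => 
    intro j l h
    obtain ⟨rfl, rfl⟩ : j = 0 ∧ l = 0 := by omega
    simp [gb, poc]
  | succ n ih =>
    intro j l h
    rcases j with _ | j
    · simp [gb_zero, poc]
    rcases l with _ | l
    · simp [gb_self, poc]
    have h1 := ih j (l + 1) (by omega)
    have h2 := ih (j + 1) l (by omega)
    have e : j + 1 + (l + 1) = (j + l + 1) + 1 := by ring
    rw [e, gb_succ]
    rw [show j + (l + 1) = j + l + 1 by ring] at h1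
    rw [show j + 1 + l = j + l + 1 by ring] at h2
    rw [poc_succ p (j + l + 1), poc_succ p j, poc_succ p l]
    rw [poc_succ p l] at h1
    rw [poc_succ p j] at h2
    linear_combination (1 - p ^ (j + 1)) * h1 + p ^ (j + 1) * (1 - p ^ (l + 1)) * h2

lemma cauchy (p : R) (a : ℕ) : ∀ (x : R) (T : ℕ → R), T 0 = 1 → (∀ k, T (k + 1) = x * p ^ k * T k) →
    ∏ t ∈ Finset.range a, (1 + x * p ^ t) = ∑ j ∈ Finset.range (a + 1), gb p a j * T j := by
  induction a with
  | zero => intro x T h0 h; simp [gb, h0]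
  | succ a ih =>
    intro x T h0 h
    have h1 := ih (x * p) (fun k => p ^ k * T k) (by simp [h0]) (by
      intro k; rw [h]; ring)
    rw [Finset.prod_range_succ', Finset.sum_range_succ']
    have h2 : ∏ t ∈ Finset.range a, (1 + x * p ^ (t + 1)) = ∏ t ∈ Finset.range a, (1 + x * p * p ^ t) := by
      apply Finset.prod_congr rfl; intros; ring
    rw [h2, h1]
    have h3 : ∀ j, gb p (a + 1) (j + 1) * T (j + 1) =
        gb p a j * (p ^ j * T j) * x + gb p a (j + 1) * (p ^ (j + 1) * T (j + 1)) := by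
      intro j; simp only [gb]; rw [h]; ring
    simp only [h3, Finset.sum_add_distrib]
    rw [← Finset.sum_mul]
    have h4 := Finset.sum_range_succ' (fun j => gb p a j * (p ^ j * T j)) (a + 1)
    rw [Finset.sum_range_succ] at h4
    rw [gb_gt p a (a + 1) (by omega)] at h4
    simp only [gb_zero, h0] at h4 ⊢
    linear_combination h4

lemma finite_jtp (p x y : R) (hp : p = x * y) (T : ℤ → R) (h0 : T 0 = 1)
    (h1 : ∀ k : ℕ, T (k + 1) = x * p ^ k * T k) (h2 : ∀ k : ℕ, T (-(k + 1)) = y * p ^ k * T (-k))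
    (a b : ℕ) :
    (∏ t ∈ Finset.range a, (1 + x * p ^ t)) * ∏ t ∈ Finset.range b, (1 + y * p ^ t) =
      ∑ j ∈ Finset.range (a + b + 1), gb p (a + b) j * T ((j : ℤ) - b) := by
  induction b with
  | zero =>
    simp only [Finset.prod_range_zero, mul_one, add_zero, Nat.cast_zero, sub_zero]
    exact cauchy p a x (fun k => T k) h0 (by intro k; simpa using h1 k)
  | succ b ih =>
    rw [Finset.prod_range_succ, ← mul_assoc, ih]
    have key : ∀ j : ℕ, y * p ^ b * T ((j : ℤ) - b) = p ^ j * T ((j : ℤ) - (b + 1 : ℕ)) := by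
      intro j
      rcases le_or_gt j b with h | h
      · obtain ⟨c, rfl⟩ := Nat.exists_eq_add_of_le h
        have := h2 c
        rw [show ((j : ℤ) - (j + c + 1 : ℕ)) = -((c : ℤ) + 1) by push_cast; ring, this,
          show ((j : ℤ) - (j + c : ℕ)) = -(c : ℤ) by push_cast; ring]
        ring
      · obtain ⟨c, rfl⟩ := Nat.exists_eq_add_of_le (show b + 1 ≤ j from h)
        have := h1 c
        rw [show (((b + 1 + c : ℕ) : ℤ) - (b : ℕ)) = (c : ℤ) + 1 by push_cast; ring, this,
          show (((b + 1 + c : ℕ) : ℤ) - (b + 1 : ℕ)) = (c : ℤ) by push_cast; ring]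
        rw [pow_add, pow_succ]
        linear_combination (- (p ^ b * p ^ c * T c)) * hp
    rw [mul_add, mul_one, Finset.sum_mul]
    have e : ∀ j : ℕ, gb p (a + b) j * T ((j : ℤ) - b) * (y * p ^ b) =
        gb p (a + b) j * (p ^ j * T ((j : ℤ) - (b + 1 : ℕ))) := by
      intro j; rw [← key]; ring
    simp only [e]
    rw [show a + (b + 1) + 1 = (a + b + 1) + 1 by ring, Finset.sum_range_succ' _ (a + b + 1)]
    rw [show a + (b + 1) = (a + b) + 1 by ring]
    have h3 : ∀ j : ℕ, gb p (a + b + 1) (j + 1) * T (((j + 1 : ℕ) : ℤ) - (b + 1 : ℕ)) =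
        gb p (a + b) j * T ((j : ℤ) - b) +
         gb p (a + b) (j + 1) * (p ^ (j + 1) * T (((j + 1 : ℕ) : ℤ) - (b + 1 : ℕ))) := by
      intro j
      simp only [gb]
      rw [show (((j + 1 : ℕ) : ℤ) - (b + 1 : ℕ)) = (j : ℤ) - b by push_cast; ring]
      ring
    simp only [h3, Finset.sum_add_distrib]
    have h4 := Finset.sum_range_succ'
      (fun j : ℕ => gb p (a + b) j * (p ^ j * T ((j : ℤ) - (b + 1 : ℕ)))) (a + b + 1)
    rw [Finset.sum_range_succ] at h4
    rw [gb_gt p (a + b) (a + b + 1) (by omega)] at h4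
    simp only [gb_zero, pow_zero] at h4 ⊢
    linear_combination h4

lemma poc_dvd (p : R) (m a : ℕ) : p ^ (m + 1) ∣ poc p (m + a) - poc p m := by
  induction a with
  | zero => simp
  | succ a ih =>
    rw [← add_assoc, poc_succ]
    have : poc p (m + a) * (1 - p ^ (m + a + 1)) - poc p m =
      (poc p (m + a) - poc p m) - p ^ (m + 1) * (p ^ a * poc p (m + a)) := by
      rw [show m + a + 1 = (m + 1) + a by ring, pow_add]; ring
    rw [this]
    exact dvd_sub ih (dvd_mul_right _ _)

end finite

lemma poc_unit (c m : ℕ) (hc : 1 ≤ c) : IsUnit (poc ((X : ℤ⟦X⟧) ^ c) m) := by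
  rw [isUnit_iff_constantCoeff]
  have : constantCoeff (poc ((X : ℤ⟦X⟧) ^ c) m) = 1 := by
    unfold poc
    rw [map_prod]
    apply Finset.prod_eq_one
    intro t _
    have : c ≠ 0 := by omega
    simp [← pow_mul, this]
  rw [this]
  exact isUnit_one

lemma gb_dvd (c n l m : ℕ) (hc : 1 ≤ c) (hl : l ≤ 2 * n) (h1 : m ≤ l) (h2 : m ≤ 2 * n - l) :
    ((X : ℤ⟦X⟧) ^ c) ^ (m + 1) ∣ poc (X ^ c) (2 * n) * gb (X ^ c) (2 * n) l - 1 := by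
  set p := (X : ℤ⟦X⟧) ^ c with hp
  obtain ⟨a, rfl⟩ := Nat.exists_eq_add_of_le h1
  obtain ⟨b, hb⟩ := Nat.exists_eq_add_of_le h2
  have e : 2 * n = m + a + (m + b) := by omega
  rw [e]
  have hg := gb_poc p _ (m + a) (m + b) rfl
  obtain ⟨u, hu⟩ := poc_dvd p m a
  obtain ⟨v, hv⟩ := poc_dvd p m b
  obtain ⟨w, hw⟩ := poc_dvd p m (a + (m + b))
  rw [← add_assoc m a] at hw
  have hz := poc_unit c m hc
  rw [← hz.dvd_mul_left]
  set g := gb p (m + a + (m + b)) (m + a)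
  set Z := poc p m
  refine ⟨w - g * (u * poc p (m + b) + Z * v) + Z * g * w, ?_⟩
  have ha : poc p (m + a) = Z + p ^ (m + 1) * u := by rw [← hu]; ring
  have hb : poc p (m + b) = Z + p ^ (m + 1) * v := by rw [← hv]; ring
  have hd : poc p (m + a + (m + b)) = Z + p ^ (m + 1) * w := by rw [← hw]; ring
  rw [ha, hd] at hg
  rw [hd]
  linear_combination hg - g * Z * hb

lemma tendsto_zero_of_dvd (f : ℕ → ℤ⟦X⟧) (h : ∀ n, (X : ℤ⟦X⟧) ^ n ∣ f n) :
    Tendsto f atTop (𝓝 0) := by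
  rw [tendsto_iff_coeff_tendsto]
  intro d
  apply tendsto_atTop_of_eventually_const (i₀ := d + 1)
  intro n hn
  rw [map_zero]
  exact X_pow_dvd_iff.1 (h n) d (by omega)

lemma tri_succ (k : ℤ) : (tri k : ℤ) = tri (k - 1) + k := by
  have h1 := tri_spec k
  have h2 := tri_spec (k - 1)
  have : 2 * (tri k : ℤ) = 2 * (tri (k - 1) + k) := by linear_combination h1 - h2
  omega

lemma tri_neg (k : ℤ) : tri (-k) = tri (k - 1) := by
  have h1 := tri_spec (-k)
  have h2 := tri_spec (k - 1)
  have : 2 * (tri (-k) : ℤ) = 2 * (tri (k - 1)) := by linear_combination h1 - h2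
  omega

lemma sum_tendsto {f : ℤ → ℤ⟦X⟧} {v : ℤ⟦X⟧} (h : HasSum f v) :
    Tendsto (fun n : ℕ => ∑ j ∈ Finset.range (2 * n + 1), f ((j : ℤ) - n)) atTop (𝓝 v) := by
  have e : ∀ n : ℕ, ∑ j ∈ Finset.range (2 * n + 1), f ((j : ℤ) - n) =
      ∑ k ∈ Finset.Icc (-(n : ℤ)) n, f k := by
    intro n
    apply Finset.sum_bij (fun (j : ℕ) _ => (j : ℤ) - n)
    · intro a ha; simp at ha ⊢; omega
    · intro a _ b _ h; simpa using h
    · intro b hb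
      simp at hb
      exact ⟨(b + n).toNat, by simp; omega, by omega⟩
    · intros; rfl
  simp only [e]
  refine Tendsto.comp (g := fun s : Finset ℤ => ∑ k ∈ s, f k) h ?_
  refine tendsto_atTop_finset_of_monotone ?_ ?_
  · intro a b hab
    apply Finset.Icc_subset_Icc <;> simp [hab]
  · intro x
    exact ⟨x.natAbs, by rw [Finset.mem_Icc]; omega⟩

lemma tt_succ (s : ℤˣ) (i j : ℕ) (k : ℕ) :
    tt s i j (k + 1) = ((s : ℤ) • X ^ i) * (X ^ (i + j)) ^ k * tt s i j k := by
  unfold tt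
  have e : i * tri ((k : ℤ) + 1) + j * tri ((k : ℤ) + 1 - 1) =
     i + (i + j) * k + (i * tri k + j * tri ((k : ℤ) - 1)) := by
    zify
    have h1 := tri_succ ((k : ℤ) + 1)
    have h2 := tri_succ (k : ℤ)
    rw [add_sub_cancel_right] at *
    rw [h1, h2]; ring
  rw [e, zpow_add_one, Units.val_mul, pow_add, pow_add, pow_mul]
  simp only [zsmul_eq_mul, Int.cast_mul]
  ring

lemma tt_neg (s : ℤˣ) (i j : ℕ) (k : ℤ) : tt s i j (-k) = tt s j i k := by
  unfold tt
  rw [tri_neg, show -k - 1 = -(k + 1) by ring, tri_neg, add_sub_cancel_right, add_comm]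
  congr 2
  rw [zpow_neg]
  rcases Int.units_eq_one_or s with rfl | rfl
  · simp
  · rcases Int.even_or_odd k with h | h <;> simp [h.neg_one_zpow]

lemma jtp (s : ℤˣ) (i j : ℕ) (hi : 1 ≤ i) (hj : 1 ≤ j) :
    th s i j = Q s i (i + j) * Q s j (i + j) * Q (-1) (i + j) (i + j) := by
  set p : ℤ⟦X⟧ := X ^ (i + j) with hp
  have hfin := finite_jtp p ((s : ℤ) • X ^ i) ((s : ℤ) • X ^ j) (by
      rw [hp, pow_add]
      rcases Int.units_eq_one_or s with rfl | rfl <;> simp) (tt s i j) (by simp [tt, tri])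
      (fun k => tt_succ s i j k) (by
        intro k
        rw [tt_neg, tt_neg, tt_succ, add_comm j i])
  have hA : ∀ (s : ℤˣ) (a : ℕ), Tendsto
      (fun n : ℕ => ∏ t ∈ Finset.range n, (1 + ((s : ℤ) • X ^ a) * p ^ t))
      atTop (𝓝 (Q s a (i + j))) := by
    intro s a
    have h := (Q_hasProd s a (i + j) (by omega)).tendsto_prod_nat
    convert h using 4 with n t
    rw [hp, pow_add X a, pow_mul, smul_mul_assoc]
  have hD : Tendsto (fun n : ℕ => poc p (2 * n)) atTop (𝓝 (Q (-1) (i + j) (i + j))) := by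
    have h := hA (-1) (i + j)
    have h' : Tendsto (fun n : ℕ => 2 * n) atTop atTop :=
      tendsto_id.const_mul_atTop' (by norm_num)
    have h2 := h.comp h'
    convert h2 using 2 with n
    unfold poc
    apply Finset.prod_congr rfl
    intro t _
    rw [← hp, pow_succ]
    simp
    ring
  have hL := ((hA s i).mul (hA s j)).mul hD
  have hR := sum_tendsto (th_hasSum s i j hi)
  have hz : Tendsto (fun n : ℕ =>
      (∏ t ∈ Finset.range n, (1 + ((s : ℤ) • X ^ i) * p ^ t)) *
      (∏ t ∈ Finset.range n, (1 + ((s : ℤ) • X ^ j) * p ^ t)) * poc p (2 * n) -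
      ∑ l ∈ Finset.range (2 * n + 1), tt s i j ((l : ℤ) - n)) atTop (𝓝 0) := by
    apply tendsto_zero_of_dvd
    intro n
    rw [hfin n n, ← two_mul, Finset.sum_mul, ← Finset.sum_sub_distrib]
    apply Finset.dvd_sum
    intro l hl
    rw [Finset.mem_range] at hl
    have e : gb p (2 * n) l * tt s i j ((l : ℤ) - n) * poc p (2 * n) - tt s i j ((l : ℤ) - n) =
      (poc p (2 * n) * gb p (2 * n) l - 1) * tt s i j ((l : ℤ) - n) := by ring
    rw [e]
    set k : ℤ := (l : ℤ) - n with hk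
    have hd := gb_dvd (i + j) n l (n - k.natAbs) (by omega) (by omega) (by omega) (by omega)
    have h2 : (X : ℤ⟦X⟧) ^ (i * tri k + j * tri (k - 1)) ∣ tt s i j k := by
      unfold tt
      exact dvd_smul_of_dvd _ dvd_rfl
    refine dvd_trans ?_ (mul_dvd_mul hd h2)
    rw [← pow_mul, ← pow_add]
    apply pow_dvd_pow
    have h3 : k.natAbs ≤ tri k + tri (k - 1) := by
      have h1 := tri_spec k
      have h2 := tri_spec (k - 1)
      have h5 : ((tri k : ℤ) + tri (k - 1)) = k ^ 2 := by
        have : 2 * ((tri k : ℤ) + tri (k - 1)) = 2 * k ^ 2 := by linear_combination h1 + h2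
        omega
      have h4 : (k.natAbs : ℤ) ≤ k ^ 2 := by
        rw [Int.natCast_natAbs, ← sq_abs]
        nlinarith [abs_nonneg k, sq_nonneg (|k|), Int.le_self_sq |k|]
      omega
    have h4 : n ≤ (n - k.natAbs + 1) + k.natAbs := by omega
    have h5 : (n - k.natAbs + 1) ≤ (i + j) * (n - k.natAbs + 1) := Nat.le_mul_of_pos_left _ (by omega)
    have h6 : tri k ≤ i * tri k := Nat.le_mul_of_pos_left _ hi
    have h7 : tri (k - 1) ≤ j * tri (k - 1) := Nat.le_mul_of_pos_left _ hj
    omega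
  have h0 := hL.sub hR
  have := tendsto_nhds_unique h0 hz
  exact (sub_eq_zero.1 this).symm

lemma hs_congr {ι M : Type*} [AddCommMonoid M] [TopologicalSpace M] {f g : ι → M} {a b : M}
    (h : HasSum f a) (h1 : ∀ i, g i = f i) (h2 : a = b) : HasSum g b := by
  rw [← h2, funext h1]; exact h

lemma hasSum_count {ι : Type*} (e : ι → ℕ) (h : LF (fun i => (X : ℤ⟦X⟧) ^ e i)) :
    HasSum (fun i => (X : ℤ⟦X⟧) ^ e i) (PowerSeries.mk fun d => ({i | e i = d}.ncard : ℤ)) := by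
  rw [hasSum_iff_hasSum_coeff]
  intro d
  have hfin : {i | e i = d}.Finite := by
    apply (h (d + 1)).subset
    intro i hi hd
    have := (X_pow_dvd_iff.1 hd) d (by omega)
    simp only [Set.mem_ofPred_eq] at hi
    simp [coeff_X_pow, hi] at this
  have h1 := hasSum_sum_of_ne_finset_zero (s := hfin.toFinset)
    (f := fun i => coeff d ((X : ℤ⟦X⟧) ^ e i)) (by
      intro b hb
      simp at hb
      simp [coeff_X_pow, Ne.symm hb]) (L := SummationFilter.unconditional _)
  refine hs_congr h1 (fun _ => rfl) (Eq.symm ?_)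
  rw [coeff_mk, Set.ncard_eq_toFinset_card _ hfin]
  rw [Finset.sum_congr rfl (g := fun _ => (1 : ℤ))]
  · simp
  · intro i hi
    simp at hi
    simp [coeff_X_pow, hi]

lemma tri_add (k : ℤ) : ((tri k : ℤ) + tri (k - 1)) = k ^ 2 := by
  have h1 := tri_spec k
  have h2 := tri_spec (k - 1)
  have : 2 * ((tri k : ℤ) + tri (k - 1)) = 2 * k ^ 2 := by linear_combination h1 + h2
  omega

lemma tt_one (i j : ℕ) : tt 1 i j = fun n => (X : ℤ⟦X⟧) ^ (i * tri n + j * tri (n - 1)) := by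
  funext n; simp [tt]

lemma phi_eq (k : ℕ) (hk : 1 ≤ k) : phi k = th 1 k k := by
  have h1 := th_hasSum 1 k k hk
  have h2 := tt_LF 1 k k hk
  rw [tt_one] at h1 h2
  rw [h1.unique (hasSum_count _ h2)]
  unfold phi
  ext d
  rw [coeff_mk, coeff_mk]
  congr 2
  ext m
  simp only [Set.mem_ofPred_eq]
  rw [← tri_add, eq_comm]
  norm_cast
  rw [mul_add]

lemma psi_hasSum (k : ℕ) (hk : 1 ≤ k) : HasSum (fun n : ℕ => (X : ℤ⟦X⟧) ^ (k * tri n)) (psi k) := by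
  have h2 := tt_LF 1 k 0 hk
  rw [tt_one] at h2
  have h3 : LF (fun n : ℕ => (X : ℤ⟦X⟧) ^ (k * tri n)) := by
    intro d
    have := (h2 d).preimage (f := fun n : ℕ => (n : ℤ)) (Nat.cast_injective.injOn)
    simpa using this
  have := hasSum_count _ h3
  convert this using 1
  unfold psi
  ext d
  rw [coeff_mk, coeff_mk]
  congr 1
  rw [← Set.ncard_image_of_injective _ (Nat.cast_injective (R := ℤ))]
  congr 1
  ext m
  simp only [Set.mem_ofPred_eq, Set.mem_image]
  constructor
  · rintro ⟨h0, h⟩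
    refine ⟨m.toNat, ?_, by omega⟩
    have : ((m.toNat : ℕ) : ℤ) = m := by omega
    rw [this]
    have h1 := tri_spec m
    have : m * (m + 1) / 2 = tri m := by omega
    rw [this] at h
    exact_mod_cast h.symm
  · rintro ⟨n, h, rfl⟩
    refine ⟨by omega, ?_⟩
    have h1 := tri_spec n
    have : (n : ℤ) * (n + 1) / 2 = tri n := by omega
    rw [this]
    exact_mod_cast h.symm

lemma psi_two (k : ℕ) (hk : 1 ≤ k) : th 1 k 0 = 2 * psi k := by
  have h := psi_hasSum k hk
  have h2 := HasSum.of_nat_of_neg_add_one (f := tt 1 k 0) (m := psi k) (m' := psi k)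
    (by simpa [tt_one] using h) (by
      convert h using 2 with n
      rw [tt_neg, tt_one]
      simp)
  rw [(th_hasSum 1 k 0 hk).unique h2]
  ring

lemma psi_eq (k : ℕ) (hk : 1 ≤ k) : psi k = th 1 (3 * k) k := by
  have h := psi_hasSum k hk
  have hs := h.summable
  have he : HasSum (fun n : ℕ => (X : ℤ⟦X⟧) ^ (k * tri ((2 * n : ℕ) : ℤ))) _ :=
    (hs.comp_injective (i := fun n => 2 * n) (fun a b h => by simpa using h)).hasSum
  have ho : HasSum (fun n : ℕ => (X : ℤ⟦X⟧) ^ (k * tri ((2 * n + 1 : ℕ) : ℤ))) _ :=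
    (hs.comp_injective (i := fun n => 2 * n + 1) (fun a b h => by simpa using h)).hasSum
  have h1 := HasSum.even_add_odd (f := fun n : ℕ => (X : ℤ⟦X⟧) ^ (k * tri n)) he ho
  rw [h.unique h1]
  have h2 := HasSum.of_nat_of_neg_add_one (f := tt 1 (3 * k) k) (by
    convert he using 2 with n
    rw [tt_one]
    simp only
    congr 1
    have a1 := tri_spec n
    have a2 := tri_spec ((n : ℤ) - 1)
    have a3 := tri_spec ((2 * n : ℕ) : ℤ)
    have : 3 * tri n + tri ((n : ℤ) - 1) = tri ((2 * n : ℕ) : ℤ) := by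
      push_cast at a3 ⊢
      have : 2 * (3 * (tri n : ℤ) + tri ((n : ℤ) - 1)) = 2 * tri (2 * (n : ℤ)) := by
        linear_combination 3 * a1 + a2 - a3
      omega
    rw [← this]; ring) (by
    convert ho using 2 with n
    rw [tt_neg, tt_one]
    simp only
    congr 1
    have a1 := tri_spec ((n : ℤ) + 1)
    have a2 := tri_spec ((n : ℤ) + 1 - 1)
    have a3 := tri_spec ((2 * n + 1 : ℕ) : ℤ)
    have : tri ((n : ℤ) + 1) + 3 * tri ((n : ℤ) + 1 - 1) = tri ((2 * n + 1 : ℕ) : ℤ) := by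
      push_cast at a3 ⊢
      have : 2 * ((tri ((n : ℤ) + 1) : ℤ) + 3 * tri ((n : ℤ) + 1 - 1)) = 2 * tri (2 * (n : ℤ) + 1) := by
        linear_combination a1 + 3 * a2 - a3
      omega
    rw [← this]; ring)
  exact (((th_hasSum 1 (3 * k) k (by omega)).unique h2)).symm

lemma phi_dissect (s : ℤˣ) (k : ℕ) (hk : 1 ≤ k) :
    th s k k = th 1 (4 * k) (4 * k) + (s : ℤ) • (X ^ k * th 1 (8 * k) 0) := by
  have h := hasSum_part (tt s k k) (fun x : Fin 2 × ℤ => 2 * x.2 + (x.1 : ℕ)) (by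
    constructor
    · rintro ⟨a, b⟩ ⟨c, d⟩ h
      have := a.2
      have := c.2
      simp only at h
      have e1 : (a : ℕ) = c := by omega
      have e2 : b = d := by omega
      rw [e2, Fin.ext e1]
    · intro n
      exact ⟨(⟨(n % 2).toNat, by omega⟩, n / 2), by simp only; omega⟩)
    ![th 1 (4 * k) (4 * k), (s : ℤ) • (X ^ k * th 1 (8 * k) 0)] (by
    intro r
    fin_cases r
    · refine hs_congr (th_hasSum 1 (4 * k) (4 * k) (by omega)) (fun n => ?_) (by simp)
      simp only [tt]
      congr 1
      · rcases Int.units_eq_one_or s with rfl | rfl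
        · simp
        · simp [zpow_mul]
      · congr 1
        have a1 := tri_add n
        have a2 := tri_add (2 * n)
        simp only [Fin.zero_eta, Fin.coe_ofNat_eq_mod, Nat.zero_mod, Nat.cast_zero, add_zero]
        zify
        linear_combination (k : ℤ) * a2 - 4 * k * a1
    · refine hs_congr (((th_hasSum 1 (8 * k) 0 (by omega)).mul_left (X ^ k)).const_smul (s : ℤ))
        (fun n => ?_) (by simp)
      simp only [tt]
      rw [mul_smul_comm, ← pow_add, smul_smul]
      congr 1
      · rcases Int.units_eq_one_or s with rfl | rfl
        · simp
        · simp [zpow_mul, zpow_add]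
      · congr 1
        have a1 := tri_spec n
        have a2 := tri_add (2 * n + 1)
        simp only [Fin.mk_one, Fin.coe_ofNat_eq_mod, Nat.mod_succ, Nat.cast_one, zero_mul, add_zero]
        zify
        linear_combination (k : ℤ) * a2 - 4 * k * a1)
  rw [(th_hasSum s k k hk).unique h]
  simp [Fin.sum_univ_two]

lemma five_squares : th 1 1 1 ^ 2 - th 1 5 5 ^ 2 = 4 * X * (th 1 1 9 * th 1 3 7) := by
  have hA := LF.hasSum_mul (tt_LF 1 1 1 le_rfl) (tt_LF 1 1 1 le_rfl)
    (th_hasSum 1 1 1 le_rfl) (th_hasSum 1 1 1 le_rfl)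
  have h5 := LF.hasSum_mul (tt_LF 1 5 5 (by omega)) (tt_LF 1 5 5 (by omega))
    (th_hasSum 1 5 5 (by omega)) (th_hasSum 1 5 5 (by omega))
  have hG := (LF.hasSum_mul (tt_LF 1 1 9 (by omega)) (tt_LF 1 3 7 (by omega))
    (th_hasSum 1 1 9 (by omega)) (th_hasSum 1 3 7 (by omega))).mul_left X
  have key : ∀ a b m n : ℤ, a ^ 2 + b ^ 2 = 5 * m ^ 2 - 4 * m + 5 * n ^ 2 - 2 * n + 1 →
      tt 1 1 1 a * tt 1 1 1 b = X * (tt 1 1 9 m * tt 1 3 7 n) := by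
    intro a b m n h
    simp only [tt_one]
    rw [← pow_add, ← pow_add, ← pow_succ']
    congr 1
    have a1 := tri_add a
    have a2 := tri_add b
    have a3 := tri_spec m
    have a4 := tri_spec (m - 1)
    have a5 := tri_spec n
    have a6 := tri_spec (n - 1)
    zify
    apply mul_left_cancel₀ (two_ne_zero (α := ℤ))
    linear_combination 2 * a1 + 2 * a2 - a3 - 9 * a4 - 3 * a5 - 7 * a6 + 2 * h
  have h := hasSum_part (fun x : ℤ × ℤ => tt 1 1 1 x.1 * tt 1 1 1 x.2)
    (fun x : Fin 5 × (ℤ × ℤ) =>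
      ((![x.2.1 - 2 * x.2.2, 2 * x.2.1 + x.2.2 - 1, -(2 * x.2.1 + x.2.2 - 1),
          -(2 * x.2.2 - x.2.1), 2 * x.2.2 - x.2.1] : Fin 5 → ℤ) x.1,
       (![2 * x.2.1 + x.2.2, 2 * x.2.2 - x.2.1, -(2 * x.2.2 - x.2.1),
          2 * x.2.1 + x.2.2 - 1, -(2 * x.2.1 + x.2.2 - 1)] : Fin 5 → ℤ) x.1)) (by
    constructor
    · rintro ⟨r, m, n⟩ ⟨r', m', n'⟩ h
      fin_cases r <;> fin_cases r' <;> simp at h ⊢ <;> omega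
    · rintro ⟨a, b⟩
      have : (b - 2 * a) % 5 = 0 ∨ (b - 2 * a) % 5 = 2 ∨ (b - 2 * a) % 5 = 3 ∨
        (b - 2 * a) % 5 = 4 ∨ (b - 2 * a) % 5 = 1 := by omega
      rcases this with h | h | h | h | h
      · refine ⟨(0, (a + 2 * b) / 5, (b - 2 * a) / 5), ?_⟩
        simp; omega
      · refine ⟨(1, (2 * a - b + 2) / 5, (a + 2 * b + 1) / 5), ?_⟩
        simp; omega
      · refine ⟨(2, (-2 * a + b + 2) / 5, (-a - 2 * b + 1) / 5), ?_⟩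
        simp; omega
      · refine ⟨(3, (2 * b + a + 2) / 5, (b - 2 * a + 1) / 5), ?_⟩
        simp; omega
      · refine ⟨(4, (-2 * b - a + 2) / 5, (-b + 2 * a + 1) / 5), ?_⟩
        simp; omega)
    ![th 1 5 5 * th 1 5 5, X * (th 1 1 9 * th 1 3 7), X * (th 1 1 9 * th 1 3 7),
      X * (th 1 1 9 * th 1 3 7), X * (th 1 1 9 * th 1 3 7)] (by
    intro r
    fin_cases r
    · refine hs_congr h5 (fun x => ?_) (by simp)
      simp only [tt_one]
      rw [← pow_add, ← pow_add]
      congr 1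
      simp
      have a1 := tri_add (x.1 - 2 * x.2)
      have a2 := tri_add (2 * x.1 + x.2)
      have a3 := tri_add x.1
      have a4 := tri_add x.2
      zify
      linear_combination a1 + a2 - 5 * a3 - 5 * a4
    all_goals
      refine hs_congr hG (fun x => key _ _ _ _ ?_) (by simp)
      simp
      ring)
  have := hA.unique h
  simp [Fin.sum_univ_succ] at this
  linear_combination this

def ee (w v : ℤ) : ℕ := ((3 * v ^ 2 + v + 2 * w ^ 2 + 2 * v * w + 2 * w) / 2).toNat

lemma ee_spec (w v : ℤ) : 4 * (ee w v : ℤ) = (v + 2 * w + 1) ^ 2 + 5 * v ^ 2 - 1 := by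
  have h1 := tri_spec v
  have hz : 2 * (ee w v : ℤ) = 3 * v ^ 2 + v + 2 * w ^ 2 + 2 * v * w + 2 * w := by
    have h0 : 0 ≤ 3 * v ^ 2 + v + 2 * w ^ 2 + 2 * v * w + 2 * w := by
      have : 0 ≤ (v + 2 * w + 1) ^ 2 + 5 * v ^ 2 := by positivity
      by_contra hc
      have : 3 * v ^ 2 + v + 2 * w ^ 2 + 2 * v * w + 2 * w ≤ -1 := by omega
      nlinarith
    have h2 : (3 * v ^ 2 + v + 2 * w ^ 2 + 2 * v * w + 2 * w) =
        2 * (tri v + v ^ 2 + w ^ 2 + v * w + w) := by linear_combination -h1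
    unfold ee
    omega
  linear_combination 2 * hz

noncomputable def FF (k : ℕ) (x : ℤ × ℤ) : ℤ⟦X⟧ :=
  (((-1) ^ x.2 : ℤˣ) : ℤ) • X ^ (k * ee x.1 x.2)

lemma quint (k : ℕ) (hk : 1 ≤ k) :
    th 1 (2 * k) 0 * th 1 (5 * k) (5 * k) - X ^ k * (th 1 k k * th 1 (10 * k) 0)
      = 2 * (th (-1) (2 * k) k * th (-1) (10 * k) (5 * k)) := by
  have h1 := LF.hasSum_mul (tt_LF 1 (2 * k) 0 (by omega)) (tt_LF 1 (5 * k) (5 * k) (by omega))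
    (th_hasSum 1 (2 * k) 0 (by omega)) (th_hasSum 1 (5 * k) (5 * k) (by omega))
  have h2 := ((LF.hasSum_mul (tt_LF 1 k k (by omega)) (tt_LF 1 (10 * k) 0 (by omega))
    (th_hasSum 1 k k (by omega)) (th_hasSum 1 (10 * k) 0 (by omega))).mul_left (X ^ k)).neg
  have h3 := LF.hasSum_mul (tt_LF (-1) (2 * k) k (by omega)) (tt_LF (-1) (10 * k) (5 * k) (by omega))
    (th_hasSum (-1) (2 * k) k (by omega)) (th_hasSum (-1) (10 * k) (5 * k) (by omega))
  have hF := hasSum_part (FF k)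
    (fun x : Fin 2 × (ℤ × ℤ) => (x.2.1 - x.2.2 - (x.1 : ℕ), 2 * x.2.2 + (x.1 : ℕ))) (by
    constructor
    · rintro ⟨r, m, n⟩ ⟨r', m', n'⟩ h
      fin_cases r <;> fin_cases r' <;> simp at h ⊢ <;> omega
    · rintro ⟨w, v⟩
      have : v % 2 = 0 ∨ v % 2 = 1 := by omega
      rcases this with h | h
      · refine ⟨(0, w + v / 2, v / 2), ?_⟩
        simp; omega
      · refine ⟨(1, w + v / 2 + 1, v / 2), ?_⟩
        simp; omega)
    ![th 1 (2 * k) 0 * th 1 (5 * k) (5 * k), -(X ^ k * (th 1 k k * th 1 (10 * k) 0))] (by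
    intro r
    fin_cases r
    · refine hs_congr h1 (fun x => ?_) (by simp)
      obtain ⟨m, n⟩ := x
      simp only [tt_one, FF]
      rw [← pow_add]
      simp [zpow_mul]
      congr 1
      have a1 := ee_spec (m - n) (2 * n)
      have a2 := tri_spec m
      have a3 := tri_add n
      zify
      apply mul_left_cancel₀ (four_ne_zero (α := ℤ))
      linear_combination (k : ℤ) * a1 - 4 * k * a2 - 20 * k * a3
    · refine hs_congr h2 (fun x => ?_) (by simp)
      obtain ⟨m, n⟩ := x
      simp only [tt_one, FF]
      rw [← pow_add, ← pow_add]
      simp [zpow_mul, zpow_add]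
      congr 1
      have a1 := ee_spec (m - n - 1) (2 * n + 1)
      have a2 := tri_add m
      have a3 := tri_spec n
      zify
      apply mul_left_cancel₀ (four_ne_zero (α := ℤ))
      linear_combination (k : ℤ) * a1 - 4 * k * a2 - 20 * k * a3)
  have hS : HasSum (fun x : ℤ × ℤ => FF k (3 * x.2 + 1, x.1 - x.2)) 0 := by
    have hs : Summable (fun x : ℤ × ℤ => FF k (3 * x.2 + 1, x.1 - x.2)) :=
      hF.summable.comp_injective (i := fun x : ℤ × ℤ => (3 * x.2 + 1, x.1 - x.2)) (by
        rintro ⟨a, b⟩ ⟨c, d⟩ h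
        simp at h ⊢
        omega)
    obtain ⟨S, hS⟩ := hs
    have hb : Function.Bijective (fun x : ℤ × ℤ => (x.1, -1 - x.2)) := by
      constructor
      · rintro ⟨a, b⟩ ⟨c, d⟩ h
        simp at h ⊢
        omega
      · rintro ⟨a, b⟩
        exact ⟨(a, -1 - b), by simp⟩
    have hS' := (Equiv.ofBijective _ hb).hasSum_iff.2 hS
    have hS2 : HasSum (fun x : ℤ × ℤ => FF k (3 * x.2 + 1, x.1 - x.2)) (-S) := by
      refine hs_congr hS'.neg (fun x => ?_) rfl
      obtain ⟨m, n⟩ := x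
      simp only [Function.comp, Equiv.ofBijective_apply, FF]
      rw [← neg_smul]
      congr 1
      · have : m - (-1 - n) = (m - n) + (2 * n + 1) := by ring
        rw [this, zpow_add _ (m - n)]
        simp [zpow_add, zpow_mul]
      · congr 2
        have a1 := ee_spec (3 * n + 1) (m - n)
        have a2 := ee_spec (3 * (-1 - n) + 1) (m - (-1 - n))
        zify
        apply mul_left_cancel₀ (four_ne_zero (α := ℤ))
        linear_combination a1 - a2
    have := hS.unique hS2
    have h0 : S = 0 := by
      ext d
      have h9 := congrArg (coeff d) this
      simp only [map_neg] at h9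
      simp only [map_zero]
      omega
    rwa [h0] at hS
  have hF3 := hasSum_part (FF k)
    (fun x : Fin 3 × (ℤ × ℤ) => ((![3 * x.2.2, 3 * x.2.2 + 1, - 3 * x.2.2 - 1] : Fin 3 → ℤ) x.1,
      (![x.2.1 - x.2.2, x.2.1 - x.2.2, x.2.2 - x.2.1] : Fin 3 → ℤ) x.1)) (by
    constructor
    · rintro ⟨r, m, n⟩ ⟨r', m', n'⟩ h
      fin_cases r <;> fin_cases r' <;> simp at h ⊢ <;> omega
    · rintro ⟨w, v⟩
      have : w % 3 = 0 ∨ w % 3 = 1 ∨ w % 3 = 2 := by omega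
      rcases this with h | h | h
      · refine ⟨(0, v + w / 3, w / 3), ?_⟩
        simp; omega
      · refine ⟨(1, v + w / 3, w / 3), ?_⟩
        simp; omega
      · refine ⟨(2, -((w + 1) / 3) - v, -((w + 1) / 3)), ?_⟩
        simp; omega)
    ![th (-1) (2 * k) k * th (-1) (10 * k) (5 * k), 0,
      th (-1) (2 * k) k * th (-1) (10 * k) (5 * k)] (by
    intro r
    fin_cases r
    · refine hs_congr h3 (fun x => ?_) (by simp)
      obtain ⟨m, n⟩ := x
      simp only [tt, FF]
      rw [smul_mul_smul_comm, ← pow_add]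
      congr 1
      · simp [zpow_sub]
      · simp
        congr 1
        have a1 := ee_spec (3 * n) (m - n)
        have a2 := tri_spec m
        have a3 := tri_spec n
        have a4 := tri_spec (m - 1)
        have a5 := tri_spec (n - 1)
        zify
        apply mul_left_cancel₀ (four_ne_zero (α := ℤ))
        linear_combination (k : ℤ) * a1 - 4 * k * a2 - 20 * k * a3 - 2 * k * a4 - 10 * k * a5
    · exact hs_congr hS (fun x => by simp) (by simp)
    · refine hs_congr h3 (fun x => ?_) (by simp)
      obtain ⟨m, n⟩ := x
      simp only [tt, FF]
      rw [smul_mul_smul_comm, ← pow_add]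
      congr 1
      · simp [zpow_sub, mul_comm]
      · simp
        congr 1
        have a1 := ee_spec (-(3 * n) - 1) (n - m)
        have a2 := tri_spec m
        have a3 := tri_spec n
        have a4 := tri_spec (m - 1)
        have a5 := tri_spec (n - 1)
        zify
        apply mul_left_cancel₀ (four_ne_zero (α := ℤ))
        linear_combination (k : ℤ) * a1 - 4 * k * a2 - 20 * k * a3 - 2 * k * a4 - 10 * k * a5)
  have := hF.unique hF3
  simp [Fin.sum_univ_succ] at this
  linear_combination this

lemma E_eq (k : ℕ) (hk : 1 ≤ k) : th (-1) (2 * k) k = Q (-1) k k := by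
  rw [jtp _ _ _ (by omega) hk, Q_split (-1) k k 3 hk (by omega)]
  simp only [Fin.prod_univ_succ, Fin.prod_univ_zero]
  have e1 : 2 * k + k = 3 * k := by ring
  have e2 : k + 0 * k = k := by ring
  have e3 : k + 1 * k = 2 * k := by ring
  have e4 : k + 2 * k = 3 * k := by ring
  simp [e1, e4]
  have e5 : k + k = 2 * k := by ring
  rw [e5]
  ring

lemma two_cancel {a b : ℤ⟦X⟧} (h : 2 * a = 2 * b) : a = b := by
  ext d
  have h9 := congrArg (coeff d) h
  rw [two_mul, two_mul, map_add, map_add] at h9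
  omega

lemma qI (k : ℕ) (hk : 1 ≤ k) : psi (2 * k) * phi (5 * k) - X ^ k * (phi k * psi (10 * k)) =
    Q (-1) k k * Q (-1) (5 * k) (5 * k) := by
  have h := quint k hk
  have e : 10 * k = 2 * (5 * k) := by ring
  rw [E_eq k hk, psi_two _ (by omega), psi_two _ (by omega), ← phi_eq _ (by omega),
    ← phi_eq _ (by omega), e, E_eq _ (by omega), ← e] at h
  apply two_cancel
  linear_combination h

lemma eh (k : ℕ) (hk : 1 ≤ k) : Q (-1) k k * Q 1 k k = Q (-1) (2 * k) (2 * k) := by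
  rw [mul_comm, Q_mul _ _ hk]

lemma split2 (s : ℤˣ) (k : ℕ) (hk : 1 ≤ k) : Q s k k = Q s k (2 * k) * Q s (2 * k) (2 * k) := by
  rw [Q_split s k k 2 hk (by omega)]
  have e5 : k + k = 2 * k := by ring
  simp [Fin.prod_univ_two, e5]

lemma split2' (s : ℤˣ) (k : ℕ) (hk : 1 ≤ k) :
    Q s k (2 * k) = Q s k (4 * k) * Q s (3 * k) (4 * k) := by
  rw [Q_split s k (2 * k) 2 (by omega) (by omega)]
  have e5 : k + 2 * k = 3 * k := by ring
  have e6 : 2 * (2 * k) = 4 * k := by ring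
  simp [Fin.prod_univ_two, e5, e6]

lemma oph (k : ℕ) (hk : 1 ≤ k) :
    Q (-1) k (2 * k) * Q 1 k (2 * k) * Q 1 (2 * k) (2 * k) = 1 := by
  have h1 := Q_mul k (2 * k) (by omega)
  have h2 := split2 (-1) (2 * k) (by omega)
  have h3 := eh (2 * k) (by omega)
  apply mul_left_cancel₀ (Q_ne (-1) (2 * k) (2 * k) (by omega) (by omega))
  rw [← h1, ← h3] at h2
  linear_combination -h2

lemma phi_prod (s : ℤˣ) (k : ℕ) (hk : 1 ≤ k) :
    th s k k = Q s k (2 * k) ^ 2 * Q (-1) (2 * k) (2 * k) := by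
  rw [jtp _ _ _ hk hk]
  have e5 : k + k = 2 * k := by ring
  rw [e5]
  ring

lemma psi_prod (k : ℕ) (hk : 1 ≤ k) :
    psi k = Q 1 k (2 * k) * Q (-1) (2 * k) (2 * k) * Q 1 (2 * k) (2 * k) := by
  rw [psi_eq _ hk, jtp _ _ _ (by omega) hk]
  have e5 : 3 * k + k = 2 * (2 * k) := by ring
  rw [e5, ← eh (2 * k) (by omega)]
  have := split2' 1 k hk
  have e6 : 2 * (2 * k) = 4 * k := by ring
  rw [e6, this]
  ring

lemma psi2_prod (k : ℕ) (hk : 1 ≤ k) :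
    psi (2 * k) = Q 1 (2 * k) (2 * k) ^ 2 * Q (-1) (2 * k) (2 * k) := by
  rw [psi_prod _ (by omega)]
  have h1 := split2 1 (2 * k) (by omega)
  have h2 := eh (2 * k) (by omega)
  rw [← h2]
  rw [mul_right_comm, ← h1]
  ring

lemma psi_sq (k : ℕ) (hk : 1 ≤ k) : psi k ^ 2 = phi k * psi (2 * k) := by
  rw [psi2_prod k hk, psi_prod k hk, phi_eq k hk, phi_prod 1 k hk]
  ring

lemma G_prod : th 1 1 9 * th 1 3 7 * Q 1 5 10 = Q 1 1 2 * Q (-1) 10 10 ^ 2 := by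
  rw [jtp _ _ _ (by omega) (by omega), jtp _ _ _ (by omega) (by omega),
    Q_split 1 1 2 5 (by omega) (by omega)]
  simp [Fin.prod_univ_succ]
  ring

lemma ccth (s : ℤˣ) (k : ℕ) (hk : 1 ≤ k) : constantCoeff (th s k k) = 1 := by
  rw [phi_prod s k hk]
  simp [Q_const s k (2 * k) hk (by omega), Q_const (-1) (2 * k) (2 * k) (by omega) (by omega)]

lemma ccphi (k : ℕ) (hk : 1 ≤ k) : constantCoeff (phi k) = 1 := by
  rw [phi_eq k hk, ccth 1 k hk]

lemma ccpsi (k : ℕ) (hk : 1 ≤ k) : constantCoeff (psi k) = 1 := by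
  rw [psi_prod k hk]
  simp [Q_const _ k (2 * k) hk (by omega), Q_const _ (2 * k) (2 * k) (by omega) (by omega)]

lemma lambert4 : th 1 1 1 * th (-1) 5 5 - th (-1) 1 1 * th 1 5 5
    = 4 * X * (Q (-1) 4 4 * Q (-1) 20 20) := by
  have h := qI 4 (by omega)
  have a1 := phi_dissect 1 1 le_rfl
  have a2 := phi_dissect (-1) 1 le_rfl
  have a3 := phi_dissect 1 5 (by omega)
  have a4 := phi_dissect (-1) 5 (by omega)
  norm_num at h a1 a2 a3 a4
  rw [psi_two _ (by omega), ← phi_eq 4 (by omega)] at a1 a2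
  rw [psi_two _ (by omega), ← phi_eq 20 (by omega)] at a3 a4
  rw [a1, a2, a3, a4]
  linear_combination 4 * X * h

lemma main_B : Q (-1) 2 2 * Q (-1) 10 10 * Q 1 2 2 * Q 1 10 10 * (Q 1 1 2 * Q (-1) 5 10) ^ 2
    = psi 4 * phi 10 + X ^ 2 * (psi 20 * phi 2) + 2 * X * (psi 2 * psi 10) := by
  have hl := lambert4
  have p1 := phi_prod 1 1 le_rfl
  have p2 := phi_prod (-1) 1 le_rfl
  have p3 := phi_prod 1 5 (by omega)
  have p4 := phi_prod (-1) 5 (by omega)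
  have q1 := psi2_prod 1 le_rfl
  have q2 := psi2_prod 5 (by omega)
  have r1 := eh 2 (by omega)
  have r2 := eh 10 (by omega)
  have s1 := oph 1 le_rfl
  have s2 := oph 5 (by omega)
  have t := qI 2 (by omega)
  have u1 := psi_sq 2 (by omega)
  have u2 := psi_sq 10 (by omega)
  norm_num at hl p1 p2 p3 p4 q1 q2 r1 r2 s1 s2 t u1 u2
  have c1 := Q_const 1 1 2 (by omega) (by omega)
  have c2 := Q_const (-1) 1 2 (by omega) (by omega)
  have c3 := Q_const 1 5 10 (by omega) (by omega)
  have c4 := Q_const (-1) 5 10 (by omega) (by omega)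
  have c5 := Q_const (-1) 2 2 (by omega) (by omega)
  have c6 := Q_const (-1) 10 10 (by omega) (by omega)
  have c7 := Q_const 1 2 2 (by omega) (by omega)
  have c8 := Q_const 1 10 10 (by omega) (by omega)
  have d1 := ccpsi 4 (by omega)
  have d2 := ccphi 10 (by omega)
  rw [p1, p2, p3, p4, ← r1, ← r2] at hl
  have ne1 := Q_ne (-1) 2 2 (by omega) (by omega)
  have ne2 := Q_ne (-1) 10 10 (by omega) (by omega)
  generalize Q 1 1 2 = p at *
  generalize Q (-1) 1 2 = o at *
  generalize Q 1 5 10 = p' at *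
  generalize Q (-1) 5 10 = o' at *
  generalize Q (-1) 2 2 = e at *
  generalize Q (-1) 10 10 = e' at *
  generalize Q 1 2 2 = h at *
  generalize Q 1 10 10 = h' at *
  have hl2 : (p * o') ^ 2 - (o * p') ^ 2 = 4 * X * (h * h') := by
    apply mul_left_cancel₀ (mul_ne_zero ne1 ne2)
    linear_combination hl
  set B := e * e' * h * h' * (p * o') ^ 2 with hB
  set B' := e * e' * h * h' * (o * p') ^ 2 with hB'
  have m1 : B - B' = 4 * X * (psi 2 * psi 10) := by
    rw [hB, hB', q1, q2]
    linear_combination e * e' * h * h' * hl2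
  have m2 : B * B' = (e * e') ^ 2 := by
    rw [hB, hB']
    have : (o * p * h) * (o' * p' * h') = 1 := by rw [s1, s2]; ring
    linear_combination (e * e') ^ 2 * ((o * p * h) * (o' * p' * h') + 1) * this
  set C := psi 4 * phi 10 + X ^ 2 * (psi 20 * phi 2) with hC
  have m3 : C ^ 2 = (e * e') ^ 2 + 4 * X ^ 2 * (psi 2 * psi 10) ^ 2 := by
    rw [← t, mul_pow, u1, u2, hC]; ring
  have m4 : (B + B' - 2 * C) * (B + B' + 2 * C) = 0 := by
    linear_combination (B - B' + 4 * X * (psi 2 * psi 10)) * m1 + 4 * m2 - 4 * m3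
  have m5 : B + B' + 2 * C ≠ 0 := by
    intro hz
    have := congrArg (constantCoeff (R := ℤ)) hz
    rw [hB, hB', hC, two_mul] at this
    simp [c1, c2, c3, c4, c5, c6, c7, c8, d1, d2] at this
  have m6 := (mul_eq_zero.1 m4).resolve_right m5
  apply two_cancel
  linear_combination m6 + m1

end ThetaAux

open ThetaAux in
theorem theta_identity_3_6 :
    psi 1 * (phi 1 ^ 2 - phi 5 ^ 2) =
      4 * X ^ 3 * psi 5 * psi 20 * phi 2 + 4 * X * psi 4 * psi 5 * phi 10
        + 8 * X ^ 2 * psi 2 * psi 5 * psi 10 := by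
  have h5 := five_squares
  have hB := main_B
  have hG := G_prod
  have s1 := oph 1 le_rfl
  have s2 := oph 5 (by omega)
  have q1 := psi_prod 1 le_rfl
  have q2 := psi_prod 5 (by omega)
  norm_num at s1 s2 q1 q2
  rw [phi_eq 1 le_rfl, phi_eq 5 (by omega), h5]
  have ne1 := Q_ne (-1) 1 2 (by omega) (by omega)
  have ne2 := Q_ne 1 5 10 (by omega) (by omega)
  have ne3 := Q_ne (-1) 5 10 (by omega) (by omega)
  have e1 : psi 1 * Q (-1) 1 2 = Q (-1) 2 2 := by
    rw [q1]; linear_combination Q (-1) 2 2 * s1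
  have e2 : psi 5 * Q (-1) 5 10 = Q (-1) 10 10 := by
    rw [q2]; linear_combination Q (-1) 10 10 * s2
  have goal' : psi 1 * (th 1 1 9 * th 1 3 7) = psi 5 *
      (psi 4 * phi 10 + X ^ 2 * (psi 20 * phi 2) + 2 * X * (psi 2 * psi 10)) := by
    rw [← hB]
    apply mul_left_cancel₀ (mul_ne_zero (mul_ne_zero ne1 ne2) ne3)
    generalize th 1 1 9 * th 1 3 7 = G at *
    generalize Q 1 1 2 = p at *
    generalize Q (-1) 1 2 = o at *
    generalize Q 1 5 10 = p' at *
    generalize Q (-1) 5 10 = o' at *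
    generalize Q (-1) 2 2 = e at *
    generalize Q (-1) 10 10 = e' at *
    generalize Q 1 2 2 = h at *
    generalize Q 1 10 10 = h' at *
    have a1 : o * p' * o' * (psi 1 * G) = e * (p * e' ^ 2) * o' := by
      rw [← e1, ← hG]; ring
    have a2 : o * p' * o' * (psi 5 * (e * e' * h * h' * (p * o') ^ 2)) =
        e' * (e * e') * (p * o') * ((o * p * h) * (o' * p' * h')) := by
      nth_rewrite 2 [← e2]; ring
    rw [a1, a2, s1, s2]; ring
  linear_combination 4 * X * goal'
end

section
/- If M is a positive integer with M ≡ 1 (mod 8), then (1,8,8,0,0,0)(M) = (1,30,30,0,0,0)(M) + 2·(6,10,15,0,0,0)(M) + 2·(3,10,30,0,0,0)(M) + 2·(5,6,30,0,0,0)(M) + 4·(9,11,11,2,6,6)(M) + 2·(2,15,30,0,0,0)(M) + 2·(5,12,18,12,0,0)(M). -/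
/-- The number of representations of `M` by the ternary quadratic form
`a x² + b y² + c z² + d y z + e z x + f x y`. -/
noncomputable def rep (a b c d e f M : ℤ) : ℕ :=
  {p : ℤ × ℤ × ℤ | M = a * p.1 ^ 2 + b * p.2.1 ^ 2 + c * p.2.2 ^ 2
      + d * p.2.1 * p.2.2 + e * p.2.2 * p.1 + f * p.1 * p.2.1}.ncard


section P1
open Complex Real

noncomputable def kap (c d : ℤ) : ℂ :=
  if c % 2 = 0 then (if d % 4 = 1 then 1 else -1) else (if c % 4 = 1 then -I else I)

def Eprop (a b c d : ℤ) : Prop :=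
  ∀ τ : ℂ, 0 < τ.im → ∃ μ : ℂ, μ ^ 2 = kap c d * (c * τ + d) ∧
    ∀ z : ℂ, jacobiTheta₂ (z / (c * τ + d)) ((a * τ + b) / (c * τ + d)) =
      μ * cexp (π * I * c * z ^ 2 / (c * τ + d)) * jacobiTheta₂ z τ

lemma Eprop_one : Eprop 1 0 0 1 := by
  intro τ hτ
  refine ⟨1, by simp [kap], fun z => by simp⟩

lemma theta_add_int (z τ : ℂ) (k : ℤ) : jacobiTheta₂ z (τ + 2 * k) = jacobiTheta₂ z τ := by
  induction k using Int.induction_on with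
  | zero => simp
  | succ n ih =>
    rw [← ih, ← jacobiTheta₂_add_right z (τ + 2 * ((n : ℤ) : ℂ))]; push_cast; ring_nf
  | pred n ih =>
    rw [← ih, ← jacobiTheta₂_add_right z (τ + 2 * ((-(n : ℤ) - 1 : ℤ) : ℂ))]; push_cast; ring_nf

lemma Eprop_T {a b c d : ℤ} (k : ℤ) (hp : c % 2 = 0 → d % 2 = 1) (h : Eprop a b c d) :
    Eprop a (b + 2 * k * a) c (d + 2 * k * c) := by
  intro τ hτ
  obtain ⟨μ, h1, h2⟩ := h (τ + 2 * k) (by simpa using hτ)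
  have e1 : (c * (τ + 2 * k) + d : ℂ) = c * τ + (d + 2 * k * c : ℤ) := by push_cast; ring
  have e2 : (a * (τ + 2 * k) + b : ℂ) = a * τ + (b + 2 * k * a : ℤ) := by push_cast; ring
  refine ⟨μ, ?_, fun z => ?_⟩
  · rw [h1, e1]
    congr 1
    unfold kap
    by_cases hc : c % 2 = 0
    · obtain ⟨m, rfl⟩ := Int.dvd_of_emod_eq_zero hc
      have : (d + 2 * k * (2 * m)) % 4 = d % 4 := by
        rw [show d + 2 * k * (2 * m) = d + 4 * (k * m) by ring]; simp
      simp [hc, this]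
    · simp [hc]
  · have := h2 z
    rw [e1, e2, theta_add_int] at this
    exact this

lemma S_eq (z τ : ℂ) (hτ : 0 < τ.im) : jacobiTheta₂ (z / τ) (-1 / τ) =
    (-I * τ) ^ (1 / 2 : ℂ) * cexp (π * I * z ^ 2 / τ) * jacobiTheta₂ z τ := by
  have h0 : τ ≠ 0 := by rintro rfl; simp at hτ
  have h1 : (-I * τ) ^ (1 / 2 : ℂ) ≠ 0 := by
    rw [Ne, cpow_eq_zero_iff]; simp [h0]
  rw [jacobiTheta₂_functional_equation z τ]
  have : cexp (π * I * z ^ 2 / τ) * cexp (-π * I * z ^ 2 / τ) = 1 := by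
    rw [← Complex.exp_add]; convert Complex.exp_zero using 2; ring
  generalize jacobiTheta₂ (z / τ) (-1 / τ) = A at *
  generalize (-I * τ) ^ (1 / 2 : ℂ) = s at *
  have h2 : s * (1 / s) = 1 := by field_simp
  linear_combination (-A * s * (1 / s)) * this - A * h2

lemma denom_ne {c d : ℤ} (h : c ≠ 0 ∨ d ≠ 0) {τ : ℂ} (hτ : 0 < τ.im) : (c * τ + d : ℂ) ≠ 0 := by
  intro h0
  have := congrArg Complex.im h0
  simp at this
  rcases this with h1 | h1
  · subst h1; simp at h0; simp [h0] at h
  · exact hτ.ne' h1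

lemma Eprop_S {a b c d : ℤ} (hdet : a * d - b * c = 1) (hp : (c + d) % 2 = 1) (h : Eprop a b c d) :
    Eprop b (-a) d (-c) := by
  intro τ hτ
  have h0 : τ ≠ 0 := by rintro rfl; simp at hτ
  have him : 0 < (-1 / τ).im := by
    rw [neg_div, one_div, Complex.neg_im, Complex.inv_im, neg_div, neg_neg]
    exact div_pos hτ (Complex.normSq_pos.2 h0)
  obtain ⟨μ, h1, h2⟩ := h (-1 / τ) him
  have hcd : d ≠ 0 ∨ -c ≠ 0 := by
    by_contra! hh
    obtain ⟨rfl, h3⟩ := hh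
    have : c = 0 := by omega
    subst this; simp at hdet
  have hne := denom_ne hcd hτ
  have hne' : (d * τ - c : ℂ) ≠ 0 := by
    convert hne using 1; push_cast; ring
  have e1 : (c * (-1 / τ) + d : ℂ) = (d * τ - c) / τ := by field_simp; ring
  have e2 : (a * (-1 / τ) + b : ℂ) = (b * τ - a) / τ := by field_simp; ring
  refine ⟨μ * (-I * τ) ^ (1 / 2 : ℂ), ?_, fun z => ?_⟩
  · rw [mul_pow, h1, ← Complex.cpow_nat_mul, e1]
    have : kap d (-c) = -I * kap c d := by
      unfold kap
      by_cases hc : c % 2 = 0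
      · have hd : ¬ (d % 2 = 0) := by omega
        simp only [hc, hd, if_true, if_false]
        split_ifs <;> simp
      · have hd : d % 2 = 0 := by omega
        simp only [hc, hd, if_true, if_false]
        by_cases h4 : c % 4 = 1
        · have : ¬ ((-c) % 4 = 1) := by omega
          simp [h4, this]
        · have : ((-c) % 4 = 1) := by omega
          simp [h4, this]
    rw [this]
    norm_num
    field_simp
    ring
  · have := h2 (z / τ)
    rw [e1, e2, S_eq z τ hτ] at this
    have e3 : z / τ / ((d * τ - c) / τ) = z / (d * τ + (-c : ℤ)) := by
      push_cast; rw [← sub_eq_add_neg]; field_simp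
    have e4 : ((b * τ - a) / τ) / ((d * τ - c) / τ) = (b * τ + (-a : ℤ)) / (d * τ + (-c : ℤ)) := by
      push_cast; rw [← sub_eq_add_neg, ← sub_eq_add_neg]; field_simp
    rw [e3, e4] at this
    rw [this]
    have e5 : cexp (π * I * d * z ^ 2 / (d * τ + (-c : ℤ))) =
        cexp (π * I * c * (z / τ) ^ 2 / ((d * τ - c) / τ)) * cexp (π * I * z ^ 2 / τ) := by
      rw [← Complex.exp_add]
      congr 1
      push_cast; rw [← sub_eq_add_neg]; field_simp; ring
    rw [e5]; ring

lemma Eprop_all (n : ℕ) : ∀ a b c d : ℤ, c.natAbs = n → a * d - b * c = 1 →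
    (c + d) % 2 = 1 → (a + b) % 2 = 1 → (a + c) % 2 = 1 → Eprop a b c d := by
  induction n using Nat.strong_induction_on with
  | _ n ih =>
  intro a b c d hn hdet hp hq hr
  by_cases hc : c = 0
  · subst hc
    have h1 : a * d = 1 := by linarith
    have hm : Eprop (-1) 0 0 (-1) := by
      have := Eprop_S (by norm_num) (by norm_num) Eprop_one
      simpa using Eprop_S (by norm_num) (by norm_num) this
    rcases Int.eq_one_or_neg_one_of_mul_eq_one' h1 with ⟨rfl, rfl⟩ | ⟨rfl, rfl⟩
    · obtain ⟨k, rfl⟩ : ∃ k, b = 2 * k := ⟨b / 2, by omega⟩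
      simpa using Eprop_T k (by norm_num) Eprop_one
    · obtain ⟨k, rfl⟩ : ∃ k, b = 2 * k := ⟨b / 2, by omega⟩
      simpa using Eprop_T (-k) (by norm_num) hm
  · -- choose k
    obtain ⟨k, hk⟩ : ∃ k : ℤ, (d + 2 * k * c).natAbs < c.natAbs := by
      have hb := Int.emod_nonneg (d + c) (b := 2 * c) (by omega)
      have hb2 := Int.emod_lt_abs (d + c) (b := 2 * c) (by omega)
      have hb3 := Int.emod_add_mul_ediv (d + c) (2 * c)
      have hab : |2 * c| = 2 * |c| := by rw [abs_mul]; norm_num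
      set r := (d + c) % (2 * c)
      set q := (d + c) / (2 * c)
      have hpar : (d + c) % 2 = r % 2 := by
        rw [← hb3, show r + 2 * c * q = r + 2 * (c * q) by ring]; simp
      rcases le_or_gt 0 c with h | h
      · refine ⟨-q, ?_⟩
        have : d + 2 * -q * c = r - c := by linarith
        rw [this]; rw [abs_of_nonneg h] at hab; omega
      · refine ⟨-q+1, ?_⟩
        have : d + 2 * (-q + 1) * c = r + c := by linarith
        rw [this]; rw [abs_of_neg h] at hab; omega
    have hmul : (2 * k * c) % 2 = 0 := by rw [mul_assoc]; simp
    have hmul' : (2 * k * a) % 2 = 0 := by rw [mul_assoc]; simp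
    have hdet' : a * (d + 2 * k * c) - (b + 2 * k * a) * c = 1 := by linarith
    have hdet'' := hdet'
    generalize hd' : d + 2 * k * c = d' at *
    generalize hb' : b + 2 * k * a = b' at *
    have E1 : Eprop b' (-a) d' (-c) :=
      ih _ (hn ▸ hk) b' (-a) d' (-c) rfl (by linarith) (by omega) (by omega) (by
        omega)
    have E2 := Eprop_S (by linarith) (by omega) E1
    have E3 := Eprop_S (by linarith) (by omega) E2
    have E4 := Eprop_S (by linarith) (by omega) E3
    have E5 := Eprop_T (-k) (by omega) E4
    have h1 : - -d' + 2 * -k * - -c = d := by rw [← hd']; ring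
    have h2 : - -b' + 2 * -k * - -a = b := by rw [← hb']; ring
    rw [h1, h2] at E5
    simpa using E5

end P1

section P2
open Complex Real

lemma theta_add_left_int (z τ : ℂ) (k : ℤ) : jacobiTheta₂ (z + k) τ = jacobiTheta₂ z τ := by
  induction k using Int.induction_on with
  | zero => simp
  | succ n ih =>
    rw [← ih, ← jacobiTheta₂_add_left (z + ((n : ℤ) : ℂ))]; push_cast; ring_nf
  | pred n ih =>
    rw [← ih, ← jacobiTheta₂_add_left (z + ((-(n : ℤ) - 1 : ℤ) : ℂ))]; push_cast; ring_nf

lemma theta_add_left_tau (z τ : ℂ) (k : ℤ) : jacobiTheta₂ (z + k * τ) τ =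
    cexp (-π * I * (k ^ 2 * τ + 2 * k * z)) * jacobiTheta₂ z τ := by
  induction k using Int.induction_on with
  | zero => simp
  | succ n ih =>
    have := jacobiTheta₂_add_left' (z + ((n : ℤ) : ℂ) * τ) τ
    rw [ih, ← mul_assoc, ← Complex.exp_add] at this
    convert this using 2
    · push_cast; ring
    · congr 1; push_cast; ring
  | pred n ih =>
    have := jacobiTheta₂_add_left' (z + ((-(n : ℤ) - 1 : ℤ) : ℂ) * τ) τ
    have e : z + ((-(n : ℤ) - 1 : ℤ) : ℂ) * τ + τ = z + ((-(n : ℤ) : ℤ) : ℂ) * τ := by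
      push_cast; ring
    rw [e, ih] at this
    have h2 := congrArg (fun x => cexp (π * I * (τ + 2 * (z + ((-(n : ℤ) - 1 : ℤ) : ℂ) * τ))) * x) this
    simp only [← mul_assoc, ← Complex.exp_add] at h2
    rw [show π * I * (τ + 2 * (z + ((-(n : ℤ) - 1 : ℤ) : ℂ) * τ)) +
      -π * I * (τ + 2 * (z + ((-(n : ℤ) - 1 : ℤ) : ℂ) * τ)) = 0 by ring, Complex.exp_zero, one_mul] at h2
    rw [← h2]
    congr 2
    push_cast; ring

lemma root_sum (k : ℕ) (hk : 0 < k) (n : ℤ) :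
    ∑ j ∈ Finset.range k, cexp (2 * π * I * n * (j / k)) = if (k : ℤ) ∣ n then (k : ℂ) else 0 := by
  have hk' : (k : ℂ) ≠ 0 := by exact_mod_cast hk.ne'
  have e : ∀ j : ℕ, cexp (2 * π * I * n * (j / k)) = cexp (2 * π * I * n / k) ^ j := by
    intro j
    rw [← Complex.exp_nat_mul]; congr 1; ring
  simp only [e]
  split_ifs with h
  · obtain ⟨m, rfl⟩ := h
    have : cexp (2 * π * I * ((k * m : ℤ) : ℂ) / k) = 1 := by
      rw [Complex.exp_eq_one_iff]
      exact ⟨m, by push_cast; field_simp⟩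
    simp only [this, one_pow]; simp
  · have h1 : cexp (2 * π * I * n / k) ≠ 1 := by
      rw [Ne, Complex.exp_eq_one_iff]
      rintro ⟨m, hm⟩
      apply h
      have hpi : (2 * π * I : ℂ) ≠ 0 := by simp [Real.pi_ne_zero]
      refine ⟨m, ?_⟩
      have : (n : ℂ) = k * m := by
        field_simp at hm
        exact hm
      exact_mod_cast this
    rw [geom_sum_eq h1, ← Complex.exp_nat_mul, show (k : ℂ) * (2 * π * I * n / k) = n * (2 * π * I) by
      field_simp, Complex.exp_int_mul_two_pi_mul_I]
    simp

lemma theta_mult (k : ℕ) (hk : 0 < k) (τ : ℂ) (hτ : 0 < τ.im) :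
    (k : ℂ) * jacobiTheta₂ 0 (k ^ 2 * τ) = ∑ j ∈ Finset.range k, jacobiTheta₂ (j / k) τ := by
  have h1 : HasSum (fun n : ℤ => ∑ j ∈ Finset.range k, jacobiTheta₂_term n (j / k) τ)
      (∑ j ∈ Finset.range k, jacobiTheta₂ (j / k) τ) :=
    hasSum_sum fun j _ => hasSum_jacobiTheta₂_term _ hτ
  have h2 : ∀ n : ℤ, ∑ j ∈ Finset.range k, jacobiTheta₂_term n (j / k) τ =
      (if (k : ℤ) ∣ n then (k : ℂ) else 0) * cexp (π * I * n ^ 2 * τ) := by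
    intro n
    rw [← root_sum k hk, Finset.sum_mul]
    refine Finset.sum_congr rfl fun j _ => ?_
    rw [jacobiTheta₂_term, ← Complex.exp_add]
  simp only [h2] at h1
  have hk' : (k : ℂ) ≠ 0 := by exact_mod_cast hk.ne'
  have him : 0 < ((k : ℂ) ^ 2 * τ).im := by
    have : ((k : ℂ) ^ 2 * τ).im = k ^ 2 * τ.im := by
      rw [show ((k : ℂ) ^ 2 * τ) = ((k ^ 2 : ℝ) : ℂ) * τ by push_cast; ring, Complex.im_ofReal_mul]
    rw [this]; positivity
  have h3 := (hasSum_jacobiTheta₂_term 0 him).mul_left (k : ℂ)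
  have inj : Function.Injective (fun m : ℤ => (k : ℤ) * m) :=
    fun x y h => mul_left_cancel₀ (by exact_mod_cast hk.ne') h
  refine (HasSum.unique h3 ?_)
  have := (inj.hasSum_iff (f := fun n : ℤ => (if (k : ℤ) ∣ n then (k : ℂ) else 0) * cexp (π * I * n ^ 2 * τ))
    (a := ∑ j ∈ Finset.range k, jacobiTheta₂ (j / k) τ) ?_).2 h1
  · have e : (fun i : ℤ => (k : ℂ) * jacobiTheta₂_term i 0 (k ^ 2 * τ)) = ((fun n : ℤ =>
      (if (k : ℤ) ∣ n then (k : ℂ) else 0) * cexp (π * I * n ^ 2 * τ)) ∘ fun m : ℤ => (k : ℤ) * m) := ?_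
    · rw [e]; exact this
    funext m
    simp only [Function.comp_apply, jacobiTheta₂_term]
    rw [if_pos (dvd_mul_right _ _)]
    congr 2
    push_cast; ring
  · intro n hn
    rw [if_neg, zero_mul]
    rintro ⟨m, rfl⟩
    exact hn ⟨m, rfl⟩

noncomputable def thZ (k : ℕ) (τ : ℂ) (j : ZMod k) : ℂ := jacobiTheta₂ (j.val / k) τ

lemma thZ_int (k : ℕ) (hk : 0 < k) (τ : ℂ) (m : ℤ) :
    jacobiTheta₂ (m / k) τ = thZ k τ (m : ZMod k) := by
  have : NeZero k := ⟨hk.ne'⟩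
  have hk' : (k : ℂ) ≠ 0 := by exact_mod_cast hk.ne'
  unfold thZ
  have h := Int.emod_add_mul_ediv m k
  have hv : (((m : ZMod k).val : ℕ) : ℤ) = m % k := ZMod.val_intCast m
  have : (m / k : ℂ) = ((m : ZMod k).val : ℂ) / k + ((m / k : ℤ) : ℂ) := by
    have e : (((m : ZMod k).val : ℕ) : ℂ) = ((m % k : ℤ) : ℂ) := by exact_mod_cast hv
    rw [e]
    have e2 : (m : ℂ) = ((m % k : ℤ) : ℂ) + k * ((m / k : ℤ) : ℂ) := by exact_mod_cast h.symm
    field_simp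
    exact e2
  rw [this, theta_add_left_int]

lemma sum_thZ (k : ℕ) [NeZero k] (τ : ℂ) :
    ∑ j ∈ Finset.range k, jacobiTheta₂ (j / k) τ = ∑ j : ZMod k, thZ k τ j := by
  have hk : 0 < k := NeZero.pos k
  refine Finset.sum_bij' (fun j _ => (j : ZMod k)) (fun j _ => j.val) ?_ ?_ ?_ ?_ ?_
  · simp
  · intro a _; simpa using ZMod.val_lt a
  · intro a ha; simpa using ZMod.val_cast_of_lt (Finset.mem_range.1 ha)
  · simp
  · intro a ha
    have := thZ_int k hk τ a
    simpa using this

noncomputable def th (d : ℕ) (τ : ℂ) : ℂ := jacobiTheta₂ 0 (2 * d * τ)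

noncomputable def kd (d : ℤ) : ℂ := if d % 4 = 1 then 1 else -1

lemma th_trans (e : ℕ) (he : 0 < e) (a b c d : ℤ) (hdet : a * d - b * c = 1) (hc : (4 * e : ℤ) ∣ c)
    (τ : ℂ) (hτ : 0 < τ.im) : ∃ μ : ℂ, μ ^ 2 = kd d * (c * τ + d) ∧
      ∀ k : ℕ, 0 < k → (4 * e * k ^ 2 : ℤ) ∣ c →
        th (e * k ^ 2) ((a * τ + b) / (c * τ + d)) = μ * th (e * k ^ 2) τ := by
  obtain ⟨c0, rfl⟩ := hc
  have hodd : a % 2 = 1 ∧ d % 2 = 1 := by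
    have : (a * d) % 2 = 1 := by
      have : a * d = 1 + 2 * (b * (2 * e * c0)) := by linarith
      rw [this]; simp
    rw [Int.mul_emod] at this
    rcases Int.emod_two_eq a with h1 | h1 <;> rcases Int.emod_two_eq d with h2 | h2 <;> simp_all
  have hE : Eprop a (2 * e * b) (2 * c0) d := by
    refine Eprop_all _ _ _ _ _ rfl (by linarith) (by omega) ?_ (by omega)
    rw [mul_assoc]; omega
  have he' : (e : ℂ) ≠ 0 := by exact_mod_cast he.ne'
  have him : 0 < (2 * e * τ).im := by
    rw [show (2 * e * τ : ℂ) = ((2 * e : ℝ) : ℂ) * τ by push_cast; ring, Complex.im_ofReal_mul]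
    positivity
  obtain ⟨μ, h1, h2⟩ := hE (2 * e * τ) him
  have e1 : ((2 * c0 : ℤ) : ℂ) * (2 * e * τ) + d = ((4 * e * c0 : ℤ) : ℂ) * τ + d := by
    push_cast; ring
  have e2 : (a : ℂ) * (2 * e * τ) + ((2 * e * b : ℤ) : ℂ) = 2 * e * (a * τ + b) := by
    push_cast; ring
  rw [e1] at h1
  simp only [e1, e2] at h2
  have hne : ((4 * e * c0 : ℤ) : ℂ) * τ + d ≠ 0 := denom_ne (Or.inr (by omega)) hτ
  refine ⟨μ, ?_, fun k hk hdvd => ?_⟩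
  · rw [h1]; congr 1; simp [kap, kd]
  have : NeZero k := ⟨hk.ne'⟩
  have hk' : (k : ℂ) ≠ 0 := by exact_mod_cast hk.ne'
  obtain ⟨s, hs⟩ : ∃ s : ℤ, c0 = k ^ 2 * s := by
    obtain ⟨s, hs⟩ := hdvd
    refine ⟨s, ?_⟩
    have : (4 * e : ℤ) * c0 = (4 * e) * (k ^ 2 * s) := by linarith
    exact mul_left_cancel₀ (by positivity) this
  have him2 : 0 < (2 * e * ((a * τ + b) / (((4 * e * c0 : ℤ) : ℂ) * τ + d))).im := by
    have hpos : 0 < ((a * τ + b) / (((4 * e * c0 : ℤ) : ℂ) * τ + d)).im := by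
      rw [Complex.div_im]
      have hn : 0 < Complex.normSq (((4 * e * c0 : ℤ) : ℂ) * τ + d) := Complex.normSq_pos.2 hne
      have hR : ((a : ℝ) * d - b * ((4 * e * c0 : ℤ) : ℝ)) = 1 := by exact_mod_cast hdet
      rw [← sub_div]
      apply div_pos _ hn
      have : (a * τ + b : ℂ).im * (((4 * e * c0 : ℤ) : ℂ) * τ + d).re -
        (a * τ + b : ℂ).re * (((4 * e * c0 : ℤ) : ℂ) * τ + d).im = τ.im := by
        generalize (4 * e * c0 : ℤ) = c at *
        simp only [Complex.add_im, Complex.add_re, Complex.mul_im, Complex.mul_re, Complex.intCast_re,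
          Complex.intCast_im]
        linear_combination τ.im * hR
      rw [this]; exact hτ
    rw [show (2 * e * ((a * τ + b) / (((4 * e * c0 : ℤ) : ℂ) * τ + d)) : ℂ) = ((2 * e : ℝ) : ℂ) *
      ((a * τ + b) / (((4 * e * c0 : ℤ) : ℂ) * τ + d)) by push_cast; ring, Complex.im_ofReal_mul]
    positivity
  have t1 := theta_mult k hk _ him
  have t2 := theta_mult k hk _ him2
  rw [sum_thZ] at t1
  have hu : ∀ j : ℕ, jacobiTheta₂ (j / k) (2 * e * ((a * τ + b) / (((4 * e * c0 : ℤ) : ℂ) * τ + d))) =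
      μ * thZ k (2 * e * τ) ((d : ZMod k) * (j : ZMod k)) := by
    intro j
    have := h2 (j / k * (((4 * e * c0 : ℤ) : ℂ) * τ + d))
    rw [mul_div_assoc, div_self hne, mul_one, mul_div_assoc] at this
    rw [this]
    have e3 : (j / k * (((4 * e * c0 : ℤ) : ℂ) * τ + d) : ℂ) =
      ((j * d : ℤ) : ℂ) / k + ((2 * j * k * s : ℤ) : ℂ) * (2 * e * τ) := by
      rw [hs]; push_cast; field_simp; ring
    rw [mul_assoc, mul_assoc]
    congr 1
    have e4 : thZ k (2 * e * τ) ((d : ZMod k) * (j : ZMod k)) =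
       jacobiTheta₂ (((j * d : ℤ) : ℂ) / k) (2 * e * τ) := by
      rw [thZ_int k hk]; congr 1; push_cast; ring
    rw [e4, e3, theta_add_left_tau, ← mul_assoc, ← Complex.exp_add]
    have e5 : cexp (π * I * (((2 * c0 : ℤ) : ℂ) * (((j * d : ℤ) : ℂ) / k + ((2 * j * k * s : ℤ) : ℂ) * (2 * e * τ)) ^ 2) /
      (((4 * e * c0 : ℤ) : ℂ) * τ + d) + -π * I * (((2 * j * k * s : ℤ) : ℂ) ^ 2 * (2 * e * τ) + 2 * ((2 * j * k * s : ℤ) : ℂ) * (((j * d : ℤ) : ℂ) / k))) = 1 := by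
      rw [Complex.exp_eq_one_iff]
      refine ⟨-(s * j ^ 2 * d), ?_⟩
      rw [← e3]
      have : ((j / k * (((4 * e * c0 : ℤ) : ℂ) * τ + d)) ^ 2 / (((4 * e * c0 : ℤ) : ℂ) * τ + d) : ℂ) =
        (j / k) ^ 2 * (((4 * e * c0 : ℤ) : ℂ) * τ + d) := by field_simp
      rw [mul_div_assoc, mul_div_assoc, this, hs]
      push_cast
      field_simp
      ring
    rw [e5, one_mul]
  have hunit : IsUnit ((d : ZMod k)) := by
    refine IsUnit.of_mul_eq_one (a : ZMod k) ?_
    have : ((a * d - b * (4 * e * (k ^ 2 * s)) : ℤ) : ZMod k) = 1 := by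
      rw [← hs, hdet]; simp
    push_cast at this
    simp at this
    rw [mul_comm]; exact this
  have : ∑ j ∈ Finset.range k, jacobiTheta₂ (j / k) (2 * e * ((a * τ + b) / (((4 * e * c0 : ℤ) : ℂ) * τ + d)))
      = μ * ∑ j : ZMod k, thZ k (2 * e * τ) j := by
    rw [sum_thZ]
    have e6 : ∀ j : ZMod k, thZ k (2 * e * ((a * τ + b) / (((4 * e * c0 : ℤ) : ℂ) * τ + d))) j =
      μ * thZ k (2 * e * τ) ((d : ZMod k) * j) := by
      intro j
      have := hu j.val
      simpa [thZ] using this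
    simp only [e6]
    rw [← Finset.mul_sum]
    congr 1
    obtain ⟨u, hu'⟩ := hunit
    rw [← hu']
    exact Equiv.sum_comp (Units.mulLeft u) (fun j => thZ k (2 * e * τ) j)
  rw [this, ← t1] at t2
  have := mul_left_cancel₀ hk' (t2.trans (by ring : _ = (k : ℂ) * (μ * jacobiTheta₂ 0 (k ^ 2 * (2 * e * τ)))))
  unfold th
  convert this using 2
  · push_cast; ring
  · congr 1; push_cast; ring

end P2

section P3
open Complex Real

def Q0 {R : Type*} [CommRing R] (t : ℕ → R) : R :=
  3 * (t 1 - t 4) * t 8 ^ 2 - 3 * (t 1 - t 4) * t 120 ^ 2 - 4 * (t 1 - t 4) * t 40 ^ 2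
    - (3 * (t 9 - t 36) - (t 1 - t 4)) * (3 * t 360 - t 40) ^ 2

def Qk {R : Type*} [CommRing R] (t : ℕ → R) : Fin 5 → R :=
  ![-6 * t 24 * (t 10 - t 40) * (t 15 - t 60),
    -6 * (t 3 - t 12) * t 40 * (t 30 - t 120),
    -6 * (t 5 - t 20) * (t 6 - t 24) * (t 30 - t 120),
    -6 * (t 2 - t 8) * (t 15 - t 60) * t 120,
    -6 * (t 5 - t 20) * (t 48 * (t 60 - t 240) + (t 12 - t 48) * t 240)]

def gE {R : Type*} [CommRing R] (t : ℕ → R) (ε : Fin 5 → ℤˣ) : R :=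
  Q0 t + ∑ k : Fin 5, (((ε k : ℤˣ) : ℤ) : R) * Qk t k

lemma exists_unit {x y : ℂ} (h : x ^ 2 = y ^ 2) : ∃ s : ℤˣ, x = ((s : ℤ) : ℂ) * y := by
  rcases sq_eq_sq_iff_eq_or_eq_neg.1 h with h | h
  · exact ⟨1, by simp [h]⟩
  · exact ⟨-1, by simp [h]⟩

lemma Q_trans (a b c d : ℤ) (hdet : a * d - b * c = 1) (hc : (2880 : ℤ) ∣ c)
    (τ : ℂ) (hτ : 0 < τ.im) : ∃ (m : ℂ) (s : Fin 5 → ℤˣ), m ^ 2 = (kd d * (c * τ + d)) ^ 3 ∧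
      Q0 (fun n => th n ((a * τ + b) / (c * τ + d))) = m * Q0 (fun n => th n τ) ∧
      ∀ k, Qk (fun n => th n ((a * τ + b) / (c * τ + d))) k =
        m * (((s k : ℤˣ) : ℤ) : ℂ) * Qk (fun n => th n τ) k := by
  obtain ⟨m1, s1, h1⟩ := th_trans 1 (by norm_num) a b c d hdet (dvd_trans (by norm_num) hc) τ hτ
  obtain ⟨m2, s2, h2⟩ := th_trans 2 (by norm_num) a b c d hdet (dvd_trans (by norm_num) hc) τ hτ
  obtain ⟨m3, s3, h3⟩ := th_trans 3 (by norm_num) a b c d hdet (dvd_trans (by norm_num) hc) τ hτ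
  obtain ⟨m5, s5, h5⟩ := th_trans 5 (by norm_num) a b c d hdet (dvd_trans (by norm_num) hc) τ hτ
  obtain ⟨m6, s6, h6⟩ := th_trans 6 (by norm_num) a b c d hdet (dvd_trans (by norm_num) hc) τ hτ
  obtain ⟨m10, s10, h10⟩ := th_trans 10 (by norm_num) a b c d hdet (dvd_trans (by norm_num) hc) τ hτ
  obtain ⟨m15, s15, h15⟩ := th_trans 15 (by norm_num) a b c d hdet (dvd_trans (by norm_num) hc) τ hτ
  obtain ⟨m30, s30, h30⟩ := th_trans 30 (by norm_num) a b c d hdet (dvd_trans (by norm_num) hc) τ hτ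
  set j := kd d * (c * τ + d) with hj
  have a1 := h1 1 (by norm_num) (dvd_trans (by norm_num) hc)
  have a4 := h1 2 (by norm_num) (dvd_trans (by norm_num) hc)
  have a9 := h1 3 (by norm_num) (dvd_trans (by norm_num) hc)
  have a36 := h1 6 (by norm_num) (dvd_trans (by norm_num) hc)
  have a2 := h2 1 (by norm_num) (dvd_trans (by norm_num) hc)
  have a8 := h2 2 (by norm_num) (dvd_trans (by norm_num) hc)
  have a3 := h3 1 (by norm_num) (dvd_trans (by norm_num) hc)
  have a12 := h3 2 (by norm_num) (dvd_trans (by norm_num) hc)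
  have a48 := h3 4 (by norm_num) (dvd_trans (by norm_num) hc)
  have a5 := h5 1 (by norm_num) (dvd_trans (by norm_num) hc)
  have a20 := h5 2 (by norm_num) (dvd_trans (by norm_num) hc)
  have a6 := h6 1 (by norm_num) (dvd_trans (by norm_num) hc)
  have a24 := h6 2 (by norm_num) (dvd_trans (by norm_num) hc)
  have a10 := h10 1 (by norm_num) (dvd_trans (by norm_num) hc)
  have a40 := h10 2 (by norm_num) (dvd_trans (by norm_num) hc)
  have a360 := h10 6 (by norm_num) (dvd_trans (by norm_num) hc)
  have a15 := h15 1 (by norm_num) (dvd_trans (by norm_num) hc)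
  have a60 := h15 2 (by norm_num) (dvd_trans (by norm_num) hc)
  have a240 := h15 4 (by norm_num) (dvd_trans (by norm_num) hc)
  have a30 := h30 1 (by norm_num) (dvd_trans (by norm_num) hc)
  have a120 := h30 2 (by norm_num) (dvd_trans (by norm_num) hc)
  norm_num only at a1 a4 a9 a36 a2 a8 a3 a12 a48 a5 a20 a6 a24 a10 a40 a360 a15 a60 a240 a30 a120
  obtain ⟨u0, hu0⟩ : ∃ s : ℤˣ, m6 * m10 * m15 = ((s : ℤ) : ℂ) * (m1 * j) :=
    exists_unit (by rw [mul_pow, mul_pow, mul_pow, s6, s10, s15, s1]; ring)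
  obtain ⟨u1, hu1⟩ : ∃ s : ℤˣ, m3 * m10 * m30 = ((s : ℤ) : ℂ) * (m1 * j) :=
    exists_unit (by rw [mul_pow, mul_pow, mul_pow, s3, s10, s30, s1]; ring)
  obtain ⟨u2, hu2⟩ : ∃ s : ℤˣ, m5 * m6 * m30 = ((s : ℤ) : ℂ) * (m1 * j) :=
    exists_unit (by rw [mul_pow, mul_pow, mul_pow, s5, s6, s30, s1]; ring)
  obtain ⟨u3, hu3⟩ : ∃ s : ℤˣ, m2 * m15 * m30 = ((s : ℤ) : ℂ) * (m1 * j) :=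
    exists_unit (by rw [mul_pow, mul_pow, mul_pow, s2, s15, s30, s1]; ring)
  obtain ⟨u4, hu4⟩ : ∃ s : ℤˣ, m5 * m3 * m15 = ((s : ℤ) : ℂ) * (m1 * j) :=
    exists_unit (by rw [mul_pow, mul_pow, mul_pow, s5, s3, s15, s1]; ring)
  refine ⟨m1 * j, ![u0, u1, u2, u3, u4], by rw [mul_pow, s1]; ring, ?_, ?_⟩
  · simp only [Q0, a1, a4, a8, a120, a40, a9, a36, a360]
    simp only [mul_pow, s2, s30, s10, ← mul_sub, ← mul_assoc]
    have e : (3 * m10 * th 360 τ - m10 * th 40 τ) ^ 2 = j * (3 * th 360 τ - th 40 τ) ^ 2 := by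
      rw [← s10]; ring
    rw [e]; ring
  · intro k
    fin_cases k
    · simp only [Qk, a24, a10, a40, a15, a60]
      dsimp
      linear_combination (-6 * th 24 τ * (th 10 τ - th 40 τ) * (th 15 τ - th 60 τ)) * hu0
    · simp only [Qk, a3, a12, a40, a30, a120]
      dsimp
      linear_combination (-6 * (th 3 τ - th 12 τ) * th 40 τ * (th 30 τ - th 120 τ)) * hu1
    · simp only [Qk, a5, a20, a6, a24, a30, a120]
      dsimp
      linear_combination (-6 * (th 5 τ - th 20 τ) * (th 6 τ - th 24 τ) * (th 30 τ - th 120 τ)) * hu2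
    · simp only [Qk, a2, a8, a15, a60, a120]
      dsimp
      linear_combination (-6 * (th 2 τ - th 8 τ) * (th 15 τ - th 60 τ) * th 120 τ) * hu3
    · simp only [Qk, a5, a20, a48, a60, a240, a12]
      dsimp
      linear_combination (-6 * (th 5 τ - th 20 τ) * (th 48 τ * (th 60 τ - th 240 τ)
        + (th 12 τ - th 48 τ) * th 240 τ)) * hu4

noncomputable def Fpre (τ : ℂ) : ℂ := ∏ ε : Fin 5 → ℤˣ, gE (fun n => th n τ) ε

lemma Fpre_trans (a b c d : ℤ) (hdet : a * d - b * c = 1) (hc : (2880 : ℤ) ∣ c)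
    (τ : ℂ) (hτ : 0 < τ.im) :
    Fpre ((a * τ + b) / (c * τ + d)) = (c * τ + d) ^ 48 * Fpre τ := by
  obtain ⟨m, s, hm, h0, hk⟩ := Q_trans a b c d hdet hc τ hτ
  have hg : ∀ ε : Fin 5 → ℤˣ, gE (fun n => th n ((a * τ + b) / (c * τ + d))) ε =
      m * gE (fun n => th n τ) (ε * s) := by
    intro ε
    simp only [gE, h0, hk, mul_add, Finset.mul_sum, Pi.mul_apply, Units.val_mul, Int.cast_mul]
    congr 1
    exact Finset.sum_congr rfl fun k _ => by ring
  have hk2 : kd d ^ 2 = 1 := by unfold kd; split_ifs <;> norm_num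
  have hcard : (Finset.univ : Finset (Fin 5 → ℤˣ)).card = 32 := by simp
  have hp : ∏ ε : Fin 5 → ℤˣ, gE (fun n => th n τ) (ε * s) = Fpre τ :=
    Equiv.prod_comp (Equiv.mulRight s) (fun ε => gE (fun n => th n τ) ε)
  have h1 : Fpre ((a * τ + b) / (c * τ + d)) = m ^ 32 * Fpre τ := by
    rw [← hp, ← hcard, ← Finset.prod_const, ← Finset.prod_mul_distrib]
    exact Finset.prod_congr rfl fun ε _ => hg ε
  have h2 : m ^ 32 = (c * τ + d) ^ 48 := by
    rw [show (32 : ℕ) = 2 * 16 by norm_num, pow_mul, hm, ← pow_mul, mul_pow,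
      show 3 * 16 = 2 * 24 by norm_num, pow_mul, hk2, one_pow, one_mul]
  rw [h1, h2]

end P3

section P4
open Complex Real

lemma summable_gauss {t : ℝ} (ht : 0 < t) : Summable fun n : ℤ => Real.exp (-π * t * (n : ℝ) ^ 2) := by
  have h := (hasSum_jacobiTheta₂_term 0 (τ := (t : ℂ) * I) (by simpa using ht)).summable.norm
  refine h.congr fun n => ?_
  rw [norm_jacobiTheta₂_term]
  simp; ring_nf

lemma gauss_mono {s t : ℝ} (hs : 0 < s) (hst : s ≤ t) :
    ∑' n : ℤ, Real.exp (-π * t * (n : ℝ) ^ 2) ≤ ∑' n : ℤ, Real.exp (-π * s * (n : ℝ) ^ 2) := by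
  refine (summable_gauss (hs.trans_le hst)).tsum_le_tsum (fun n => ?_) (summable_gauss hs)
  apply Real.exp_le_exp.2
  have : 0 ≤ (n : ℝ) ^ 2 := sq_nonneg _
  have h2 := mul_le_mul_of_nonneg_right (mul_le_mul_of_nonneg_left hst Real.pi_pos.le) this
  linarith

lemma gauss_bound : ∃ C : ℝ, 0 < C ∧ ∀ t : ℝ, 0 < t →
    ∑' n : ℤ, Real.exp (-π * t * (n : ℝ) ^ 2) ≤ C * (1 + 1 / Real.sqrt t) := by
  refine ⟨∑' n : ℤ, Real.exp (-π * 1 * (n : ℝ) ^ 2), ?_, fun t ht => ?_⟩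
  · exact (summable_gauss one_pos).tsum_pos (fun n => (Real.exp_pos _).le) 0 (Real.exp_pos _)
  set C := ∑' n : ℤ, Real.exp (-π * 1 * (n : ℝ) ^ 2)
  have hC : 0 ≤ C := tsum_nonneg fun n => (Real.exp_pos _).le
  have hs : 0 < 1 / Real.sqrt t := by positivity
  rcases le_total 1 t with h | h
  · refine (gauss_mono one_pos h).trans ?_
    change C ≤ _
    nlinarith
  · rw [Real.tsum_exp_neg_mul_int_sq ht, ← Real.sqrt_eq_rpow]
    have h1 : ∑' n : ℤ, Real.exp (-π / t * (n : ℝ) ^ 2) ≤ C := by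
      have := gauss_mono (s := 1) (t := 1 / t) one_pos (by rw [le_div_iff₀ ht]; linarith)
      simpa only [mul_one_div] using this
    have := mul_le_mul_of_nonneg_left h1 hs.le
    nlinarith

lemma th_bound (d : ℕ) (hd : 0 < d) : ∃ C : ℝ, 0 < C ∧ ∀ τ : ℂ, 0 < τ.im →
    ‖th d τ‖ ≤ C * (1 + 1 / Real.sqrt τ.im) := by
  obtain ⟨C, hC, h⟩ := gauss_bound
  refine ⟨C, hC, fun τ hτ => ?_⟩
  have hd1 : (1 : ℝ) ≤ d := by exact_mod_cast hd
  have him : (2 * d * τ : ℂ).im = 2 * d * τ.im := by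
    rw [show (2 * d * τ : ℂ) = ((2 * d : ℝ) : ℂ) * τ by push_cast; ring, Complex.im_ofReal_mul]
  have hpos : 0 < 2 * d * τ.im := by positivity
  have h1 : ‖th d τ‖ ≤ ∑' n : ℤ, Real.exp (-π * (2 * d * τ.im) * (n : ℝ) ^ 2) := by
    unfold th jacobiTheta₂
    have hs := summable_gauss hpos
    have e : ∀ n : ℤ, ‖jacobiTheta₂_term n 0 (2 * d * τ)‖ = Real.exp (-π * (2 * d * τ.im) * (n : ℝ) ^ 2) := by
      intro n
      rw [norm_jacobiTheta₂_term, him]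
      simp; ring_nf
    simp only [← e] at hs ⊢
    exact norm_tsum_le_tsum_norm hs
  refine h1.trans ((gauss_mono hτ (by nlinarith)).trans (h _ hτ))

/-- moderate growth class -/
def Gr (m : ℕ) (f : ℂ → ℂ) : Prop := ∃ C : ℝ, 0 < C ∧ ∀ τ : ℂ, 0 < τ.im →
    ‖f τ‖ ≤ C * (1 + 1 / Real.sqrt τ.im) ^ m

lemma Gr.add {m f g} (hf : Gr m f) (hg : Gr m g) : Gr m (fun τ => f τ + g τ) := by
  obtain ⟨C, hC, h⟩ := hf
  obtain ⟨D, hD, h'⟩ := hg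
  refine ⟨C + D, by positivity, fun τ hτ => (norm_add_le _ _).trans ?_⟩
  rw [add_mul]; exact add_le_add (h τ hτ) (h' τ hτ)

lemma Gr.mul {m n f g} (hf : Gr m f) (hg : Gr n g) : Gr (m + n) (fun τ => f τ * g τ) := by
  obtain ⟨C, hC, h⟩ := hf
  obtain ⟨D, hD, h'⟩ := hg
  refine ⟨C * D, by positivity, fun τ hτ => (norm_mul_le _ _).trans ?_⟩
  rw [show C * D * (1 + 1 / Real.sqrt τ.im) ^ (m + n) = (C * (1 + 1 / Real.sqrt τ.im) ^ m) *
    (D * (1 + 1 / Real.sqrt τ.im) ^ n) by ring]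
  exact mul_le_mul (h τ hτ) (h' τ hτ) (norm_nonneg _) (by positivity)

lemma Gr.const (c : ℂ) : Gr 0 (fun _ => c) :=
  ⟨‖c‖ + 1, by positivity, fun τ _ => by simp⟩

lemma Gr.smul (c : ℂ) {m f} (hf : Gr m f) : Gr m (fun τ => c * f τ) := by
  simpa using (Gr.const c).mul hf

lemma Gr.sub {m f g} (hf : Gr m f) (hg : Gr m g) : Gr m (fun τ => f τ - g τ) := by
  simpa [sub_eq_add_neg] using hf.add (hg.smul (-1))

lemma Gr.th (d : ℕ) (hd : 0 < d) : Gr 1 (fun τ => th d τ) := by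
  simpa [Gr] using th_bound d hd

lemma Gr.prod {ι : Type*} [DecidableEq ι] (s : Finset ι) (m : ℕ) (f : ι → ℂ → ℂ) (h : ∀ i, Gr m (f i)) :
    Gr (m * s.card) (fun τ => ∏ i ∈ s, f i τ) := by
  induction s using Finset.induction_on with
  | empty => simpa using Gr.const 1
  | insert a s ha ih =>
    simp only [Finset.prod_insert ha, Finset.card_insert_of_notMem ha]
    have := (h a).mul ih
    rwa [show m + m * s.card = m * (s.card + 1) by ring] at this

lemma Gr.gE (ε : Fin 5 → ℤˣ) : Gr 3 (fun τ => gE (fun n => _root_.th n τ) ε) := by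
  have T := fun d (hd : 0 < d) => Gr.th d hd
  have h0 : Gr 3 (fun τ => Q0 (fun n => _root_.th n τ)) := by
    unfold Q0
    simp only [pow_two]
    have D : Gr 1 (fun τ => _root_.th 1 τ - _root_.th 4 τ) := (T 1 (by norm_num)).sub (T 4 (by norm_num))
    have D9 : Gr 1 (fun τ => _root_.th 9 τ - _root_.th 36 τ) := (T 9 (by norm_num)).sub (T 36 (by norm_num))
    have E : Gr 1 (fun τ => 3 * _root_.th 360 τ - _root_.th 40 τ) :=
      ((T 360 (by norm_num)).smul 3).sub (T 40 (by norm_num))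
    have t8 := T 8 (by norm_num)
    have t120 := T 120 (by norm_num)
    have t40 := T 40 (by norm_num)
    exact ((((D.smul 3).mul (t8.mul t8)).sub ((D.smul 3).mul (t120.mul t120))).sub
      ((D.smul 4).mul (t40.mul t40))).sub (((D9.smul 3).sub D).mul (E.mul E))
  have hk : ∀ k, Gr 3 (fun τ => Qk (fun n => _root_.th n τ) k) := by
    intro k
    fin_cases k
    · exact (((T 24 (by norm_num)).smul (-6)).mul ((T 10 (by norm_num)).sub (T 40 (by norm_num)))).mul
        ((T 15 (by norm_num)).sub (T 60 (by norm_num)))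
    · exact ((((T 3 (by norm_num)).sub (T 12 (by norm_num))).smul (-6)).mul (T 40 (by norm_num))).mul
        ((T 30 (by norm_num)).sub (T 120 (by norm_num)))
    · exact ((((T 5 (by norm_num)).sub (T 20 (by norm_num))).smul (-6)).mul
        ((T 6 (by norm_num)).sub (T 24 (by norm_num)))).mul
        ((T 30 (by norm_num)).sub (T 120 (by norm_num)))
    · exact ((((T 2 (by norm_num)).sub (T 8 (by norm_num))).smul (-6)).mul
        ((T 15 (by norm_num)).sub (T 60 (by norm_num)))).mul (T 120 (by norm_num))
    · exact (((T 5 (by norm_num)).sub (T 20 (by norm_num))).smul (-6)).mul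
        (((T 48 (by norm_num)).mul ((T 60 (by norm_num)).sub (T 240 (by norm_num)))).add
        (((T 12 (by norm_num)).sub (T 48 (by norm_num))).mul (T 240 (by norm_num))))
  unfold _root_.gE
  simp only [Fin.sum_univ_five]
  exact h0.add ((((((hk 0).smul _).add ((hk 1).smul _)).add ((hk 2).smul _)).add ((hk 3).smul _)).add
    ((hk 4).smul _))

lemma Gr_Fpre : Gr 96 Fpre := by
  have := Gr.prod (Finset.univ : Finset (Fin 5 → ℤˣ)) 3 (fun ε τ => gE (fun n => th n τ) ε) Gr.gE
  have hcard : (Finset.univ : Finset (Fin 5 → ℤˣ)).card = 32 := by simp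
  rw [hcard] at this
  exact this

lemma th_diff (d : ℕ) (hd : 0 < d) {τ : ℂ} (hτ : 0 < τ.im) : DifferentiableAt ℂ (th d) τ := by
  have him : 0 < (2 * d * τ : ℂ).im := by
    rw [show (2 * d * τ : ℂ) = ((2 * d : ℝ) : ℂ) * τ by push_cast; ring, Complex.im_ofReal_mul]
    positivity
  exact (differentiableAt_jacobiTheta₂_snd 0 him).comp τ (by fun_prop)

lemma gE_diff (ε : Fin 5 → ℤˣ) {τ : ℂ} (hτ : 0 < τ.im) :
    DifferentiableAt ℂ (fun τ => gE (fun n => th n τ) ε) τ := by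
  have T := fun d (hd : 0 < d) => th_diff d hd hτ
  have h1 := T 1 (by norm_num)
  have h4 := T 4 (by norm_num)
  have h9 := T 9 (by norm_num)
  have h36 := T 36 (by norm_num)
  have h2 := T 2 (by norm_num)
  have h8 := T 8 (by norm_num)
  have h3 := T 3 (by norm_num)
  have h12 := T 12 (by norm_num)
  have h48 := T 48 (by norm_num)
  have h5 := T 5 (by norm_num)
  have h20 := T 20 (by norm_num)
  have h6 := T 6 (by norm_num)
  have h24 := T 24 (by norm_num)
  have h10 := T 10 (by norm_num)
  have h40 := T 40 (by norm_num)
  have h360 := T 360 (by norm_num)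
  have h15 := T 15 (by norm_num)
  have h60 := T 60 (by norm_num)
  have h240 := T 240 (by norm_num)
  have h30 := T 30 (by norm_num)
  have h120 := T 120 (by norm_num)
  simp only [gE, Q0, Qk, Fin.sum_univ_five]
  dsimp
  fun_prop

end P4

section P5
open Complex Real UpperHalfPlane CongruenceSubgroup ModularForm MatrixGroups
open scoped Manifold

noncomputable def Fh (τ : ℍ) : ℂ := Fpre τ

lemma sl_coe_smul (γ : SL(2, ℤ)) (τ : ℍ) : ((γ • τ : ℍ) : ℂ) =
    ((γ 0 0 : ℤ) * (τ : ℂ) + (γ 0 1 : ℤ)) / ((γ 1 0 : ℤ) * (τ : ℂ) + (γ 1 1 : ℤ)) := by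
  rw [UpperHalfPlane.specialLinearGroup_apply]
  simp

lemma sl_det (γ : SL(2, ℤ)) : γ 0 0 * γ 1 1 - γ 0 1 * γ 1 0 = 1 := by
  have := γ.det_coe
  rwa [Matrix.det_fin_two] at this

lemma sl_slash (f : ℍ → ℂ) (γ : SL(2, ℤ)) (τ : ℍ) : (f ∣[(48 : ℤ)] γ) τ =
    f (γ • τ) / ((γ 1 0 : ℤ) * (τ : ℂ) + (γ 1 1 : ℤ)) ^ 48 := by
  rw [ModularForm.SL_slash_apply, UpperHalfPlane.denom, zpow_neg, div_eq_mul_inv]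
  simp

lemma Fh_slash (γ : SL(2, ℤ)) (hγ : γ ∈ Gamma0 2880) : Fh ∣[(48 : ℤ)] γ = Fh := by
  funext τ
  rw [sl_slash]
  unfold Fh
  have hd := sl_det γ
  have hc : (2880 : ℤ) ∣ γ 1 0 := by
    rw [Gamma0_mem] at hγ
    exact (ZMod.intCast_zmod_eq_zero_iff_dvd _ _).1 hγ
  have hne : ((γ 1 0 : ℤ) * (τ : ℂ) + (γ 1 1 : ℤ) : ℂ) ≠ 0 := by
    apply denom_ne _ τ.im_pos
    by_contra! h
    rw [h.1, h.2] at hd; simp at hd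
  rw [sl_coe_smul, Fpre_trans _ _ _ _ hd hc _ τ.im_pos]
  field_simp

lemma gE_mdiff (ε : Fin 5 → ℤˣ) : MDiff (fun τ : ℍ => gE (fun n => th n τ) ε) := by
  rw [UpperHalfPlane.mdifferentiable_iff]
  intro z hz
  have h := (gE_diff ε (τ := z) hz).differentiableWithinAt (s := {z | 0 < z.im})
  refine h.congr (fun w hw => ?_) ?_
  · simp only [Function.comp_apply]; rw [ofComplex_apply_of_im_pos hw]
  · simp only [Function.comp_apply]; rw [ofComplex_apply_of_im_pos hz]

lemma Fh_local (γ : SL(2, ℤ)) : ∃ B : ℝ, ∀ τ : ℍ, |τ.re| ≤ 2880 → 1 ≤ τ.im →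
    ‖(Fh ∣[(48 : ℤ)] γ) τ‖ ≤ B := by
  obtain ⟨C, hC, h⟩ := Gr_Fpre
  set D : ℝ := 2880 * |(γ 1 0 : ℝ)| + |(γ 1 0 : ℝ)| + |(γ 1 1 : ℝ)| with hD
  refine ⟨C * (2 + 2 * D) ^ 48, fun τ hx hy => ?_⟩
  rw [sl_slash]
  set j : ℂ := ((γ 1 0 : ℤ) * (τ : ℂ) + (γ 1 1 : ℤ) : ℂ) with hj
  have hd := sl_det γ
  have hypos : 0 < τ.im := τ.im_pos
  have hjne : j ≠ 0 := by
    apply denom_ne _ τ.im_pos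
    by_contra! h
    rw [h.1, h.2] at hd; simp at hd
  have him : (γ • τ).im = τ.im / ‖j‖ ^ 2 := by
    rw [ModularGroup.im_smul_eq_div_normSq, Complex.normSq_eq_norm_sq]
    congr 3
  have hj1 : 1 ≤ ‖j‖ := by
    have him2 : j.im = (γ 1 0 : ℝ) * τ.im := by simp [hj]
    by_cases hc : γ 1 0 = 0
    · have h11 : γ 1 1 ≠ 0 := by intro h0; rw [hc, h0] at hd; simp at hd
      have : j = ((γ 1 1 : ℤ) : ℂ) := by rw [hj, hc]; simp
      rw [this, Complex.norm_intCast]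
      exact_mod_cast Int.one_le_abs h11
    · refine le_trans ?_ (Complex.abs_im_le_norm j)
      rw [him2, abs_mul]
      have h1 : (1 : ℝ) ≤ |(γ 1 0 : ℝ)| := by exact_mod_cast Int.one_le_abs hc
      have h2 : 1 ≤ |τ.im| := by rw [abs_of_pos hypos]; exact hy
      nlinarith
  have hj2 : ‖j‖ ≤ D * τ.im := by
    have h1 : ‖j‖ ≤ |(γ 1 0 : ℝ)| * ‖(τ : ℂ)‖ + |(γ 1 1 : ℝ)| := by
      refine (norm_add_le _ _).trans ?_
      rw [norm_mul, Complex.norm_intCast, Complex.norm_intCast]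
    have h2 : ‖(τ : ℂ)‖ ≤ 2880 + τ.im := by
      refine (Complex.norm_le_abs_re_add_abs_im _).trans ?_
      have : |(τ : ℂ).im| = τ.im := abs_of_pos hypos
      rw [this]
      exact add_le_add_left hx _
    have h3 : 0 ≤ |(γ 1 0 : ℝ)| := abs_nonneg _
    have h4 : 0 ≤ |(γ 1 1 : ℝ)| := abs_nonneg _
    have h5 := mul_le_mul_of_nonneg_left h2 h3
    rw [hD]
    nlinarith
  have hjpos : 0 < ‖j‖ := by linarith
  have hs : 1 / Real.sqrt ((γ • τ : ℍ) : ℂ).im = ‖j‖ / Real.sqrt τ.im := by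
    change 1 / Real.sqrt (γ • τ : ℍ).im = _
    rw [him, Real.sqrt_div hypos.le, Real.sqrt_sq hjpos.le, one_div_div]
  have hF := h _ (γ • τ).im_pos
  rw [hs] at hF
  rw [norm_div, norm_pow, div_le_iff₀ (by positivity)]
  refine hF.trans ?_
  rw [mul_assoc]
  refine mul_le_mul_of_nonneg_left ?_ hC.le
  rw [← mul_pow, show (96 : ℕ) = 2 * 48 by norm_num, pow_mul]
  refine pow_le_pow_left₀ (by positivity) ?_ 48
  set r := ‖j‖ / Real.sqrt τ.im with hr
  have hr2 : r ^ 2 ≤ D * ‖j‖ := by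
    rw [hr, div_pow, Real.sq_sqrt hypos.le, div_le_iff₀ hypos]
    nlinarith
  nlinarith [sq_nonneg (1 - r)]

lemma Fh_slash_T (γ : SL(2, ℤ)) (m : ℤ) :
    (Fh ∣[(48 : ℤ)] γ) ∣[(48 : ℤ)] (ModularGroup.T ^ (2880 * m)) = Fh ∣[(48 : ℤ)] γ := by
  rw [← SlashAction.slash_mul, show γ * ModularGroup.T ^ (2880 * m) =
    (γ * ModularGroup.T ^ (2880 * m) * γ⁻¹) * γ by group, SlashAction.slash_mul, Fh_slash]
  rw [Gamma0_mem]
  have h1 : (((γ * ModularGroup.T ^ (2880 * m) * γ⁻¹ : SL(2, ℤ)) 1 0 : ℤ)) = -(γ 1 0)^2 * (2880 * m) := by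
    have e : ((ModularGroup.T ^ (2880 * m) : SL(2, ℤ)) : Matrix (Fin 2) (Fin 2) ℤ) = !![1, 2880 * m; 0, 1] :=
      ModularGroup.coe_T_zpow _
    simp only [Matrix.SpecialLinearGroup.coe_mul, Matrix.SpecialLinearGroup.coe_inv, e,
      Matrix.adjugate_fin_two]
    simp [Matrix.mul_apply, Fin.sum_univ_two]
    ring
  rw [h1]
  push_cast
  have : (2880 : ZMod 2880) = 0 := by exact_mod_cast ZMod.natCast_self 2880
  rw [this]; simp

lemma Fh_bdd (γ : SL(2, ℤ)) : IsBoundedAtImInfty (Fh ∣[(48 : ℤ)] γ) := by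
  obtain ⟨B, hB⟩ := Fh_local γ
  rw [UpperHalfPlane.isBoundedAtImInfty_iff]
  refine ⟨B, 1, fun τ hτ => ?_⟩
  set m : ℤ := -⌊τ.re / 2880⌋ with hm
  have hper : (Fh ∣[(48 : ℤ)] γ) (ModularGroup.T ^ (2880 * m) • τ) = (Fh ∣[(48 : ℤ)] γ) τ := by
    have e : ((ModularGroup.T ^ (2880 * m) : SL(2, ℤ)) : Matrix (Fin 2) (Fin 2) ℤ) = !![1, 2880 * m; 0, 1] :=
      ModularGroup.coe_T_zpow _
    have := congrFun (Fh_slash_T γ m) τ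
    rw [sl_slash, e] at this
    simpa using this
  have hc : ((ModularGroup.T ^ (2880 * m) • τ : ℍ) : ℂ) = τ + (2880 * m : ℤ) := by
    have e : ((ModularGroup.T ^ (2880 * m) : SL(2, ℤ)) : Matrix (Fin 2) (Fin 2) ℤ) = !![1, 2880 * m; 0, 1] :=
      ModularGroup.coe_T_zpow _
    rw [sl_coe_smul, e]; simp
  rw [← hper]
  apply hB
  · have : (ModularGroup.T ^ (2880 * m) • τ : ℍ).re = τ.re + 2880 * m := by
      have := congrArg Complex.re hc
      simpa using this
    rw [this, hm, abs_le]
    have h1 := Int.floor_le (τ.re / 2880)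
    have h2 := Int.lt_floor_add_one (τ.re / 2880)
    push_cast
    constructor <;> linarith
  · have : (ModularGroup.T ^ (2880 * m) • τ : ℍ).im = τ.im := by
      have := congrArg Complex.im hc
      simpa using this
    rw [this]; exact hτ

noncomputable def FM : ModularForm ((Gamma0 2880).map (Matrix.SpecialLinearGroup.mapGL ℝ)) 48 where
  toFun := Fh
  slash_action_eq' := by
    rintro _ ⟨γ, hγ, rfl⟩
    exact Fh_slash γ hγ
  holo' := by
    have : Fh = ∏ ε : Fin 5 → ℤˣ, fun τ : ℍ => gE (fun n => th n τ) ε := by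
      funext τ; simp [Fh, Fpre]
    change MDiff Fh
    rw [this]
    exact MDifferentiable.prod fun ε _ => gE_mdiff ε
  bdd_at_cusps' := by
    intro c hc
    have hc' : IsCusp c 𝒮ℒ := by
      exact Subgroup.IsArithmetic.isCusp_iff_isCusp_SL2Z _ |>.1 hc
    rw [OnePoint.isBoundedAt_iff_forall_SL2Z hc']
    intro γ _
    exact Fh_bdd γ

end P5

section P6
open CongruenceSubgroup MatrixGroups

noncomputable def phiM (m p : ℕ) (a c : ℤ) : ZMod m ⊕ ZMod m :=
  open Classical in
  if (p : ℤ) ∣ a then Sum.inr ((a : ZMod m) * (c : ZMod m)⁻¹) else Sum.inl ((c : ZMod m) * (a : ZMod m)⁻¹)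

lemma unit_of_not_dvd (p k : ℕ) (hp : p.Prime) (a : ℤ) (h : ¬ (p : ℤ) ∣ a) :
    (a : ZMod (p ^ k)) * (a : ZMod (p ^ k))⁻¹ = 1 := by
  apply ZMod.mul_inv_of_unit
  have h1 : IsCoprime (p : ℤ) a := (Prime.coprime_iff_not_dvd (Nat.prime_iff_prime_int.1 hp)).2 h
  have h2 : IsCoprime ((p : ℤ) ^ k) a := h1.pow_left
  obtain ⟨u, v, huv⟩ := h2
  refine IsUnit.of_mul_eq_one (v : ZMod (p ^ k)) ?_
  have := congrArg (Int.cast : ℤ → ZMod (p ^ k)) huv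
  push_cast at this
  have h0 : (p : ZMod (p ^ k)) ^ k = 0 := by exact_mod_cast ZMod.natCast_self (p ^ k)
  rw [h0, mul_zero, zero_add] at this
  rw [mul_comm]; exact this

lemma phiM_inj (m p k : ℕ) (hp : p.Prime) (hm : m = p ^ k) (a b c d a' b' c' d' : ℤ)
    (h : a * d - b * c = 1) (h' : a' * d' - b' * c' = 1) (he : phiM m p a c = phiM m p a' c') :
    (m : ℤ) ∣ a * c' - a' * c := by
  subst hm
  rw [← ZMod.intCast_zmod_eq_zero_iff_dvd]
  push_cast
  have key : ∀ a b c d : ℤ, a * d - b * c = 1 → (p : ℤ) ∣ a → ¬ (p : ℤ) ∣ c := by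
    intro a b c d h ha hc
    have : (p : ℤ) ∣ 1 := by rw [← h]; exact dvd_sub (ha.mul_right _) (hc.mul_left _)
    exact (Nat.prime_iff_prime_int.1 hp).not_unit (isUnit_of_dvd_one this)
  unfold phiM at he
  split_ifs at he with h1 h2 h2
  · have e := Sum.inr_injective he
    have u1 := unit_of_not_dvd p k hp c (key _ _ _ _ h h1)
    have u2 := unit_of_not_dvd p k hp c' (key _ _ _ _ h' h2)
    generalize (c : ZMod (p ^ k))⁻¹ = x at *
    generalize (c' : ZMod (p ^ k))⁻¹ = y at *
    linear_combination (c * c' : ZMod (p ^ k)) * e - a * c' * u1 + a' * c * u2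
  · have e := Sum.inl_injective he
    have u1 := unit_of_not_dvd p k hp a h1
    have u2 := unit_of_not_dvd p k hp a' h2
    generalize (a : ZMod (p ^ k))⁻¹ = x at *
    generalize (a' : ZMod (p ^ k))⁻¹ = y at *
    linear_combination - (a * a' : ZMod (p ^ k)) * e + a' * c * u1 - a * c' * u2

lemma index_le : (Gamma0 2880).index ≤ 23040 := by
  rw [Subgroup.index]
  let φ : SL(2, ℤ) ⧸ Gamma0 2880 → (ZMod 64 ⊕ ZMod 64) × (ZMod 9 ⊕ ZMod 9) × (ZMod 5 ⊕ ZMod 5) :=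
    fun q => (phiM 64 2 (q.out 0 0) (q.out 1 0), phiM 9 3 (q.out 0 0) (q.out 1 0),
      phiM 5 5 (q.out 0 0) (q.out 1 0))
  have hφ : Function.Injective φ := by
    intro q r h
    rw [← q.out_eq', ← r.out_eq']
    rw [Prod.mk.injEq, Prod.mk.injEq] at h
    obtain ⟨h1, h2, h3⟩ := h
    have e1 := phiM_inj 64 2 6 (by norm_num) (by norm_num) _ _ _ _ _ _ _ _ (sl_det q.out) (sl_det r.out) h1
    have e2 := phiM_inj 9 3 2 (by norm_num) (by norm_num) _ _ _ _ _ _ _ _ (sl_det q.out) (sl_det r.out) h2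
    have e3 := phiM_inj 5 5 1 (by norm_num) (by norm_num) _ _ _ _ _ _ _ _ (sl_det q.out) (sl_det r.out) h3
    apply QuotientGroup.eq.2
    rw [Gamma0_mem]
    have : ((q.out⁻¹ * r.out : SL(2, ℤ)) 1 0 : ℤ) = q.out 0 0 * r.out 1 0 - r.out 0 0 * q.out 1 0 := by
      simp only [Matrix.SpecialLinearGroup.coe_mul, Matrix.SpecialLinearGroup.coe_inv,
        Matrix.adjugate_fin_two]
      simp [Matrix.mul_apply, Fin.sum_univ_two]
      ring
    rw [this, ZMod.intCast_zmod_eq_zero_iff_dvd]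
    push_cast at e1 e2 e3 ⊢
    omega
  have := Nat.card_le_card_of_injective φ hφ
  refine this.trans (le_of_eq ?_)
  simp [Nat.card_prod, Nat.card_sum]

lemma card_le : Nat.card (𝒮ℒ ⧸ ((Gamma0 2880).map (Matrix.SpecialLinearGroup.mapGL ℝ)).subgroupOf 𝒮ℒ)
    ≤ 23040 := by
  have : ((Gamma0 2880).map (Matrix.SpecialLinearGroup.mapGL ℝ)).relIndex 𝒮ℒ = (Gamma0 2880).index := by
    rw [MonoidHom.range_eq_map, Subgroup.relIndex_map_map_of_injective, Subgroup.relIndex_top_right]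
    exact Matrix.SpecialLinearGroup.mapGL_injective
  calc _ = ((Gamma0 2880).map (Matrix.SpecialLinearGroup.mapGL ℝ)).relIndex 𝒮ℒ := rfl
    _ ≤ _ := this ▸ index_le
end P6

section P7
open Complex Real UpperHalfPlane CongruenceSubgroup ModularForm MatrixGroups
open scoped Manifold

lemma gE_bddInf (ε : Fin 5 → ℤˣ) :
    IsBoundedAtImInfty (fun τ : ℍ => gE (fun n => th n τ) ε) := by
  obtain ⟨C, hC, h⟩ := Gr.gE ε
  rw [UpperHalfPlane.isBoundedAtImInfty_iff]
  refine ⟨C * 2 ^ 3, 1, fun τ hτ => ?_⟩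
  refine (h τ τ.im_pos).trans ?_
  refine mul_le_mul_of_nonneg_left ?_ hC.le
  refine pow_le_pow_left₀ (by positivity) ?_ 3
  have : 1 ≤ Real.sqrt τ.im := by rw [Real.one_le_sqrt]; exact hτ
  have h2 : 1 / Real.sqrt τ.im ≤ 1 := by rw [div_le_one (by linarith)]; exact this
  change 1 + 1 / Real.sqrt τ.im ≤ 2
  linarith

lemma bddInf_one : IsBoundedAtImInfty (1 : ℍ → ℂ) := by
  rw [UpperHalfPlane.isBoundedAtImInfty_iff]
  exact ⟨1, 1, fun τ hτ => by simp⟩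

lemma bddInf_mul {f g : ℍ → ℂ} (hf : IsBoundedAtImInfty f) (hg : IsBoundedAtImInfty g) :
    IsBoundedAtImInfty (f * g) := Filter.BoundedAtFilter.mul hf hg

lemma bddInf_prod {ι : Type*} (s : Finset ι) (f : ι → ℍ → ℂ)
    (h : ∀ i ∈ s, IsBoundedAtImInfty (f i)) : IsBoundedAtImInfty (∏ i ∈ s, f i) :=
  Finset.prod_induction f IsBoundedAtImInfty (fun _ _ => bddInf_mul) bddInf_one h

lemma norm_factor : ∃ H : ℍ → ℂ, IsBoundedAtImInfty H ∧
    ⇑(ModularForm.norm 𝒮ℒ FM) = (fun τ : ℍ => gE (fun n => th n τ) 1) * H := by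
  classical
  rw [ModularForm.coe_norm]
  letI := Fintype.ofFinite (𝒮ℒ ⧸ ((Gamma0 2880).map (Matrix.SpecialLinearGroup.mapGL ℝ)).subgroupOf 𝒮ℒ)
  rw [← Finset.mul_prod_erase Finset.univ _ (Finset.mem_univ (⟦1⟧ : 𝒮ℒ ⧸ _))]
  rw [SlashInvariantForm.quotientFunc_mk]
  have hF : (⇑FM : ℍ → ℂ) = (fun τ : ℍ => gE (fun n => th n τ) 1) *
      ∏ ε ∈ Finset.univ.erase (1 : Fin 5 → ℤˣ), (fun τ : ℍ => gE (fun n => th n τ) ε) := by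
    rw [Finset.mul_prod_erase Finset.univ (fun ε => (fun τ : ℍ => gE (fun n => th n τ) ε))
      (Finset.mem_univ _)]
    funext τ
    change Fpre τ = _
    rw [Finset.prod_apply]
    rfl
  have h1 : (⇑FM ∣[(48:ℤ)] ((1 : 𝒮ℒ).val)⁻¹ : ℍ → ℂ) = ⇑FM := by simp
  rw [h1, hF, mul_assoc]
  refine ⟨_, bddInf_mul (bddInf_prod _ _ fun ε _ => gE_bddInf ε) (bddInf_prod _ _ ?_), rfl⟩
  intro q _
  induction q using Quotient.inductionOn with | h x => ?_
  rw [SlashInvariantForm.quotientFunc_mk]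
  obtain ⟨γ, hγ⟩ := x⁻¹.2
  have : (x : GL (Fin 2) ℝ)⁻¹ = Matrix.SpecialLinearGroup.mapGL ℝ γ := by rw [hγ]; rfl
  rw [this]
  exact Fh_bdd γ

lemma exp_qbound {f : ℍ → ℂ} {L : ℕ} {C A : ℝ}
    (h : ∀ τ : ℍ, A ≤ τ.im → ‖f τ‖ ≤ C * Real.exp (-2 * π * L * τ.im))
    {n : ℕ} (hn : n < L) (c : ℂ)
    (hc : ∀ (t : ℝ) (ht : 0 < t), c = 1 / (1:ℝ) * ∫ u in (0:ℝ)..1,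
      1 / Function.Periodic.qParam 1 (u + t * Complex.I) ^ n * f ⟨u + t * Complex.I, by simpa using ht⟩) : c = 0 := by
  have hC : 0 ≤ C := by
    have := (norm_nonneg _).trans (h ⟨(|A| + 1 : ℝ) * Complex.I, by simp; positivity⟩ (by
      change A ≤ (((|A| + 1 : ℝ) : ℂ) * Complex.I).im
      simp; linarith [le_abs_self A]))
    exact nonneg_of_mul_nonneg_left this (Real.exp_pos _)
  have key : ∀ t : ℝ, max A 1 ≤ t → ‖c‖ ≤ C * Real.exp (-t) := by
    intro t ht
    have ht1 : 1 ≤ t := (le_max_right _ _).trans ht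
    have htA : A ≤ t := (le_max_left _ _).trans ht
    have ht0 : 0 < t := by linarith
    rw [hc t ht0]
    simp only [ofReal_one, ne_eq, one_ne_zero, not_false_eq_true, div_self, one_mul]
    have := intervalIntegral.norm_integral_le_of_norm_le_const (a := (0:ℝ)) (b := 1)
      (f := fun u : ℝ => 1 / Function.Periodic.qParam 1 (u + t * Complex.I) ^ n * f ⟨u + t * Complex.I, by simpa using ht0⟩)
      (C := C * Real.exp (-t)) ?_
    · simpa using this
    intro u _
    rw [norm_mul, norm_div, norm_pow, Function.Periodic.norm_qParam]
    have h1 := h ⟨u + t * Complex.I, by simpa using ht0⟩ (by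
      change A ≤ ((u : ℂ) + t * Complex.I).im
      simpa using htA)
    have h2 : (⟨u + t * Complex.I, by simpa using ht0⟩ : ℍ).im = t := by
      change ((u : ℂ) + t * Complex.I).im = t
      simp
    rw [h2] at h1
    have h3 : ((u : ℂ) + t * Complex.I).im = t := by simp
    refine (mul_le_mul_of_nonneg_left h1 (by positivity)).trans ?_
    rw [h3, ← Real.exp_nat_mul, norm_one, one_div, ← Real.exp_neg]
    calc _ = C * Real.exp (-(n * (-2 * π * t / 1)) + -2 * π * L * t) := by rw [Real.exp_add]; ring
      _ ≤ _ := by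
        refine mul_le_mul_of_nonneg_left (Real.exp_le_exp.2 ?_) hC
        have hnL : (n : ℝ) + 1 ≤ L := by exact_mod_cast hn
        have hp := Real.pi_gt_three
        have : 0 ≤ 2 * π * t * ((L : ℝ) - n - 1) := by
          have : 0 ≤ (L : ℝ) - n - 1 := by linarith
          positivity
        nlinarith
  have hlim : Filter.Tendsto (fun t : ℝ => C * Real.exp (-t)) Filter.atTop (nhds (C * 0)) :=
    (Real.tendsto_exp_neg_atTop_nhds_zero).const_mul C
  have : ‖c‖ ≤ C * 0 := ge_of_tendsto hlim (Filter.eventually_atTop.2 ⟨_, key⟩)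
  rw [mul_zero] at this
  exact norm_le_zero_iff.1 this

theorem sturm_step (C : ℝ) (h : ∀ τ : ℍ, 1 ≤ τ.im →
    ‖gE (fun n => th n τ) 1‖ ≤ C * Real.exp (-2 * π * (92161 : ℕ) * τ.im)) :
    ∃ ε : Fin 5 → ℤˣ, (fun τ : ℍ => gE (fun n => th n τ) ε) = 0 := by
  have hz : ModularForm.norm 𝒮ℒ FM = 0 := by
    apply sturm_bound_levelOne
    have hle : ((92161 : ℕ) : ℕ∞) ≤ (qExpansion 1 (ModularForm.norm 𝒮ℒ FM)).order := by
      apply PowerSeries.nat_le_order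
      intro i hi
      obtain ⟨H, hH, hN⟩ := norm_factor
      rw [UpperHalfPlane.isBoundedAtImInfty_iff] at hH
      obtain ⟨B, A, hB⟩ := hH
      refine exp_qbound (f := ⇑(ModularForm.norm 𝒮ℒ FM)) (L := 92161) (C := C * B) (A := max A 1) ?_ hi _
        (fun t ht => ModularFormClass.qExpansion_coeff_eq_intervalIntegral _ one_pos
          one_mem_strictPeriods_SL i ht)
      intro τ hτ
      rw [hN, Pi.mul_apply, norm_mul]
      have h1 := h τ ((le_max_right _ _).trans hτ)
      have h2 := hB τ ((le_max_left _ _).trans hτ)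
      calc _ ≤ (C * Real.exp (-2 * π * (92161 : ℕ) * τ.im)) * B :=
            mul_le_mul h1 h2 (norm_nonneg _) ((norm_nonneg _).trans h1)
        _ = _ := by ring
    refine lt_of_lt_of_le ?_ hle
    have := card_le
    norm_cast
    set N := Nat.card (𝒮ℒ ⧸ ((Gamma0 2880).map (Matrix.SpecialLinearGroup.mapGL ℝ)).subgroupOf 𝒮ℒ)
    omega
  rw [ModularForm.norm_eq_zero_iff] at hz
  have h2 : ∏ ε : Fin 5 → ℤˣ, (fun τ : ℍ => gE (fun n => th n τ) ε) = 0 := by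
    rw [← hz]
    funext τ
    change _ = Fpre τ
    rw [Finset.prod_apply]
    rfl
  rw [UpperHalfPlane.prod_eq_zero_iff (fun ε _ => gE_mdiff ε)] at h2
  obtain ⟨ε, _, h⟩ := h2
  exact ⟨ε, h⟩
end P7

section P8
open Complex Real UpperHalfPlane ModularForm MatrixGroups PowerSeries

noncomputable def qq (τ : ℍ) : ℂ := Function.Periodic.qParam 1 τ

lemma qq_norm (τ : ℍ) : ‖qq τ‖ = Real.exp (-2 * π * τ.im) := by
  rw [qq, Function.Periodic.norm_qParam, div_one]; rfl

def QRep (P : ℤ⟦X⟧) (F : ℍ → ℂ) : Prop :=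
  ∀ τ : ℍ, Summable (fun n => ‖((PowerSeries.coeff n P : ℤ) : ℂ) * qq τ ^ n‖) ∧
    HasSum (fun n => ((PowerSeries.coeff n P : ℤ) : ℂ) * qq τ ^ n) (F τ)

lemma QRep.add {P Q F G} (hP : QRep P F) (hQ : QRep Q G) : QRep (P + Q) (fun τ => F τ + G τ) := by
  intro τ
  have e : (fun n => ((PowerSeries.coeff n (P + Q) : ℤ) : ℂ) * qq τ ^ n) =
    fun n => ((PowerSeries.coeff n P : ℤ) : ℂ) * qq τ ^ n + ((PowerSeries.coeff n Q : ℤ) : ℂ) * qq τ ^ n := by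
    funext n; rw [map_add]; push_cast; ring
  rw [e]
  refine ⟨?_, (hP τ).2.add (hQ τ).2⟩
  refine Summable.of_nonneg_of_le (fun _ => norm_nonneg _) (fun n => ?_) ((hP τ).1.add (hQ τ).1)
  have := congrFun e n
  rw [this]
  exact norm_add_le _ _

lemma QRep.mul {P Q F G} (hP : QRep P F) (hQ : QRep Q G) : QRep (P * Q) (fun τ => F τ * G τ) := by
  intro τ
  have e : (fun n => ((PowerSeries.coeff n (P * Q) : ℤ) : ℂ) * qq τ ^ n) =
    fun n => ∑ kl ∈ Finset.HasAntidiagonal.antidiagonal n, (((PowerSeries.coeff kl.1 P : ℤ) : ℂ) * qq τ ^ kl.1) *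
      (((PowerSeries.coeff kl.2 Q : ℤ) : ℂ) * qq τ ^ kl.2) := by
    funext n
    rw [PowerSeries.coeff_mul]
    push_cast
    rw [Finset.sum_mul]
    refine Finset.sum_congr rfl fun kl h => ?_
    rw [← Finset.HasAntidiagonal.mem_antidiagonal.1 h, pow_add]; ring
  have h1 := summable_norm_sum_mul_antidiagonal_of_summable_norm (hP τ).1 (hQ τ).1
  have h2 := tsum_mul_tsum_eq_tsum_sum_antidiagonal_of_summable_norm (hP τ).1 (hQ τ).1
  have e' : (fun n => ‖((PowerSeries.coeff n (P * Q) : ℤ) : ℂ) * qq τ ^ n‖) =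
    fun n => ‖∑ kl ∈ Finset.HasAntidiagonal.antidiagonal n, (((PowerSeries.coeff kl.1 P : ℤ) : ℂ) * qq τ ^ kl.1) *
      (((PowerSeries.coeff kl.2 Q : ℤ) : ℂ) * qq τ ^ kl.2)‖ := by
    funext n; rw [← congrFun e n]
  rw [e, e']
  refine ⟨h1, ?_⟩
  rw [(hP τ).2.tsum_eq, (hQ τ).2.tsum_eq] at h2
  change HasSum _ (F τ * G τ)
  rw [h2]
  exact h1.of_norm.hasSum

lemma QRep.const (c : ℤ) : QRep (PowerSeries.C c) (fun _ => (c : ℂ)) := by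
  intro τ
  have e : (fun n => ((PowerSeries.coeff n (PowerSeries.C c) : ℤ) : ℂ) * qq τ ^ n) =
    fun n => if n = 0 then (c : ℂ) else 0 := by
    funext n; rw [PowerSeries.coeff_C]; split_ifs with h <;> simp [h]
  have e' : (fun n => ‖((PowerSeries.coeff n (PowerSeries.C c) : ℤ) : ℂ) * qq τ ^ n‖) =
    fun n => if n = 0 then ‖(c : ℂ)‖ else 0 := by
    funext n; rw [PowerSeries.coeff_C]; split_ifs with h <;> simp [h]
  rw [e, e']
  exact ⟨(hasSum_ite_eq 0 _).summable, hasSum_ite_eq 0 _⟩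

lemma QRep.int (c : ℤ) : QRep (c : ℤ⟦X⟧) (fun _ => (c : ℂ)) := by
  have := QRep.const c
  rwa [show PowerSeries.C c = (c : ℤ⟦X⟧) from eq_intCast _ _] at this

lemma QRep.smul (c : ℤ) {P F} (hP : QRep P F) : QRep ((c : ℤ⟦X⟧) * P) (fun τ => (c : ℂ) * F τ) :=
  (QRep.int c).mul hP

lemma QRep.sub {P Q F G} (hP : QRep P F) (hQ : QRep Q G) : QRep (P - Q) (fun τ => F τ - G τ) := by
  have := hP.add (hQ.smul (-1))
  have e1 : P - Q = P + ((-1 : ℤ) : ℤ⟦X⟧) * Q := by push_cast; ring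
  have e2 : (fun τ => F τ - G τ) = fun τ => F τ + ((-1 : ℤ) : ℂ) * G τ := by
    funext τ; push_cast; ring
  rw [e1, e2]; exact this

lemma QRep.pow2 {P F} (hP : QRep P F) : QRep (P ^ 2) (fun τ => F τ ^ 2) := by
  simp only [pow_two]; exact hP.mul hP

lemma QRep.sum {ι : Type*} [DecidableEq ι] (s : Finset ι) (P : ι → ℤ⟦X⟧) (F : ι → ℍ → ℂ) (h : ∀ i, QRep (P i) (F i)) :
    QRep (∑ i ∈ s, P i) (fun τ => ∑ i ∈ s, F i τ) := by
  induction s using Finset.induction_on with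
  | empty => simpa using QRep.int 0
  | insert i s hi ih => simp only [Finset.sum_insert hi]; exact (h i).add ih

lemma QRep.gE {t : ℕ → ℤ⟦X⟧} {f : ℕ → ℍ → ℂ} (h : ∀ n, 0 < n → QRep (t n) (f n)) (ε : Fin 5 → ℤˣ) :
    QRep (gE t ε) (fun τ => gE (fun n => f n τ) ε) := by
  have h3 := QRep.int 3
  have h4 := QRep.int 4
  have h6 := QRep.int (-6)
  have c3 : ((3 : ℤ) : ℤ⟦X⟧) = 3 := by norm_cast
  have c4 : ((4 : ℤ) : ℤ⟦X⟧) = 4 := by norm_cast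
  have c6 : ((-6 : ℤ) : ℤ⟦X⟧) = -6 := by norm_cast
  have d3 : ((3 : ℤ) : ℂ) = 3 := by norm_cast
  have d4 : ((4 : ℤ) : ℂ) = 4 := by norm_cast
  have d6 : ((-6 : ℤ) : ℂ) = -6 := by norm_cast
  rw [c3, d3] at h3
  rw [c4, d4] at h4
  rw [c6, d6] at h6
  have p (n : ℕ) (hn : 0 < n) := h n hn
  refine QRep.add ?_ ?_
  · unfold Q0
    refine QRep.sub (QRep.sub (QRep.sub ?_ ?_) ?_) ?_
    · exact (h3.mul ((p 1 (by decide)).sub (p 4 (by decide)))).mul (p 8 (by decide)).pow2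
    · exact (h3.mul ((p 1 (by decide)).sub (p 4 (by decide)))).mul (p 120 (by decide)).pow2
    · exact (h4.mul ((p 1 (by decide)).sub (p 4 (by decide)))).mul (p 40 (by decide)).pow2
    · exact ((h3.mul ((p 9 (by decide)).sub (p 36 (by decide)))).sub ((p 1 (by decide)).sub (p 4 (by decide)))).mul
        ((h3.mul (p 360 (by decide))).sub (p 40 (by decide))).pow2
  · apply QRep.sum
    intro k
    refine (QRep.int _).mul ?_
    fin_cases k
    · exact ((h6.mul (p 24 (by decide))).mul ((p 10 (by decide)).sub (p 40 (by decide)))).mul ((p 15 (by decide)).sub (p 60 (by decide)))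
    · exact ((h6.mul ((p 3 (by decide)).sub (p 12 (by decide)))).mul (p 40 (by decide))).mul ((p 30 (by decide)).sub (p 120 (by decide)))
    · exact ((h6.mul ((p 5 (by decide)).sub (p 20 (by decide)))).mul ((p 6 (by decide)).sub (p 24 (by decide)))).mul ((p 30 (by decide)).sub (p 120 (by decide)))
    · exact ((h6.mul ((p 2 (by decide)).sub (p 8 (by decide)))).mul ((p 15 (by decide)).sub (p 60 (by decide)))).mul (p 120 (by decide))
    · exact (h6.mul ((p 5 (by decide)).sub (p 20 (by decide)))).mul
        (((p 48 (by decide)).mul ((p 60 (by decide)).sub (p 240 (by decide)))).add (((p 12 (by decide)).sub (p 48 (by decide))).mul (p 240 (by decide))))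

noncomputable def Th (d : ℕ) : ℤ⟦X⟧ :=
  PowerSeries.mk fun n => ({m : ℤ | d * m.natAbs ^ 2 = n}.ncard : ℤ)

lemma QRep.th (d : ℕ) (hd : 0 < d) : QRep (Th d) (fun τ => th d τ) := by
  intro τ
  have him : 0 < (2 * d * (τ : ℂ)).im := by
    have : (2 * d * (τ : ℂ)).im = 2 * d * τ.im := by
      rw [show (2 * d * (τ : ℂ)) = ((2 * d : ℝ) : ℂ) * τ by push_cast; ring, Complex.im_ofReal_mul]; rfl
    rw [this]; have := τ.im_pos; positivity
  have h := hasSum_jacobiTheta₂_term 0 him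
  have e : ∀ n : ℤ, jacobiTheta₂_term n 0 (2 * d * τ) = qq τ ^ (d * n.natAbs ^ 2) := by
    intro n
    rw [jacobiTheta₂_term, qq, Function.Periodic.qParam, ← Complex.exp_nat_mul]
    congr 1
    have : ((n.natAbs : ℕ) : ℂ) ^ 2 = (n : ℂ) ^ 2 := by
      have h2 : ((n.natAbs : ℕ) : ℤ) ^ 2 = n ^ 2 := by simp
      have h3 := congrArg (Int.cast : ℤ → ℂ) h2
      push_cast at h3
      rw [← h3, ← Int.cast_natCast (R := ℂ)]
      simp
    push_cast
    rw [this]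
    ring
  simp only [e] at h
  have hn := h.summable.norm
  have key : ∀ c : ℕ, ∀ {E : Type} [NormedAddCommGroup E] [NormedSpace ℝ E] (f : ℕ → E),
      ∑' b : ((fun n : ℤ => d * n.natAbs ^ 2) ⁻¹' {c}), f (d * b.1.natAbs ^ 2) =
        ({m : ℤ | d * m.natAbs ^ 2 = c}.ncard) • f c := by
    intro c E _ _ f
    have : ∀ b : ((fun n : ℤ => d * n.natAbs ^ 2) ⁻¹' {c}), f (d * b.1.natAbs ^ 2) = f c :=
      fun b => by have := b.2; simp only [Set.mem_preimage, Set.mem_singleton_iff] at this; rw [this]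
    simp only [this]
    rw [tsum_const]
    rfl
  constructor
  · have h2 := (hn.hasSum.tsum_fiberwise (fun n : ℤ => d * n.natAbs ^ 2)).summable
    refine h2.congr fun c => ?_
    have := key c (fun n => ‖qq τ ^ n‖)
    rw [this]
    simp [Th]
  · have h2 := (h.tsum_fiberwise (fun n : ℤ => d * n.natAbs ^ 2))
    have e2 : (fun c : ℕ => ∑' (b : ((fun n : ℤ => d * n.natAbs ^ 2) ⁻¹' {c})), qq τ ^ (d * b.1.natAbs ^ 2)) =
        fun n => ((PowerSeries.coeff n (Th d) : ℤ) : ℂ) * qq τ ^ n := by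
      funext c
      have := key c (fun n => qq τ ^ n)
      rw [this]
      simp [Th]
    rw [e2] at h2
    exact h2

lemma QRep.decay {P F} (hP : QRep P F) (L : ℕ) (h0 : ∀ n < L, PowerSeries.coeff n P = 0) :
    ∃ C : ℝ, ∀ τ : ℍ, 1 ≤ τ.im → ‖F τ‖ ≤ C * Real.exp (-2 * π * L * τ.im) := by
  set r : ℝ := ‖qq UpperHalfPlane.I‖ with hr
  have hr' : r = Real.exp (-2 * π) := by rw [hr, qq_norm]; simp
  have hr0 : 0 < r := by rw [hr']; exact Real.exp_pos _
  refine ⟨(∑' n, ‖((PowerSeries.coeff n P : ℤ) : ℂ) * qq UpperHalfPlane.I ^ n‖) / r ^ L, fun τ hτ => ?_⟩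
  have hS := (hP UpperHalfPlane.I).1
  rw [← (hP τ).2.tsum_eq]
  refine (norm_tsum_le_tsum_norm (hP τ).1).trans ?_
  have hq : ‖qq τ‖ ≤ r := by
    rw [hr', qq_norm]; apply Real.exp_le_exp.2; nlinarith [Real.pi_pos]
  have e : Real.exp (-2 * π * L * τ.im) = ‖qq τ‖ ^ L := by
    rw [qq_norm, ← Real.exp_nat_mul]; congr 1; ring
  rw [e, div_mul_eq_mul_div, mul_div_assoc, ← tsum_mul_right]
  refine (hP τ).1.tsum_le_tsum (fun n => ?_) (hS.mul_right _)
  rw [norm_mul, norm_mul, norm_pow, norm_pow, ← hr]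
  by_cases hn : n < L
  · rw [h0 n hn]; simp
  · obtain ⟨m, rfl⟩ := Nat.exists_eq_add_of_le (not_lt.1 hn)
    rw [mul_assoc]
    refine mul_le_mul_of_nonneg_left ?_ (norm_nonneg _)
    have : r ^ (L + m) * (‖qq τ‖ ^ L / r ^ L) = ‖qq τ‖ ^ L * r ^ m := by
      rw [pow_add]; field_simp
    rw [this, pow_add]
    exact mul_le_mul_of_nonneg_left (pow_le_pow_left₀ (norm_nonneg _) hq _) (by positivity)

lemma QRep.eq_zero {P} (hP : QRep P (fun _ => 0)) : P = 0 := by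
  ext n
  have := ModularFormClass.qExpansion_coeff_unique (h := 1) (Γ := 𝒮ℒ) (k := 0)
    (c := fun n => ((PowerSeries.coeff n P : ℤ) : ℂ)) one_pos one_mem_strictPeriods_SL
    (f := (0 : ModularForm 𝒮ℒ 0)) (fun τ => by simpa [qq] using (hP τ).2) n
  have h2 : (qExpansion 1 (0 : ModularForm 𝒮ℒ 0)).coeff n = 0 := by
    rw [FunLike.coe_zero, qExpansion_zero]; simp
  rw [h2] at this
  simpa using this
end P8

section P9
open Polynomial

lemma map_gE {R S : Type*} [CommRing R] [CommRing S] (φ : R →+* S) (t : ℕ → R) (ε : Fin 5 → ℤˣ) :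
    φ (gE t ε) = gE (fun n => φ (t n)) ε := by
  have h3 : φ 3 = 3 := map_ofNat φ 3
  have h4 : φ 4 = 4 := map_ofNat φ 4
  have h6 : φ 6 = 6 := map_ofNat φ 6
  simp [gE, Q0, Qk, Fin.sum_univ_succ, h3, h4, h6]

lemma gE_congr {R : Type*} [CommRing R] {t t' : ℕ → R} (h : ∀ n, 0 < n → t n = t' n) (ε : Fin 5 → ℤˣ) :
    gE t ε = gE t' ε := by
  simp [gE, Q0, Qk, Fin.sum_univ_succ, h]

noncomputable def Tp (L K d : ℕ) : ℤ[X] :=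
  ∑ m ∈ Finset.Icc (-(K : ℤ)) K, if d * m.natAbs ^ 2 < L then X ^ (d * m.natAbs ^ 2) else 0

lemma Tp_coeff {L K d : ℕ} (hd : 0 < d) (hK : L ≤ (K + 1) ^ 2) {n : ℕ} (hn : n < L) :
    (Tp L K d).coeff n = PowerSeries.coeff n (Th d) := by
  have hset : {m : ℤ | d * m.natAbs ^ 2 = n} =
      ↑((Finset.Icc (-(K : ℤ)) K).filter (fun m => d * m.natAbs ^ 2 = n)) := by
    ext m
    simp only [Set.mem_ofPred_eq, Finset.coe_filter, Finset.mem_Icc]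
    refine ⟨fun h => ⟨?_, h⟩, fun h => h.2⟩
    have h1 : m.natAbs ^ 2 < (K + 1) ^ 2 := by nlinarith [Nat.zero_le (m.natAbs ^ 2)]
    have := lt_of_pow_lt_pow_left₀ 2 (by positivity) h1
    omega
  rw [Th, PowerSeries.coeff_mk, hset, Set.ncard_coe_finset, Tp, Polynomial.finsetSum_coeff,
    Finset.card_filter]
  push_cast
  refine Finset.sum_congr rfl fun m _ => ?_
  split_ifs with h1 h2 h2
  · simp [h2]
  · rw [Polynomial.coeff_X_pow, if_neg (fun h => h2 h.symm)]
  · omega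
  · simp

lemma gE_coeff {L K : ℕ} (hK : L ≤ (K + 1) ^ 2) (ε : Fin 5 → ℤˣ) {n : ℕ} (hn : n < L) :
    (gE (Tp L K) ε).coeff n = PowerSeries.coeff n (gE Th ε) := by
  set J : Ideal (PowerSeries ℤ) := Ideal.span {PowerSeries.X ^ L} with hJ
  have h1 : ∀ d, 0 < d → Ideal.Quotient.mk J ((Tp L K d : ℤ[X]) : PowerSeries ℤ) = Ideal.Quotient.mk J (Th d) := by
    intro d hd
    rw [Ideal.Quotient.eq, hJ, Ideal.mem_span_singleton, PowerSeries.X_pow_dvd_iff]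
    intro m hm
    rw [map_sub, Polynomial.coeff_coe, Tp_coeff hd hK hm, sub_self]
  have h2 := gE_congr h1 ε
  rw [← map_gE (Ideal.Quotient.mk J) Th ε] at h2
  have h3 := map_gE (Ideal.Quotient.mk J) (fun d => ((Tp L K d : ℤ[X]) : PowerSeries ℤ)) ε
  rw [← h3] at h2
  have h4 := map_gE (Polynomial.coeToPowerSeries.ringHom (R := ℤ)) (Tp L K) ε
  simp only [Polynomial.coeToPowerSeries.ringHom_apply] at h4
  rw [← h4, Ideal.Quotient.eq, hJ, Ideal.mem_span_singleton, PowerSeries.X_pow_dvd_iff] at h2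
  have h5 := h2 n hn
  rw [map_sub, Polynomial.coeff_coe, sub_eq_zero] at h5
  exact h5

/-- digit extraction -/
lemma digits {B : ℤ} (hB : 0 < B) (L : ℕ) : ∀ P : ℤ[X], (∀ n, |P.coeff n| < B) → B ^ L ∣ P.eval B →
    ∀ n < L, P.coeff n = 0 := by
  induction L with
  | zero => intro P _ _ n hn; omega
  | succ L ih =>
    intro P hP hd n hn
    have e : P.eval B = (P.divX).eval B * B + P.coeff 0 := by
      conv_lhs => rw [← Polynomial.divX_mul_X_add P]
      simp
    have h0 : P.coeff 0 = 0 := by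
      have h1 : B ∣ P.eval B := (dvd_pow_self B (Nat.succ_ne_zero L)).trans hd
      rw [e] at h1
      have h2 : B ∣ P.coeff 0 := (Int.dvd_add_right (Dvd.intro_left _ rfl)).1 h1
      exact Int.eq_zero_of_abs_lt_dvd h2 (hP 0)
    rcases n with _ | n
    · exact h0
    · rw [← Polynomial.coeff_divX]
      refine ih P.divX (fun n => by rw [Polynomial.coeff_divX]; exact hP _) ?_ n (by omega)
      rw [e, h0, add_zero, pow_succ] at hd
      exact Int.dvd_of_mul_dvd_mul_right hB.ne' hd

lemma not_dvd_eval {B : ℤ} (L : ℕ) (P : ℤ[X]) (h : ∀ n < L, P.coeff n = 0) : B ^ L ∣ P.eval B := by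
  have : X ^ L ∣ P := (Polynomial.X_pow_dvd_iff).2 h
  obtain ⟨Q, rfl⟩ := this
  simp

def Nb (P : ℤ[X]) (c : ℤ) : Prop := ∃ P' : ℤ[X], (∀ n, |P.coeff n| ≤ P'.coeff n) ∧ P'.eval 1 = c

lemma Nb.add {P Q a b} (hP : Nb P a) (hQ : Nb Q b) : Nb (P + Q) (a + b) := by
  obtain ⟨P', h1, h2⟩ := hP
  obtain ⟨Q', h3, h4⟩ := hQ
  refine ⟨P' + Q', fun n => ?_, by simp [h2, h4]⟩
  rw [coeff_add, coeff_add]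
  exact (abs_add_le _ _).trans (add_le_add (h1 n) (h3 n))

lemma Nb.sub {P Q a b} (hP : Nb P a) (hQ : Nb Q b) : Nb (P - Q) (a + b) := by
  obtain ⟨P', h1, h2⟩ := hP
  obtain ⟨Q', h3, h4⟩ := hQ
  refine ⟨P' + Q', fun n => ?_, by simp [h2, h4]⟩
  rw [coeff_sub, coeff_add]
  exact (abs_sub _ _).trans (add_le_add (h1 n) (h3 n))

lemma Nb.mul {P Q a b} (hP : Nb P a) (hQ : Nb Q b) : Nb (P * Q) (a * b) := by
  obtain ⟨P', h1, h2⟩ := hP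
  obtain ⟨Q', h3, h4⟩ := hQ
  refine ⟨P' * Q', fun n => ?_, by simp [h2, h4]⟩
  rw [coeff_mul, coeff_mul]
  refine (Finset.abs_sum_le_sum_abs _ _).trans (Finset.sum_le_sum fun x _ => ?_)
  rw [abs_mul]
  exact mul_le_mul (h1 _) (h3 _) (abs_nonneg _) ((abs_nonneg _).trans (h1 _))

lemma Nb.const (c : ℤ) : Nb (c : ℤ[X]) |c| := by
  refine ⟨C |c|, fun n => ?_, by simp⟩
  rw [← Polynomial.C_eq_intCast, coeff_C, coeff_C]
  split_ifs <;> simp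

lemma Nb.le {P a} (hP : Nb P a) (n : ℕ) : |P.coeff n| ≤ a := by
  obtain ⟨P', h1, h2⟩ := hP
  have h0 : ∀ n, 0 ≤ P'.coeff n := fun n => (abs_nonneg _).trans (h1 n)
  refine (h1 n).trans ?_
  rw [← h2, Polynomial.eval_eq_sum_range' (lt_of_lt_of_le (Nat.lt_succ_self _) (Nat.succ_le_succ (le_max_left P'.natDegree n)))]
  simp only [one_pow, mul_one]
  exact Finset.single_le_sum (f := fun i => P'.coeff i) (fun i _ => h0 i) (Finset.mem_range.2 (Nat.lt_succ_of_le (le_max_right _ _)))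

lemma Nb.tp (L K d : ℕ) : Nb (Tp L K d) (2 * K + 1) := by
  refine ⟨∑ m ∈ Finset.Icc (-(K : ℤ)) K, X ^ (d * m.natAbs ^ 2), fun n => ?_, ?_⟩
  · rw [Tp, finsetSum_coeff, finsetSum_coeff]
    refine (Finset.abs_sum_le_sum_abs _ _).trans (Finset.sum_le_sum fun x _ => ?_)
    split_ifs
    · rw [coeff_X_pow]; split_ifs <;> simp
    · rw [coeff_X_pow]; split_ifs <;> simp
  · simp [Polynomial.eval_finsetSum]; omega

lemma Nb.gE {t : ℕ → ℤ[X]} {N : ℤ} (h : ∀ n, Nb (t n) N) : Nb (gE t 1)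
    (3 * (N + N) * (N * N) + 3 * (N + N) * (N * N) + 4 * (N + N) * (N * N) +
      (3 * (N + N) + (N + N)) * ((3 * N + N) * (3 * N + N)) +
      (6 * N * (N + N) * (N + N) + 6 * (N + N) * N * (N + N) + 6 * (N + N) * (N + N) * (N + N)
        + 6 * (N + N) * (N + N) * N + 6 * (N + N) * (N * (N + N) + (N + N) * N))) := by
  have h3 : Nb (3 : ℤ[X]) 3 := by simpa using Nb.const 3
  have h4 : Nb (4 : ℤ[X]) 4 := by simpa using Nb.const 4
  have h6 : Nb (-6 : ℤ[X]) 6 := by simpa using Nb.const (-6)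
  have e : _root_.gE t 1 = Q0 t + (Qk t 0 + Qk t 1 + Qk t 2 + Qk t 3 + Qk t 4) := by
    simp [_root_.gE, Fin.sum_univ_succ]; ring
  rw [e]
  refine Nb.add ?_ (Nb.add (Nb.add (Nb.add (Nb.add ?_ ?_) ?_) ?_) ?_)
  · unfold Q0
    simp only [pow_two]
    exact (((((h3.mul ((h 1).sub (h 4))).mul ((h 8).mul (h 8))).sub ((h3.mul ((h 1).sub (h 4))).mul ((h 120).mul (h 120)))).sub
      ((h4.mul ((h 1).sub (h 4))).mul ((h 40).mul (h 40))))).sub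
      (((h3.mul ((h 9).sub (h 36))).sub ((h 1).sub (h 4))).mul (((h3.mul (h 360)).sub (h 40)).mul ((h3.mul (h 360)).sub (h 40))))
  · exact ((h6.mul (h 24)).mul ((h 10).sub (h 40))).mul ((h 15).sub (h 60))
  · exact ((h6.mul ((h 3).sub (h 12))).mul (h 40)).mul ((h 30).sub (h 120))
  · exact ((h6.mul ((h 5).sub (h 20))).mul ((h 6).sub (h 24))).mul ((h 30).sub (h 120))
  · exact ((h6.mul ((h 2).sub (h 8))).mul ((h 15).sub (h 60))).mul (h 120)
  · exact (h6.mul ((h 5).sub (h 20))).mul (((h 48).mul ((h 60).sub (h 240))).add (((h 12).sub (h 48)).mul (h 240)))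

def tv (w L d : ℕ) : ℕ → ℕ
  | 0 => bif Nat.blt 0 L then 1 else 0
  | k + 1 => tv w L d k + bif Nat.blt (d * (k + 1) ^ 2) L then 2 * 2 ^ (w * (d * (k + 1) ^ 2)) else 0

lemma Tp_eval (w L d K : ℕ) : (Tp L K d).eval (2 ^ w) = (tv w L d K : ℤ) := by
  induction K with
  | zero =>
    simp only [Tp, tv, Nat.blt_eq, Bool.cond_eq_ite]
    simp
    split_ifs <;> simp
  | succ k ih =>
    have hs : Finset.Icc (-((k + 1 : ℕ) : ℤ)) ((k + 1 : ℕ) : ℤ) =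
        insert (-((k + 1 : ℕ) : ℤ)) (insert ((k + 1 : ℕ) : ℤ) (Finset.Icc (-(k : ℤ)) k)) := by
      ext m; simp only [Finset.mem_Icc, Finset.mem_insert]; omega
    have e : Tp L (k + 1) d = Tp L k d + if d * (k + 1) ^ 2 < L then 2 * X ^ (d * (k + 1) ^ 2) else 0 := by
      rw [Tp, hs, Finset.sum_insert, Finset.sum_insert, ← Tp]
      · simp only [Int.natAbs_neg, Int.natAbs_natCast]
        split_ifs <;> ring
      · simp
      · simp only [Finset.mem_Icc, Finset.mem_insert]; omega
    rw [e, eval_add, ih, tv]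
    simp only [Nat.blt_eq, Bool.cond_eq_ite]
    split_ifs
    · simp [pow_mul]
    · simp
end P9

section P10
open Polynomial

def posF (g : ℕ → ℕ) : ℕ :=
  3 * g 1 * g 8 ^ 2 + 3 * g 4 * g 120 ^ 2 + 4 * g 4 * g 40 ^ 2
  + (3 * g 9 + g 4) * (6 * g 360 * g 40) + (3 * g 36 + g 1) * (9 * g 360 ^ 2 + g 40 ^ 2)
  + 6 * g 24 * (g 10 * g 60 + g 40 * g 15) + 6 * g 40 * (g 3 * g 120 + g 12 * g 30)
  + 6 * ((g 5 * g 6 + g 20 * g 24) * g 120 + (g 5 * g 24 + g 20 * g 6) * g 30)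
  + 6 * g 120 * (g 2 * g 60 + g 8 * g 15)
  + 6 * (g 5 * (2 * g 48 * g 240) + g 20 * (g 48 * g 60 + g 12 * g 240))

def negF (g : ℕ → ℕ) : ℕ :=
  3 * g 4 * g 8 ^ 2 + 3 * g 1 * g 120 ^ 2 + 4 * g 1 * g 40 ^ 2
  + (3 * g 9 + g 4) * (9 * g 360 ^ 2 + g 40 ^ 2) + (3 * g 36 + g 1) * (6 * g 360 * g 40)
  + 6 * g 24 * (g 10 * g 15 + g 40 * g 60) + 6 * g 40 * (g 3 * g 30 + g 12 * g 120)
  + 6 * ((g 5 * g 6 + g 20 * g 24) * g 30 + (g 5 * g 24 + g 20 * g 6) * g 120)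
  + 6 * g 120 * (g 2 * g 15 + g 8 * g 60)
  + 6 * (g 5 * (g 48 * g 60 + g 12 * g 240) + g 20 * (2 * g 48 * g 240))

lemma gE_pos_neg (g : ℕ → ℕ) : gE (fun n => (g n : ℤ)) 1 = (posF g : ℤ) - (negF g : ℤ) := by
  simp [gE, Q0, Qk, Fin.sum_univ_succ, posF, negF]
  ring

def lchk (k p n : ℕ) : Prop := Nat.land p (2 ^ k - 1) = Nat.land n (2 ^ k - 1)

instance (k p n : ℕ) : Decidable (lchk k p n) :=
  inferInstanceAs (Decidable (Nat.land p (2 ^ k - 1) = Nat.land n (2 ^ k - 1)))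

lemma land_dvd (p n k : ℕ) (h : lchk k p n) :
    (2 : ℤ) ^ k ∣ (p : ℤ) - (n : ℤ) := by
  unfold lchk at h
  have e : ∀ x : ℕ, Nat.land x (2 ^ k - 1) = x % 2 ^ k :=
    fun x => Nat.and_two_pow_sub_one_eq_mod x _
  rw [e, e] at h
  have := (Nat.modEq_iff_dvd.1 (show n ≡ p [MOD 2 ^ k] from h.symm))
  exact_mod_cast this

lemma big_check : lchk (40 * 92161) (posF (fun d => tv 40 92161 d 303)) (negF (fun d => tv 40 92161 d 303)) := by
  decide +kernel

lemma big_dvd : ((2 ^ 40 : ℤ)) ^ 92161 ∣ (gE (Tp 92161 303) 1).eval (2 ^ 40) := by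
  have h1 := map_gE (Polynomial.evalRingHom (2 ^ 40 : ℤ)) (Tp 92161 303) 1
  simp only [Polynomial.coe_evalRingHom, Tp_eval] at h1
  rw [h1, gE_pos_neg]
  rw [← pow_mul]
  exact land_dvd _ _ _ big_check

lemma gE_one_coeff (n : ℕ) (hn : n < 92161) : PowerSeries.coeff n (gE Th 1) = 0 := by
  rw [← gE_coeff (K := 303) (by norm_num) 1 hn]
  refine digits (B := 2 ^ 40) (by positivity) 92161 _ (fun n => ?_) big_dvd n hn
  refine lt_of_le_of_lt ((Nb.gE (N := 2 * (303 : ℕ) + 1) (fun d => Nb.tp 92161 303 d)).le n) ?_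
  norm_num

lemma small_check : ∀ ε : Fin 5 → ℤˣ,
    ¬ ((2 ^ 8 : ℤ) ^ 70 ∣ gE (fun n => (tv 8 70 n 8 : ℤ)) ε) ∨ ε = 1 := by
  decide +kernel

theorem gE_Th_zero : gE Th 1 = 0 := by
  have hrep (ε : Fin 5 → ℤˣ) := QRep.gE (fun d hd => QRep.th d hd) ε
  obtain ⟨C, hC⟩ := (hrep 1).decay 92161 gE_one_coeff
  obtain ⟨ε, hε⟩ := sturm_step C hC
  have h0 : gE Th ε = 0 := by
    apply QRep.eq_zero
    have := hrep ε
    rwa [show (fun τ : UpperHalfPlane => gE (fun n => th n τ) ε) = fun _ => 0 from hε] at this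
  have h1 : (2 ^ 8 : ℤ) ^ 70 ∣ (gE (Tp 70 8) ε).eval (2 ^ 8) := by
    apply not_dvd_eval
    intro n hn
    rw [gE_coeff (by norm_num) ε hn, h0, map_zero]
  have h2 := map_gE (Polynomial.evalRingHom (2 ^ 8 : ℤ)) (Tp 70 8) ε
  simp only [Polynomial.coe_evalRingHom, Tp_eval] at h2
  rw [h2] at h1
  rcases small_check ε with h | h
  · exact absurd h1 h
  · rw [h] at h0; exact h0
end P10

section P11

def S3 (a b c M : ℤ) : Set (ℤ × ℤ × ℤ) := {p | M = a * p.1 ^ 2 + b * p.2.1 ^ 2 + c * p.2.2 ^ 2}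

lemma rep_S3 (a b c M : ℤ) : rep a b c 0 0 0 M = (S3 a b c M).ncard := by
  simp [rep, S3]

lemma rep_scale {a b c a' b' c' : ℤ} (k l m : ℤ) (hk : k ≠ 0) (hl : l ≠ 0) (hm : m ≠ 0)
    (ha : a' = a * k ^ 2) (hb : b' = b * l ^ 2) (hc : c' = c * m ^ 2) (M : ℤ) :
    rep a' b' c' 0 0 0 M = {p ∈ S3 a b c M | k ∣ p.1 ∧ l ∣ p.2.1 ∧ m ∣ p.2.2}.ncard := by
  have hinj : Function.Injective (fun p : ℤ × ℤ × ℤ => (k * p.1, l * p.2.1, m * p.2.2)) := by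
    rintro ⟨x, y, z⟩ ⟨x', y', z'⟩ h
    simp only [Prod.mk.injEq] at h ⊢
    exact ⟨mul_left_cancel₀ hk h.1, mul_left_cancel₀ hl h.2.1, mul_left_cancel₀ hm h.2.2⟩
  rw [rep_S3, ← Set.ncard_image_of_injective _ hinj]
  congr 1
  subst ha hb hc
  ext ⟨x, y, z⟩
  simp only [S3, Set.mem_image, Set.mem_ofPred_eq, Prod.mk.injEq, Prod.exists]
  constructor
  · rintro ⟨x', y', z', h, rfl, rfl, rfl⟩
    exact ⟨by rw [h]; ring, Dvd.intro _ rfl, Dvd.intro _ rfl, Dvd.intro _ rfl⟩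
  · rintro ⟨h, ⟨x', rfl⟩, ⟨y', rfl⟩, ⟨z', rfl⟩⟩
    exact ⟨x', y', z', by rw [h]; ring, rfl, rfl, rfl⟩

lemma sq8 (x : ℤ) : (x ^ 2 % 8 = 1 ∧ ¬ 2 ∣ x) ∨ (x ^ 2 % 8 = 0 ∧ 2 ∣ x) ∨ (x ^ 2 % 8 = 4 ∧ 2 ∣ x) := by
  have h : x % 8 = 0 ∨ x % 8 = 1 ∨ x % 8 = 2 ∨ x % 8 = 3 ∨ x % 8 = 4 ∨ x % 8 = 5 ∨ x % 8 = 6 ∨ x % 8 = 7 := by omega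
  rcases h with h | h | h | h | h | h | h | h <;> simp [pow_two, Int.mul_emod, h] <;> omega

/-- parity table on squares -/
def tab (a b c : ℤ) (f : Bool → Bool → Bool → Bool) : Prop :=
  ∀ u ∈ [(1, false), (0, true), (4, true)], ∀ v ∈ [(1, false), (0, true), (4, true)],
    ∀ w ∈ [((1 : ℤ), false), (0, true), (4, true)],
    (a * u.1 + b * v.1 + c * w.1) % 8 = 1 → f u.2 v.2 w.2 = true

instance (a b c : ℤ) (f : Bool → Bool → Bool → Bool) : Decidable (tab a b c f) := by
  unfold tab; infer_instance

lemma sq8' (x : ℤ) : ∃ u ∈ [((1 : ℤ), false), (0, true), (4, true)], x ^ 2 % 8 = u.1 % 8 ∧ (u.2 = true ↔ 2 ∣ x) := by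
  rcases sq8 x with h | h | h
  · exact ⟨(1, false), by simp, h.1, by simp [h.2]⟩
  · exact ⟨(0, true), by simp, h.1, by simp [h.2]⟩
  · exact ⟨(4, true), by simp, h.1, by simp [h.2]⟩

lemma tab_use {a b c : ℤ} {f : Bool → Bool → Bool → Bool} (h : tab a b c f) {M : ℤ} (h8 : M % 8 = 1)
    {p : ℤ × ℤ × ℤ} (hp : p ∈ S3 a b c M) :
    f (decide (2 ∣ p.1)) (decide (2 ∣ p.2.1)) (decide (2 ∣ p.2.2)) = true := by
  obtain ⟨u, hu, hu1, hu2⟩ := sq8' p.1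
  obtain ⟨v, hv, hv1, hv2⟩ := sq8' p.2.1
  obtain ⟨w, hw, hw1, hw2⟩ := sq8' p.2.2
  have e : M % 8 = (a * u.1 + b * v.1 + c * w.1) % 8 := by
    have hp' : M = a * p.1 ^ 2 + b * p.2.1 ^ 2 + c * p.2.2 ^ 2 := hp
    rw [hp']
    exact (((Int.ModEq.mul_left a hu1).add (Int.ModEq.mul_left b hv1)).add (Int.ModEq.mul_left c hw1))
  have := h u hu v hv w hw (by rw [← e, h8])
  have d1 : decide (2 ∣ p.1) = u.2 := by rw [Bool.eq_iff_iff]; simp [hu2]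
  have d2 : decide (2 ∣ p.2.1) = v.2 := by rw [Bool.eq_iff_iff]; simp [hv2]
  have d3 : decide (2 ∣ p.2.2) = w.2 := by rw [Bool.eq_iff_iff]; simp [hw2]
  rw [d1, d2, d3]; exact this

lemma rep_zero {a b c : ℤ} (h : tab a b c (fun _ _ _ => false)) {M : ℤ} (h8 : M % 8 = 1) :
    rep a b c 0 0 0 M = 0 := by
  rw [rep_S3]
  have : S3 a b c M = ∅ := by
    ext p
    simp only [Set.mem_empty_iff_false, iff_false]
    intro hp
    exact absurd (tab_use h h8 hp) (by simp)
  rw [this, Set.ncard_empty]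

lemma rep_y {a b c : ℤ} (h : tab a b c (fun _ y _ => y)) {M : ℤ} (h8 : M % 8 = 1) :
    rep a (b * 2 ^ 2) c 0 0 0 M = rep a b c 0 0 0 M := by
  rw [rep_scale (a := a) (b := b) (c := c) 1 2 1 (by simp) (by simp) (by simp) (by ring) rfl (by ring), rep_S3]
  congr 1
  ext p
  simp only [Set.mem_ofPred_eq, one_dvd, true_and, and_true, and_iff_left_iff_imp]
  intro hp
  simpa using tab_use h h8 hp

lemma rep_x {a b c : ℤ} (h : tab a b c (fun x _ _ => x)) {M : ℤ} (h8 : M % 8 = 1) :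
    rep (a * 2 ^ 2) b c 0 0 0 M = rep a b c 0 0 0 M := by
  rw [rep_scale (a := a) (b := b) (c := c) 2 1 1 (by simp) (by simp) (by simp) rfl (by ring) (by ring), rep_S3]
  congr 1
  ext p
  simp only [Set.mem_ofPred_eq, one_dvd, and_true, and_iff_left_iff_imp]
  intro hp
  simpa using tab_use h h8 hp

lemma rep_z {a b c : ℤ} (h : tab a b c (fun _ _ z => z)) {M : ℤ} (h8 : M % 8 = 1) :
    rep a b (c * 2 ^ 2) 0 0 0 M = rep a b c 0 0 0 M := by
  rw [rep_scale (a := a) (b := b) (c := c) 1 1 2 (by simp) (by simp) (by simp) (by ring) (by ring) rfl, rep_S3]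
  congr 1
  ext p
  simp only [Set.mem_ofPred_eq, one_dvd, true_and, and_iff_left_iff_imp]
  intro hp
  simpa using tab_use h h8 hp

lemma S3_sub_box {a b c M : ℤ} (ha : 0 < a) (hb : 0 < b) (hc : 0 < c) :
    S3 a b c M ⊆ ↑(Finset.Icc (-M) M ×ˢ (Finset.Icc (-M) M ×ˢ Finset.Icc (-M) M)) := by
  rintro ⟨x, y, z⟩ h
  have h' : M = a * x ^ 2 + b * y ^ 2 + c * z ^ 2 := h
  simp only [Finset.coe_product, Set.mem_prod, Finset.coe_Icc, Set.mem_Icc]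
  have hx : x ^ 2 ≤ M := by nlinarith [mul_nonneg hb.le (sq_nonneg y), mul_nonneg hc.le (sq_nonneg z), sq_nonneg x]
  have hy : y ^ 2 ≤ M := by nlinarith [mul_nonneg ha.le (sq_nonneg x), mul_nonneg hc.le (sq_nonneg z), sq_nonneg y]
  have hz : z ^ 2 ≤ M := by nlinarith [mul_nonneg ha.le (sq_nonneg x), mul_nonneg hb.le (sq_nonneg y), sq_nonneg z]
  have k : ∀ w : ℤ, w ^ 2 ≤ M → -M ≤ w ∧ w ≤ M := by
    intro w hw
    have h1 := Int.le_self_sq w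
    have h2 := Int.le_self_sq (-w)
    rw [neg_sq] at h2
    constructor <;> linarith
  exact ⟨k x hx, k y hy, k z hz⟩

lemma S3_fin {a b c : ℤ} (M : ℤ) (ha : 0 < a) (hb : 0 < b) (hc : 0 < c) : (S3 a b c M).Finite :=
  (Finset.finite_toSet _).subset (S3_sub_box ha hb hc)

lemma rep_5_12_60 {M : ℤ} (h8 : M % 8 = 1) :
    rep 5 12 60 0 0 0 M = rep 5 48 60 0 0 0 M + rep 5 12 240 0 0 0 M := by
  rw [rep_scale (a := 5) (b := 12) (c := 60) (a' := 5) (b' := 48) (c' := 60) 1 2 1 (by simp) (by simp) (by simp) (by ring) (by ring) (by ring),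
   rep_scale (a := 5) (b := 12) (c := 60) (a' := 5) (b' := 12) (c' := 240) 1 1 2 (by simp) (by simp) (by simp) (by ring) (by ring) (by ring), rep_S3]
  have hf := S3_fin M (show (0:ℤ) < 5 by simp) (show (0:ℤ) < 12 by simp) (show (0:ℤ) < 60 by simp)
  have ht : tab 5 12 60 (fun _ y z => xor y z) := by decide
  rw [← Set.ncard_union_eq ?_ (hf.subset (fun p hp => hp.1)) (hf.subset (fun p hp => hp.1))]
  · congr 1
    ext p
    simp only [Set.mem_union, Set.mem_ofPred_eq, one_dvd, true_and, and_true]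
    constructor
    · intro hp
      have := tab_use ht h8 hp
      simp at this
      tauto
    · tauto
  · rw [Set.disjoint_left]
    rintro p ⟨hp, h1⟩ ⟨_, h2⟩
    have := tab_use ht h8 hp
    simp at this
    tauto

lemma rep_5_12_18 {M : ℤ} (h8 : M % 8 = 1) : rep 5 12 18 12 0 0 M = rep 5 12 60 0 0 0 M := by
  have hinj : Function.Injective (fun p : ℤ × ℤ × ℤ => (p.1, p.2.1 - p.2.2, 2 * p.2.2)) := by
    rintro ⟨x, y, z⟩ ⟨x', y', z'⟩ h
    simp only [Prod.mk.injEq] at h ⊢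
    omega
  rw [rep_S3, rep, ← Set.ncard_image_of_injective (S3 5 12 60 M) hinj]
  congr 1
  ext ⟨x, y, z⟩
  simp only [S3, Set.mem_image, Set.mem_ofPred_eq, Prod.mk.injEq, Prod.exists]
  constructor
  · intro h
    have hz : 2 ∣ z := by
      by_contra hz
      have h1 : M = 5 * x ^ 2 + 3 * (2 * y + z) ^ 2 + 15 * z ^ 2 := by rw [h]; ring
      have hz' : ¬ 2 ∣ 2 * y + z := by omega
      rcases sq8 x with a | a | a <;> rcases sq8 (2 * y + z) with b | b | b <;>
        rcases sq8 z with c | c | c <;> omega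
    obtain ⟨w, rfl⟩ := hz
    exact ⟨x, y + w, w, by rw [h]; ring, rfl, by ring, rfl⟩
  · rintro ⟨x', y', z', h, rfl, rfl, rfl⟩
    rw [h]; ring
end P11

section P12
open Finset

noncomputable def Tq (K d : ℕ) : PowerSeries ℤ :=
  ∑ m ∈ Finset.Icc (-(K : ℤ)) K, PowerSeries.X ^ (d * m.natAbs ^ 2)

lemma natAbs_le_of {d n : ℕ} (hd : 0 < d) {m : ℤ} (h : d * m.natAbs ^ 2 ≤ n) : -(n : ℤ) ≤ m ∧ m ≤ n := by
  have h1 : m.natAbs ≤ n := by nlinarith [Nat.zero_le m.natAbs, Nat.le_self_pow (n := 2) (by norm_num) m.natAbs]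
  omega

lemma Tq_coeff {K d : ℕ} (hd : 0 < d) {n : ℕ} (hn : n ≤ K) :
    PowerSeries.coeff n (Tq K d) = PowerSeries.coeff n (Th d) := by
  rw [Th, PowerSeries.coeff_mk, Tq, map_sum]
  have : {m : ℤ | d * m.natAbs ^ 2 = n} = ((Finset.Icc (-(K : ℤ)) K).filter fun m => d * m.natAbs ^ 2 = n : Finset ℤ) := by
    ext m
    simp only [Set.mem_ofPred_eq, coe_filter, Finset.mem_Icc, iff_and_self]
    intro h
    have := natAbs_le_of hd h.le
    omega
  rw [this, Set.ncard_coe_finset]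
  simp [PowerSeries.coeff_X_pow, eq_comm]

lemma mul_coeff_congr {A A' B B' : PowerSeries ℤ} {n : ℕ}
    (hA : ∀ m ≤ n, PowerSeries.coeff m A = PowerSeries.coeff m A')
    (hB : ∀ m ≤ n, PowerSeries.coeff m B = PowerSeries.coeff m B') :
    ∀ m ≤ n, PowerSeries.coeff m (A * B) = PowerSeries.coeff m (A' * B') := by
  intro m hm
  rw [PowerSeries.coeff_mul, PowerSeries.coeff_mul]
  refine Finset.sum_congr rfl fun p hp => ?_
  have := Finset.HasAntidiagonal.mem_antidiagonal.1 hp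
  rw [hA _ (by omega), hB _ (by omega)]

lemma coeff_Th3 {a b c : ℕ} (ha : 0 < a) (hb : 0 < b) (hc : 0 < c) (n : ℕ) :
    PowerSeries.coeff n (Th a * Th b * Th c) = (rep a b c 0 0 0 n : ℤ) := by
  rw [← mul_coeff_congr (mul_coeff_congr (fun m hm => Tq_coeff ha hm) (fun m hm => Tq_coeff hb hm))
    (fun m hm => Tq_coeff hc hm) n le_rfl]
  have hs : S3 a b c n = (((Finset.Icc (-(n : ℤ)) n ×ˢ (Finset.Icc (-(n : ℤ)) n ×ˢ Finset.Icc (-(n : ℤ)) n)).filter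
      fun p => a * p.1.natAbs ^ 2 + b * p.2.1.natAbs ^ 2 + c * p.2.2.natAbs ^ 2 = n : Finset _) : Set (ℤ × ℤ × ℤ)) := by
    ext p
    have e : (p ∈ S3 a b c n) ↔ a * p.1.natAbs ^ 2 + b * p.2.1.natAbs ^ 2 + c * p.2.2.natAbs ^ 2 = n := by
      rw [← Int.natCast_inj]
      push_cast
      simp only [sq_abs]
      exact eq_comm
    rw [Finset.coe_filter, Set.mem_ofPred_eq, ← e]
    refine ⟨fun h => ⟨?_, h⟩, fun h => h.2⟩
    exact_mod_cast S3_sub_box (by exact_mod_cast ha) (by exact_mod_cast hb) (by exact_mod_cast hc) h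
  rw [rep_S3, hs, Set.ncard_coe_finset, Tq, Tq, Tq, Finset.sum_mul_sum, Finset.sum_mul, Finset.card_filter]
  simp only [Finset.sum_mul, Finset.mul_sum, map_sum, ← pow_add, PowerSeries.coeff_X_pow, Finset.sum_product]
  push_cast
  refine Finset.sum_congr rfl fun x _ => ?_
  rw [Finset.sum_comm]
  refine Finset.sum_congr rfl fun y _ => Finset.sum_congr rfl fun z _ => ?_
  exact if_congr eq_comm rfl rfl
end P12

section P13
open Finset

/-- divisibility indicator -/
def i3 (x : ℤ) : ℤ := if 3 ∣ x then 1 else 0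

lemma i3_id (t a b : ℤ) : 3 * (i3 (t + a + b) + i3 (t + -a + b) + i3 (t + a + -b) + i3 (t + -a + -b)) =
    3 + 27 * (i3 t * i3 a * i3 b) - 9 * (i3 t * i3 a) - 9 * (i3 a * i3 b) - 9 * (i3 t * i3 b)
      + 3 * i3 t + 3 * i3 a + 3 * i3 b := by
  have k : ∀ x : ℤ, (i3 x = 1 ∧ x % 3 = 0) ∨ (i3 x = 0 ∧ x % 3 = 1) ∨ (i3 x = 0 ∧ x % 3 = 2) := by
    intro x
    unfold i3
    split_ifs <;> omega
  have k1 := k (t + a + b)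
  have k2 := k (t + -a + b)
  have k3 := k (t + a + -b)
  have k4 := k (t + -a + -b)
  rcases k t with ⟨h1, h1'⟩ | ⟨h1, h1'⟩ | ⟨h1, h1'⟩ <;> rcases k a with ⟨h2, h2'⟩ | ⟨h2, h2'⟩ | ⟨h2, h2'⟩ <;>
    rcases k b with ⟨h3, h3'⟩ | ⟨h3, h3'⟩ | ⟨h3, h3'⟩ <;> rw [h1, h2, h3] <;> omega

lemma i3_2 (x y : ℤ) : i3 x * i3 y = if 3 ∣ x ∧ 3 ∣ y then 1 else 0 := by
  unfold i3
  by_cases h1 : 3 ∣ x <;> by_cases h2 : 3 ∣ y <;> simp [h1, h2]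

lemma i3_3 (x y z : ℤ) : i3 x * i3 y * i3 z = if 3 ∣ x ∧ 3 ∣ y ∧ 3 ∣ z then 1 else 0 := by
  unfold i3
  by_cases h1 : 3 ∣ x <;> by_cases h2 : 3 ∣ y <;> by_cases h3 : 3 ∣ z <;> simp [h1, h2, h3]

lemma rep_swap (a b c M : ℤ) : rep a b c 0 0 0 M = rep a c b 0 0 0 M := by
  have hinj : Function.Injective (fun p : ℤ × ℤ × ℤ => (p.1, p.2.2, p.2.1)) := by
    rintro ⟨x, y, z⟩ ⟨x', y', z'⟩ h
    simp only [Prod.mk.injEq] at h ⊢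
    omega
  rw [rep_S3, rep_S3, ← Set.ncard_image_of_injective _ hinj]
  congr 1
  ext ⟨x, y, z⟩
  simp only [S3, Set.mem_image, Set.mem_ofPred_eq, Prod.mk.injEq, Prod.exists]
  constructor
  · rintro ⟨x', y', z', h, rfl, rfl, rfl⟩
    rw [h]; ring
  · intro h
    exact ⟨x, z, y, by rw [h]; ring, rfl, rfl, rfl⟩

noncomputable def SF (M : ℤ) : Finset (ℤ × ℤ × ℤ) :=
  (S3_fin M (show (0:ℤ) < 1 by simp) (show (0:ℤ) < 40 by simp) (show (0:ℤ) < 40 by simp)).toFinset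

lemma mem_SF {M : ℤ} {p : ℤ × ℤ × ℤ} : p ∈ SF M ↔ M = p.1 ^ 2 + 40 * p.2.1 ^ 2 + 40 * p.2.2 ^ 2 := by
  simp [SF, S3]

lemma SF_ncard (M : ℤ) (q : ℤ × ℤ × ℤ → Prop) [DecidablePred q] :
    ({p ∈ S3 1 40 40 M | q p}.ncard : ℤ) = ∑ p ∈ SF M, if q p then 1 else 0 := by
  have : {p ∈ S3 1 40 40 M | q p} = ((SF M).filter q : Finset _) := by
    ext p; simp [SF]
  rw [this, Set.ncard_coe_finset, Finset.card_filter]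
  push_cast; rfl

lemma SF_flip (M : ℤ) (g : ℤ → ℤ → ℤ → ℤ) (s s' : ℤ) (hs : s * s = 1) (hs' : s' * s' = 1) :
    ∑ p ∈ SF M, g p.1 (s * p.2.1) (s' * p.2.2) = ∑ p ∈ SF M, g p.1 p.2.1 p.2.2 := by
  have e : ∀ x : ℤ, s * (s * x) = x := fun x => by rw [← mul_assoc, hs, one_mul]
  have e' : ∀ x : ℤ, s' * (s' * x) = x := fun x => by rw [← mul_assoc, hs', one_mul]
  refine Finset.sum_nbij' (fun p => (p.1, s * p.2.1, s' * p.2.2)) (fun p => (p.1, s * p.2.1, s' * p.2.2))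
    ?_ ?_ ?_ ?_ ?_
  · intro p hp
    rw [mem_SF] at hp ⊢
    rw [hp]
    linear_combination (-40 * p.2.1 ^ 2) * hs + (-40 * p.2.2 ^ 2) * hs'
  · intro p hp
    rw [mem_SF] at hp ⊢
    rw [hp]
    linear_combination (-40 * p.2.1 ^ 2) * hs + (-40 * p.2.2 ^ 2) * hs'
  · intro p _
    simp [e, e']
  · intro p _
    simp [e, e']
  · intro p _
    rfl

lemma rep_9_11 {M : ℤ} (h8 : M % 8 = 1) :
    (rep 9 11 11 2 6 6 M : ℤ) = ∑ p ∈ SF M, i3 (p.1 + p.2.1 + p.2.2) := by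
  unfold i3
  rw [← SF_ncard M (fun p => 3 ∣ p.1 + p.2.1 + p.2.2)]
  have hinj : Function.Injective (fun p : ℤ × ℤ × ℤ => (3 * p.1 + p.2.1 + p.2.2, p.2.1, p.2.2)) := by
    rintro ⟨x, y, z⟩ ⟨x', y', z'⟩ h
    simp only [Prod.mk.injEq] at h ⊢
    omega
  have hinj2 : Function.Injective (fun p : ℤ × ℤ × ℤ => (p.1, 2 * p.2.1, 2 * p.2.2)) := by
    rintro ⟨x, y, z⟩ ⟨x', y', z'⟩ h
    simp only [Prod.mk.injEq] at h ⊢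
    omega
  rw [rep, ← Set.ncard_image_of_injective _ hinj, ← Set.ncard_image_of_injective {p ∈ S3 1 40 40 M | 3 ∣ p.1 + p.2.1 + p.2.2} hinj2]
  congr 2
  ext ⟨x, y, z⟩
  simp only [S3, Set.mem_image, Set.mem_ofPred_eq, Prod.mk.injEq, Prod.exists]
  constructor
  · rintro ⟨x, y, z, h, rfl, rfl, rfl⟩
    have h1 : M = 1 * (3 * x + y + z) ^ 2 + 10 * y ^ 2 + 10 * z ^ 2 := by rw [h]; ring
    have hh := tab_use (show tab 1 10 10 (fun _ y z => y && z) by decide) h8 (p := (3 * x + y + z, y, z)) h1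
    simp only [Bool.and_eq_true, decide_eq_true_eq] at hh
    obtain ⟨⟨y, rfl⟩, ⟨z, rfl⟩⟩ := hh
    exact ⟨3 * x + 2 * y + 2 * z, y, z, ⟨by rw [h]; ring, ⟨x + y + z, by ring⟩⟩, rfl, rfl, rfl⟩
  · rintro ⟨t, a, b, ⟨h, w, hw⟩, rfl, rfl, rfl⟩
    refine ⟨w - a - b, 2 * a, 2 * b, ?_, by linarith, rfl, rfl⟩
    have : t = 3 * w - a - b := by linarith
    rw [h, this]; ring

lemma twelveN {M : ℤ} (h8 : M % 8 = 1) :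
    12 * (rep 9 11 11 2 6 6 M : ℤ) = 3 * rep 1 40 40 0 0 0 M + 27 * rep 9 360 360 0 0 0 M
      - 18 * rep 9 360 40 0 0 0 M + 3 * rep 9 40 40 0 0 0 M - 9 * rep 1 360 360 0 0 0 M
      + 6 * rep 1 360 40 0 0 0 M := by
  have f1 := SF_flip M (fun t a b => i3 (t + a + b)) (-1) 1 (by norm_num) (by norm_num)
  have f2 := SF_flip M (fun t a b => i3 (t + a + b)) 1 (-1) (by norm_num) (by norm_num)
  have f3 := SF_flip M (fun t a b => i3 (t + a + b)) (-1) (-1) (by norm_num) (by norm_num)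
  simp only [one_mul, neg_mul] at f1 f2 f3
  have key := Finset.sum_congr (rfl : SF M = SF M) (fun p _ => i3_id p.1 p.2.1 p.2.2)
  simp only [Finset.sum_add_distrib, Finset.sum_sub_distrib, ← Finset.mul_sum] at key
  rw [f1, f2, f3, ← rep_9_11 h8] at key
  have r0 : (rep 1 40 40 0 0 0 M : ℤ) = ∑ p ∈ SF M, (1 : ℤ) := by
    rw [rep_S3, ← Set.sep_true (s := S3 1 40 40 M), SF_ncard M (fun _ => True)]; simp
  have rs : ∀ {a b c : ℤ} (k l m : ℤ) (hk : k ≠ 0) (hl : l ≠ 0) (hm : m ≠ 0)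
    (ha : a = 1 * k ^ 2) (hb : b = 40 * l ^ 2) (hc : c = 40 * m ^ 2), (rep a b c 0 0 0 M : ℤ) =
      ∑ p ∈ SF M, if k ∣ p.1 ∧ l ∣ p.2.1 ∧ m ∣ p.2.2 then 1 else 0 := by
    intro a b c k l m hk hl hm ha hb hc
    rw [rep_scale k l m hk hl hm ha hb hc, SF_ncard M (fun p => k ∣ p.1 ∧ l ∣ p.2.1 ∧ m ∣ p.2.2)]
  have r1 := rs (a := 9) (b := 360) (c := 360) 3 3 3 (by simp) (by simp) (by simp) (by simp) (by simp) (by simp)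
  have r2 := rs (a := 9) (b := 360) (c := 40) 3 3 1 (by simp) (by simp) (by simp) (by simp) (by simp) (by simp)
  have r2' := rs (a := 9) (b := 40) (c := 360) 3 1 3 (by simp) (by simp) (by simp) (by simp) (by simp) (by simp)
  have r3 := rs (a := 9) (b := 40) (c := 40) 3 1 1 (by simp) (by simp) (by simp) (by simp) (by simp) (by simp)
  have r4 := rs (a := 1) (b := 360) (c := 360) 1 3 3 (by simp) (by simp) (by simp) (by simp) (by simp) (by simp)
  have r5 := rs (a := 1) (b := 360) (c := 40) 1 3 1 (by simp) (by simp) (by simp) (by simp) (by simp) (by simp)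
  have r5' := rs (a := 1) (b := 40) (c := 360) 1 1 3 (by simp) (by simp) (by simp) (by simp) (by simp) (by simp)
  have c1 : ∑ p ∈ SF M, i3 p.1 * i3 p.2.1 * i3 p.2.2 = rep 9 360 360 0 0 0 M := by
    rw [r1]; refine Finset.sum_congr rfl fun p _ => ?_
    rw [i3_3]
  have c2 : ∑ p ∈ SF M, i3 p.1 * i3 p.2.1 = rep 9 360 40 0 0 0 M := by
    rw [r2]; refine Finset.sum_congr rfl fun p _ => ?_
    rw [i3_2]; simp only [one_dvd, and_true, true_and]
  have c2' : ∑ p ∈ SF M, i3 p.1 * i3 p.2.2 = rep 9 360 40 0 0 0 M := by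
    rw [rep_swap, r2']; refine Finset.sum_congr rfl fun p _ => ?_
    rw [i3_2]; simp only [one_dvd, and_true, true_and]
  have c3 : ∑ p ∈ SF M, i3 p.1 = rep 9 40 40 0 0 0 M := by
    rw [r3]; refine Finset.sum_congr rfl fun p _ => ?_
    simp only [i3, one_dvd, and_true, true_and]
  have c4 : ∑ p ∈ SF M, i3 p.2.1 * i3 p.2.2 = rep 1 360 360 0 0 0 M := by
    rw [r4]; refine Finset.sum_congr rfl fun p _ => ?_
    rw [i3_2]; simp only [one_dvd, and_true, true_and]
  have c5 : ∑ p ∈ SF M, i3 p.2.1 = rep 1 360 40 0 0 0 M := by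
    rw [r5]; refine Finset.sum_congr rfl fun p _ => ?_
    simp only [i3, one_dvd, and_true, true_and]
  have c5' : ∑ p ∈ SF M, i3 p.2.2 = rep 1 360 40 0 0 0 M := by
    rw [rep_swap, r5']; refine Finset.sum_congr rfl fun p _ => ?_
    simp only [i3, one_dvd, and_true, true_and]
  have c0 : ∑ p ∈ SF M, (3 : ℤ) = 3 * rep 1 40 40 0 0 0 M := by
    rw [r0, Finset.mul_sum]; simp
  rw [c1, c2, c2', c3, c4, c5, c5', c0] at key
  linarith
end P13

section P14

lemma gE_expand {R : Type*} [CommRing R] (t : ℕ → R) : gE t 1 =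
    (3 : ℤ) • (t 1 * t 8 * t 8) + (-3 : ℤ) • (t 4 * t 8 * t 8) + (-3 : ℤ) • (t 1 * t 120 * t 120) + (3 : ℤ) • (t 4 * t 120 * t 120) + (-3 : ℤ) • (t 1 * t 40 * t 40) + (3 : ℤ) • (t 4 * t 40 * t 40) + (-27 : ℤ) • (t 9 * t 360 * t 360) + (27 : ℤ) • (t 36 * t 360 * t 360) + (9 : ℤ) • (t 1 * t 360 * t 360) + (-9 : ℤ) • (t 4 * t 360 * t 360) + (18 : ℤ) • (t 9 * t 360 * t 40) + (-18 : ℤ) • (t 36 * t 360 * t 40) + (-6 : ℤ) • (t 1 * t 360 * t 40) + (6 : ℤ) • (t 4 * t 360 * t 40) + (-3 : ℤ) • (t 9 * t 40 * t 40) + (3 : ℤ) • (t 36 * t 40 * t 40) + (-6 : ℤ) • (t 24 * t 10 * t 15) + (6 : ℤ) • (t 24 * t 10 * t 60) + (6 : ℤ) • (t 24 * t 40 * t 15) + (-6 : ℤ) • (t 24 * t 40 * t 60) + (-6 : ℤ) • (t 3 * t 40 * t 30) + (6 : ℤ) • (t 3 * t 40 * t 120) + (6 : ℤ) • (t 12 *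 t 40 * t 30) + (-6 : ℤ) • (t 12 * t 40 * t 120) + (-6 : ℤ) • (t 5 * t 6 * t 30) + (6 : ℤ) • (t 5 * t 6 * t 120) + (6 : ℤ) • (t 5 * t 24 * t 30) + (-6 : ℤ) • (t 5 * t 24 * t 120) + (6 : ℤ) • (t 20 * t 6 * t 30) + (-6 : ℤ) • (t 20 * t 6 * t 120) + (-6 : ℤ) • (t 20 * t 24 * t 30) + (6 : ℤ) • (t 20 * t 24 * t 120) + (-6 : ℤ) • (t 2 * t 15 * t 120) + (6 : ℤ) • (t 2 * t 60 * t 120) + (6 : ℤ) • (t 8 * t 15 * t 120) + (-6 : ℤ) • (t 8 * t 60 * t 120) + (-6 : ℤ) • (t 5 * t 48 * t 60) + (12 : ℤ) • (t 5 * t 48 * t 240) + (6 : ℤ) • (t 20 * t 48 * t 60) + (-12 : ℤ) • (t 20 * t 48 * t 240) + (-6 : ℤ) • (t 5 * t 12 * t 240) + (6 : ℤ) • (t 20 * t 12 * t 240) := by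
  simp [gE, Q0, Qk, Fin.sum_univ_succ]
  ring

lemma coeff_term {a b c : ℕ} (ha : 0 < a) (hb : 0 < b) (hc : 0 < c) (k : ℤ) (n : ℕ) :
    PowerSeries.coeff n (k • (Th a * Th b * Th c)) = k * (rep a b c 0 0 0 n : ℤ) := by
  rw [map_zsmul, coeff_Th3 ha hb hc, smul_eq_mul]

theorem disc3600_identity (M : ℤ) (hM : 0 < M) (h8 : M % 8 = 1) :
    rep 1 8 8 0 0 0 M =
      rep 1 30 30 0 0 0 M + 2 * rep 6 10 15 0 0 0 M + 2 * rep 3 10 30 0 0 0 M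
        + 2 * rep 5 6 30 0 0 0 M + 4 * rep 9 11 11 2 6 6 M + 2 * rep 2 15 30 0 0 0 M
        + 2 * rep 5 12 18 12 0 0 M := by
  have main : PowerSeries.coeff M.toNat (gE Th 1) = 0 := by rw [gE_Th_zero, map_zero]
  rw [gE_expand] at main
  simp only [map_add] at main
  iterate 42 rw [coeff_term (by norm_num) (by norm_num) (by norm_num)] at main
  rw [Int.toNat_of_nonneg hM.le] at main
  push_cast at main
  have z0 := rep_zero (show tab 4 8 8 (fun _ _ _ => false) by decide) h8
  have z1 := rep_zero (show tab 4 120 120 (fun _ _ _ => false) by decide) h8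
  have z2 := rep_zero (show tab 4 40 40 (fun _ _ _ => false) by decide) h8
  have z3 := rep_zero (show tab 36 360 360 (fun _ _ _ => false) by decide) h8
  have z4 := rep_zero (show tab 4 360 360 (fun _ _ _ => false) by decide) h8
  have z5 := rep_zero (show tab 36 360 40 (fun _ _ _ => false) by decide) h8
  have z6 := rep_zero (show tab 4 360 40 (fun _ _ _ => false) by decide) h8
  have z7 := rep_zero (show tab 36 40 40 (fun _ _ _ => false) by decide) h8
  have z8 := rep_zero (show tab 24 10 60 (fun _ _ _ => false) by decide) h8
  have z9 := rep_zero (show tab 24 40 15 (fun _ _ _ => false) by decide) h8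
  have z10 := rep_zero (show tab 24 40 60 (fun _ _ _ => false) by decide) h8
  have z11 := rep_zero (show tab 3 40 120 (fun _ _ _ => false) by decide) h8
  have z12 := rep_zero (show tab 12 40 30 (fun _ _ _ => false) by decide) h8
  have z13 := rep_zero (show tab 12 40 120 (fun _ _ _ => false) by decide) h8
  have z14 := rep_zero (show tab 5 6 120 (fun _ _ _ => false) by decide) h8
  have z15 := rep_zero (show tab 5 24 30 (fun _ _ _ => false) by decide) h8
  have z16 := rep_zero (show tab 5 24 120 (fun _ _ _ => false) by decide) h8
  have z17 := rep_zero (show tab 20 6 30 (fun _ _ _ => false) by decide) h8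
  have z18 := rep_zero (show tab 20 6 120 (fun _ _ _ => false) by decide) h8
  have z19 := rep_zero (show tab 20 24 30 (fun _ _ _ => false) by decide) h8
  have z20 := rep_zero (show tab 20 24 120 (fun _ _ _ => false) by decide) h8
  have z21 := rep_zero (show tab 2 60 120 (fun _ _ _ => false) by decide) h8
  have z22 := rep_zero (show tab 8 15 120 (fun _ _ _ => false) by decide) h8
  have z23 := rep_zero (show tab 8 60 120 (fun _ _ _ => false) by decide) h8
  have z24 := rep_zero (show tab 5 48 240 (fun _ _ _ => false) by decide) h8
  have z25 := rep_zero (show tab 20 48 60 (fun _ _ _ => false) by decide) h8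
  have z26 := rep_zero (show tab 20 48 240 (fun _ _ _ => false) by decide) h8
  have z27 := rep_zero (show tab 20 12 240 (fun _ _ _ => false) by decide) h8
  have N := twelveN h8
  have e1 : rep 1 120 120 0 0 0 M = rep 1 30 30 0 0 0 M := by
    rw [show (120 : ℤ) = 30 * 2 ^ 2 by norm_num, rep_y (by decide) h8, rep_z (by decide) h8]
  have e2 : rep 24 10 15 0 0 0 M = rep 6 10 15 0 0 0 M := rep_x (a := 6) (by decide) h8
  have e3 : rep 3 40 30 0 0 0 M = rep 3 10 30 0 0 0 M := rep_y (b := 10) (by decide) h8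
  have e4 : rep 2 15 120 0 0 0 M = rep 2 15 30 0 0 0 M := rep_z (c := 30) (by decide) h8
  have e5 := rep_5_12_60 h8
  have e6 := rep_5_12_18 h8
  zify at *
  rw [z0, z1, z2, z3, z4, z5, z6, z7, z8, z9, z10, z11, z12, z13, z14, z15, z16, z17, z18, z19, z20, z21, z22, z23, z24, z25, z26, z27] at main
  linarith
end P14
end
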